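/- arXiv:math/0307280 — 11 statements merged into one kernel-verified Lean document; each statement's English description precedes it below -/
import Mathlib

section
/- Let k be an infinite field, let n ≥ 2 and 2 ≤ p ≤ n. In k[x_1, ..., x_n], the ideal generated by the polynomials ∏_{i<j, i ≡_λ j} (x_i − x_j), where λ ranges over all partitions of [n] into exactly p−1 blocks, equals the intersection ⋂_{σ ⊆ [n], |σ| = p} ⟨x_i − x_j : i, j ∈ σ⟩. -/
open MvPolynomial

/-- A tableau filled with `1, …, n`, recorded as the map sending an entry to its cell
`(row, column)`; the cells form a Young diagram. -/
def IsTableau {n : ℕ} (T : Fin n → ℕ × ℕ) : Prop :=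
  Function.Injective T ∧ IsLowerSet (Set.range T)

/-- A family of shapes containing, with the shape of `T`, the shape of every tableau whose rows
meet each column of `T` at most once (an upper set for the dominance order on conjugates). -/
def ShapeClosed (n : ℕ) (E : Set (Set (ℕ × ℕ))) : Prop :=
  ∀ T T' : Fin n → ℕ × ℕ, IsTableau T → IsTableau T' → Set.range T ∈ E →
    (∀ i j, (T i).2 = (T j).2 → (T' i).1 = (T' j).1 → i = j) → Set.range T' ∈ E

/-- The shapes that can be brought into `E` by adding one cell in a row of index at most `c`. -/
def shapesBelow (c : ℕ) (E : Set (Set (ℕ × ℕ))) : Set (Set (ℕ × ℕ)) :=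
  {S | ∃ q, q ∉ S ∧ q.1 ≤ c ∧ IsLowerSet (insert q S) ∧ insert q S ∈ E}

/-- The Specht polynomial of a tableau: the product of the differences of the pairs of variables
lying in a common column. -/
noncomputable def spechtPoly (k : Type*) [Field k] {n : ℕ} (T : Fin n → ℕ × ℕ) :
    MvPolynomial (Fin n) k :=
  ∏ i, ∏ j, if i < j ∧ (T i).2 = (T j).2 then X i - X j else 1

/-- The ideal generated by the Specht polynomials of the tableaux with shape in `E`. -/
noncomputable def spechtIdeal (k : Type*) [Field k] (n : ℕ) (E : Set (Set (ℕ × ℕ))) :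
    Ideal (MvPolynomial (Fin n) k) :=
  Ideal.span {f | ∃ T : Fin n → ℕ × ℕ, IsTableau T ∧ Set.range T ∈ E ∧ f = spechtPoly k T}

/-- `f` vanishes at the points whose coordinates coincide exactly along the rows of a tableau with
shape outside `E`. -/
def VanishesOff {k : Type*} [Field k] {n : ℕ} (E : Set (Set (ℕ × ℕ)))
    (f : MvPolynomial (Fin n) k) : Prop :=
  ∀ (x : Fin n → k) (T : Fin n → ℕ × ℕ), IsTableau T → Set.range T ∉ E →
    (∀ i j, (T i).1 = (T j).1 ↔ x i = x j) → eval x f = 0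

lemma isTableau_cons {n : ℕ} {T : Fin n → ℕ × ℕ} (hT : IsTableau T) {q : ℕ × ℕ}
    (hq : q ∉ Set.range T) (hl : IsLowerSet (insert q (Set.range T))) :
    IsTableau (Fin.cons q T : Fin (n + 1) → ℕ × ℕ) := by
  refine ⟨Fin.cons_injective_iff.2 ⟨hq, hT.1⟩, ?_⟩
  rwa [Fin.range_cons]

/-- A new entry can be added to a row of length equal to that of row `r`, up to permuting rows of
equal length. -/
lemma IsTableau.exists_extension {n : ℕ} {T : Fin n → ℕ × ℕ} (hT : IsTableau T) (r : ℕ) :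
    ∃ T' : Fin (n + 1) → ℕ × ℕ, IsTableau T' ∧
      (∀ i j : Fin n, (T' i.succ).1 = (T' j.succ).1 ↔ (T i).1 = (T j).1) ∧
      (∀ i : Fin n, (T' 0).1 = (T' i.succ).1 ↔ (T i).1 = r) ∧
      (T' 0).1 ≤ r ∧ T' 0 ∉ Set.range T ∧ Set.range T' = insert (T' 0) (Set.range T) := by
  classical
  have hfin : (Set.range T).Finite := Set.finite_range T
  have hex : ∃ m, (r, m) ∉ Set.range T := by
    by_contra! h
    have hinj : Function.Injective (fun m : ℕ => (r, m)) := fun a b hab => by simpa using hab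
    exact Set.infinite_of_injective_forall_mem hinj h hfin
  let m := Nat.find hex
  have hm : (r, m) ∉ Set.range T := Nat.find_spec hex
  have hm' : ∀ m' < m, (r, m') ∈ Set.range T := fun m' h => not_not.1 (Nat.find_min hex h)
  have hex2 : ∃ t, (t, m) ∉ Set.range T := ⟨r, hm⟩
  let t := Nat.find hex2
  have ht : (t, m) ∉ Set.range T := Nat.find_spec hex2
  have ht' : ∀ t' < t, (t', m) ∈ Set.range T := fun m' h => not_not.1 (Nat.find_min hex2 h)
  have htr : t ≤ r := Nat.find_min' hex2 hm
  have htm : ∀ s, (t, s) ∈ Set.range T ↔ s < m := by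
    intro s
    refine ⟨fun h => ?_, fun h => hT.2 (Prod.mk_le_mk.2 ⟨htr, le_rfl⟩) (hm' s h)⟩
    by_contra! hs
    exact ht (hT.2 (Prod.mk_le_mk.2 ⟨le_rfl, hs⟩) h)
  have hrm : ∀ s, (r, s) ∈ Set.range T ↔ s < m := by
    intro s
    refine ⟨fun h => ?_, hm' s⟩
    by_contra! hs
    exact hm (hT.2 (Prod.mk_le_mk.2 ⟨le_rfl, hs⟩) h)
  let w : ℕ × ℕ → ℕ × ℕ := fun q => (Equiv.swap t r q.1, q.2)
  have hww : ∀ q, w (w q) = q := fun q => by simp [w]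
  have hwmem : ∀ q ∈ Set.range T, w q ∈ Set.range T := by
    rintro ⟨a, s⟩ h
    simp only [w]
    rcases eq_or_ne a t with rfl | hat
    · rw [Equiv.swap_apply_left, hrm]
      exact (htm s).1 h
    rcases eq_or_ne a r with rfl | har
    · rw [Equiv.swap_apply_right, htm]
      exact (hrm s).1 h
    rwa [Equiv.swap_apply_of_ne_of_ne hat har]
  have hrange : Set.range (w ∘ T) = Set.range T := by
    apply Set.Subset.antisymm
    · rintro _ ⟨i, rfl⟩
      exact hwmem _ ⟨i, rfl⟩
    · intro q hq
      obtain ⟨i, hi⟩ := hwmem q hq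
      exact ⟨i, by simp [hi, hww]⟩
  have hwT : IsTableau (w ∘ T) :=
    ⟨(Function.LeftInverse.injective hww).comp hT.1, hrange ▸ hT.2⟩
  have hlow : IsLowerSet (insert (t, m) (Set.range T)) := by
    rintro a ⟨b₁, b₂⟩ hb ha
    rcases ha with rfl | ha
    · obtain ⟨h1, h2⟩ := Prod.mk_le_mk.1 hb
      rcases h2.lt_or_eq with h2 | rfl
      · exact Or.inr (hT.2 (Prod.mk_le_mk.2 ⟨h1, le_rfl⟩) ((htm b₂).2 h2))
      · rcases h1.lt_or_eq with h1 | rfl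
        · exact Or.inr (ht' _ h1)
        · exact Or.inl rfl
    · exact Or.inr (hT.2 hb ha)
  refine ⟨Fin.cons (t, m) (w ∘ T),
    isTableau_cons hwT (by rwa [hrange]) (by rwa [hrange]), ?_, ?_, ?_, ?_, ?_⟩
  · intro i j
    simp [w]
  · intro i
    simp only [Fin.cons_zero, Fin.cons_succ, Function.comp, w]
    rw [eq_comm, Equiv.swap_apply_eq_iff, Equiv.swap_apply_left]
  · simpa using htr
  · simpa using ht
  · rw [Fin.range_cons, hrange, Fin.cons_zero]

lemma IsTableau.card_column_le {n : ℕ} {T : Fin n → ℕ × ℕ} (hT : IsTableau T) {q : ℕ × ℕ}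
    (hq : q ∉ Set.range T) :
    (Finset.univ.filter fun i => q.2 = (T i).2).card ≤ q.1 := by
  rw [← Finset.card_range q.1]
  refine Finset.card_le_card_of_injOn (fun i => (T i).1) ?_ ?_
  · intro i hi
    have hi : q.2 = (T i).2 := by simpa using hi
    simp only [Finset.coe_range, Set.mem_Iio]
    by_contra! h
    exact hq (hT.2 (show q ≤ T i from ⟨h, hi.le⟩) ⟨i, rfl⟩)
  · intro i hi j hj hij
    have hi : q.2 = (T i).2 := by simpa using hi
    have hj : q.2 = (T j).2 := by simpa using hj
    exact hT.1 (Prod.ext hij (hi.symm.trans hj))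

lemma ShapeClosed.shapesBelow {n : ℕ} {E : Set (Set (ℕ × ℕ))} (hE : ShapeClosed (n + 1) E)
    (c : ℕ) : ShapeClosed n (shapesBelow c E) := by
  classical
  rintro T T' hT hT' ⟨q, hq, hqc, hql, hqE⟩ hTT'
  have hcard : ((Finset.univ.filter fun i => q.2 = (T i).2).image fun i => (T' i).1).card
      < (Finset.range (c + 1)).card := by
    rw [Finset.card_range]
    exact Nat.lt_succ_of_le (Finset.card_image_le.trans ((hT.card_column_le hq).trans hqc))
  obtain ⟨r, hrc, hr⟩ := Finset.exists_mem_notMem_of_card_lt_card hcard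
  have hr : ∀ i, q.2 = (T i).2 → (T' i).1 ≠ r := by simpa using hr
  obtain ⟨T'', hT'', h1, h2, h3, h4, h5⟩ := hT'.exists_extension r
  refine ⟨T'' 0, h4, h3.trans (Nat.lt_succ_iff.1 (Finset.mem_range.1 hrc)), h5 ▸ hT''.2, ?_⟩
  rw [← h5]
  refine hE (Fin.cons q T) T'' (isTableau_cons hT hq hql) hT'' (by rwa [Fin.range_cons]) ?_
  intro i j
  refine Fin.cases ?_ (fun i => ?_) i <;> refine Fin.cases ?_ (fun j => ?_) j
  · simp
  · intro ha hb
    exact absurd ((h2 j).1 hb) (hr j (by simpa using ha))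
  · intro ha hb
    exact absurd ((h2 i).1 hb.symm) (hr i (by simpa using ha.symm))
  · intro ha hb
    rw [hTT' i j (by simpa using ha) ((h1 i j).1 hb)]

section

variable {k : Type*} [Field k]

lemma VanishesOff.sub {n : ℕ} {E : Set (Set (ℕ × ℕ))} {f g : MvPolynomial (Fin n) k}
    (hf : VanishesOff E f) (hg : VanishesOff E g) : VanishesOff E (f - g) :=
  fun x T hT hTE hx => by rw [map_sub, hf x T hT hTE hx, hg x T hT hTE hx, sub_zero]

lemma spechtPoly_vanishesOff {n : ℕ} {E : Set (Set (ℕ × ℕ))} (hE : ShapeClosed n E)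
    {T : Fin n → ℕ × ℕ} (hT : IsTableau T) (hTE : Set.range T ∈ E) :
    VanishesOff E (spechtPoly k T) := by
  intro x T' hT' hT'E hx
  by_contra hne
  refine hT'E (hE T T' hT hT' hTE fun i j hc hr => ?_)
  have key : ∀ i j, i < j → (T i).2 = (T j).2 → (T' i).1 ≠ (T' j).1 := by
    intro i j hij hc hr
    apply hne
    rw [spechtPoly, map_prod]
    refine Finset.prod_eq_zero (Finset.mem_univ i) ?_
    rw [map_prod]
    refine Finset.prod_eq_zero (Finset.mem_univ j) ?_
    rw [if_pos ⟨hij, hc⟩]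
    simp [(hx i j).1 hr]
  rcases lt_trichotomy i j with h | h | h
  · exact absurd hr (key i j h hc)
  · exact h
  · exact absurd hr.symm (key j i h hc.symm)

lemma vanishesOff_of_mem_spechtIdeal {n : ℕ} {E : Set (Set (ℕ × ℕ))} (hE : ShapeClosed n E)
    {f : MvPolynomial (Fin n) k} (hf : f ∈ spechtIdeal k n E) : VanishesOff E f := by
  intro x T hT hTE hx
  have hle : spechtIdeal k n E ≤ RingHom.ker (eval x) := by
    refine Ideal.span_le.2 ?_
    rintro _ ⟨T', hT', hT'E, rfl⟩
    exact spechtPoly_vanishesOff hE hT' hT'E x T hT hTE hx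
  exact hle hf

lemma finSuccEquiv_spechtPoly_cons {n : ℕ} (T : Fin n → ℕ × ℕ) (q : ℕ × ℕ) :
    finSuccEquiv k n (spechtPoly k (Fin.cons q T : Fin (n + 1) → ℕ × ℕ)) =
      (∏ j ∈ Finset.univ.filter (fun j => q.2 = (T j).2), (Polynomial.X - Polynomial.C (X j))) *
        Polynomial.C (spechtPoly k T) := by
  rw [spechtPoly, Fin.prod_univ_succ, map_mul]
  congr 1
  · rw [Fin.prod_univ_succ, map_mul, map_prod, Finset.prod_filter]
    simp only [lt_irrefl, false_and, if_false, map_one, one_mul, Fin.cons_zero, Fin.cons_succ,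
      Fin.succ_pos, true_and]
    refine Finset.prod_congr rfl fun j _ => ?_
    split_ifs
    · rw [map_sub, finSuccEquiv_X_zero, finSuccEquiv_X_succ]
    · rw [map_one]
  · rw [spechtPoly, map_prod, map_prod]
    refine Finset.prod_congr rfl fun i _ => ?_
    rw [Fin.prod_univ_succ, map_mul, map_prod, map_prod]
    simp only [Fin.not_lt_zero, false_and, if_false, map_one, one_mul, Fin.cons_succ,
      Fin.succ_lt_succ_iff]
    refine Finset.prod_congr rfl fun j _ => ?_
    split_ifs
    · rw [map_sub, map_sub, finSuccEquiv_X_succ, finSuccEquiv_X_succ]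
    · rw [map_one, map_one]

/-- Every element of the ideal of `shapesBelow c E` is the coefficient of degree `c` of an element
of the ideal of `E` of degree at most `c` in the first variable. -/
lemma exists_lift_of_mem_spechtIdeal {n : ℕ} {E : Set (Set (ℕ × ℕ))} {c : ℕ}
    {g : MvPolynomial (Fin n) k} (hg : g ∈ spechtIdeal k n (shapesBelow c E)) :
    ∃ F ∈ spechtIdeal k (n + 1) E,
      (finSuccEquiv k n F).natDegree ≤ c ∧ (finSuccEquiv k n F).coeff c = g := by
  induction hg using Submodule.span_induction with
  | mem g hg =>
    obtain ⟨T, hT, ⟨q, hq, hqc, hql, hqE⟩, rfl⟩ := hg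
    have hA := (hT.card_column_le hq).trans hqc
    set A := Finset.univ.filter fun j => q.2 = (T j).2 with hAdef
    let M : Polynomial (MvPolynomial (Fin n) k) :=
      Polynomial.X ^ (c - A.card) * ∏ j ∈ A, (Polynomial.X - Polynomial.C (X j))
    have hmon : (∏ j ∈ A, (Polynomial.X - Polynomial.C (X j : MvPolynomial (Fin n) k))).Monic :=
      Polynomial.monic_prod_of_monic _ _ fun j _ => Polynomial.monic_X_sub_C _
    have hM : M.Monic := (Polynomial.monic_X_pow _).mul hmon
    have hdeg : M.natDegree = c := by
      rw [(Polynomial.monic_X_pow _).natDegree_mul hmon, Polynomial.natDegree_X_pow,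
        Polynomial.natDegree_prod_of_monic _ _ fun j _ => Polynomial.monic_X_sub_C _]
      simp only [Polynomial.natDegree_X_sub_C, Finset.sum_const, smul_eq_mul, mul_one]
      omega
    have hF : finSuccEquiv k n (X 0 ^ (c - A.card) *
        spechtPoly k (Fin.cons q T : Fin (n + 1) → ℕ × ℕ)) =
        M * Polynomial.C (spechtPoly k T) := by
      rw [map_mul, map_pow, finSuccEquiv_X_zero, finSuccEquiv_spechtPoly_cons, ← hAdef, mul_assoc]
    refine ⟨X 0 ^ (c - A.card) * spechtPoly k (Fin.cons q T : Fin (n + 1) → ℕ × ℕ),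
      Ideal.mul_mem_left _ _ (Ideal.subset_span
        ⟨_, isTableau_cons hT hq hql, by rwa [Fin.range_cons], rfl⟩), ?_, ?_⟩
    · rw [hF]
      exact (Polynomial.natDegree_mul_C_le _ _).trans hdeg.le
    · rw [hF, Polynomial.coeff_mul_C]
      conv_lhs => rw [← hdeg]
      rw [hM.coeff_natDegree, one_mul]
  | zero => exact ⟨0, Ideal.zero_mem _, by simp, by simp⟩
  | add g₁ g₂ _ _ h₁ h₂ =>
    obtain ⟨F₁, hF₁, hd₁, hc₁⟩ := h₁
    obtain ⟨F₂, hF₂, hd₂, hc₂⟩ := h₂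
    refine ⟨F₁ + F₂, Ideal.add_mem _ hF₁ hF₂, ?_, ?_⟩
    · rw [map_add]
      exact Polynomial.natDegree_add_le_of_degree_le hd₁ hd₂
    · rw [map_add, Polynomial.coeff_add, hc₁, hc₂]
  | smul a g _ h =>
    obtain ⟨F, hF, hd, hc⟩ := h
    have ha : finSuccEquiv k n ((finSuccEquiv k n).symm (Polynomial.C a) * F) =
        Polynomial.C a * finSuccEquiv k n F := by
      rw [map_mul, AlgEquiv.apply_symm_apply]
    refine ⟨(finSuccEquiv k n).symm (Polynomial.C a) * F, Ideal.mul_mem_left _ _ hF, ?_, ?_⟩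
    · rw [ha]
      exact (Polynomial.natDegree_C_mul_le _ _).trans hd
    · rw [ha, Polynomial.coeff_C_mul, hc, smul_eq_mul]

lemma VanishesOff.coeff_finSuccEquiv [Infinite k] {n : ℕ} {E : Set (Set (ℕ × ℕ))} {c : ℕ}
    {f : MvPolynomial (Fin (n + 1)) k} (hf : VanishesOff E f)
    (hdeg : (finSuccEquiv k n f).degree < (c + 1 : ℕ)) :
    VanishesOff (shapesBelow c E) ((finSuccEquiv k n f).coeff c) := by
  classical
  intro x T hT hTE hx
  let P : Polynomial k := (finSuccEquiv k n f).map (eval x)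
  suffices hP : P = 0 by
    have := congrArg (fun P => Polynomial.coeff P c) hP
    simpa [P] using this
  have hroot : ∀ r ≤ c, ∀ y, (∀ i, (T i).1 = r ↔ x i = y) → P.eval y = 0 := by
    intro r hr y hy
    obtain ⟨T', hT', h1, h2, h3, h4, h5⟩ := hT.exists_extension r
    rw [← eval_eq_eval_mv_eval']
    refine hf _ T' hT' (fun hmem => hTE
      ⟨T' 0, h4, h3.trans hr, h5 ▸ hT'.2, h5 ▸ hmem⟩) ?_
    intro i j
    refine Fin.cases ?_ (fun i => ?_) i <;> refine Fin.cases ?_ (fun j => ?_) j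
    · simp
    · rw [h2, hy, Fin.cons_zero, Fin.cons_succ, eq_comm]
    · rw [eq_comm, h2, hy, Fin.cons_zero, Fin.cons_succ]
    · rw [h1, hx, Fin.cons_succ, Fin.cons_succ]
  by_cases hrow : ∃ r ≤ c, ∀ i, (T i).1 ≠ r
  · obtain ⟨r, hr, hri⟩ := hrow
    refine Polynomial.eq_zero_of_infinite_isRoot P
      ((Set.finite_range x).infinite_compl.mono fun y hy => ?_)
    refine hroot r hr y fun i => ⟨fun h => absurd h (hri i), fun h => absurd ⟨i, h⟩ hy⟩
  · push Not at hrow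
    choose e he using fun r : Fin (c + 1) => hrow r (Nat.lt_succ_iff.1 r.2)
    have hinj : Function.Injective (fun r => x (e r)) := by
      intro r s hrs
      have := (hx _ _).2 hrs
      rw [he, he] at this
      exact Fin.ext this
    refine Polynomial.eq_zero_of_degree_lt_of_eval_finset_eq_zero
      (Finset.univ.image fun r => x (e r)) ?_ ?_
    · rw [Finset.card_image_of_injective _ hinj, Finset.card_univ, Fintype.card_fin]
      exact Polynomial.degree_map_le.trans_lt hdeg
    · intro y hy
      obtain ⟨r, -, rfl⟩ := Finset.mem_image.1 hy
      refine hroot r (Nat.lt_succ_iff.1 r.2) _ fun i => ?_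
      rw [← hx, he]

theorem VanishesOff.mem_spechtIdeal [Infinite k] {n : ℕ} {E : Set (Set (ℕ × ℕ))}
    (hE : ShapeClosed n E) {f : MvPolynomial (Fin n) k} (hf : VanishesOff E f) :
    f ∈ spechtIdeal k n E := by
  induction n generalizing E with
  | zero =>
    have hT : IsTableau (Fin.elim0 : Fin 0 → ℕ × ℕ) :=
      ⟨fun i => i.elim0, by rw [Set.range_eq_empty]; exact isLowerSet_empty⟩
    by_cases h : Set.range (Fin.elim0 : Fin 0 → ℕ × ℕ) ∈ E
    · have h1 : (1 : MvPolynomial (Fin 0) k) ∈ spechtIdeal k 0 E :=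
        Ideal.subset_span ⟨_, hT, h, by simp [spechtPoly]⟩
      rw [(Ideal.eq_top_iff_one _).2 h1]
      exact Submodule.mem_top
    · have h0 := hf Fin.elim0 _ hT h fun i => i.elim0
      have hf0 : f = 0 := MvPolynomial.funext fun x => by
        rw [Subsingleton.elim x Fin.elim0, h0, map_zero]
      rw [hf0]
      exact Ideal.zero_mem _
  | succ n ih =>
    suffices h : ∀ (N : ℕ) (f : MvPolynomial (Fin (n + 1)) k), VanishesOff E f →
        (finSuccEquiv k n f).degree < N → f ∈ spechtIdeal k (n + 1) E from
      h _ f hf (Polynomial.degree_le_natDegree.trans_lt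
        (Nat.cast_lt.2 (Nat.lt_succ_self _)))
    intro N
    induction N with
    | zero =>
      intro f _ hd
      have h0 : finSuccEquiv k n f = 0 := by
        rw [← Polynomial.degree_eq_bot]
        exact Nat.WithBot.lt_zero_iff.1 (by simpa using hd)
      rw [(map_eq_zero_iff _ (finSuccEquiv k n).injective).1 h0]
      exact Ideal.zero_mem _
    | succ c ihc =>
      intro f hf hd
      obtain ⟨F, hF, hFd, hFc⟩ := exists_lift_of_mem_spechtIdeal
        (ih (hE.shapesBelow c) (hf.coeff_finSuccEquiv hd))
      have hsub : f - F ∈ spechtIdeal k (n + 1) E := by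
        refine ihc _ (hf.sub (vanishesOff_of_mem_spechtIdeal hE hF)) ?_
        rw [Polynomial.degree_lt_iff_coeff_zero]
        intro m hm
        rw [map_sub, Polynomial.coeff_sub]
        rcases hm.lt_or_eq with hm | rfl
        · rw [(Polynomial.degree_lt_iff_coeff_zero _ _).1 hd m hm,
            Polynomial.coeff_eq_zero_of_natDegree_lt (hFd.trans_lt hm), sub_zero]
        · rw [hFc, sub_self]
      simpa using Ideal.add_mem _ hsub hF

end

/-- A row reaching column `m` contains `m + 1` entries. -/
lemma IsTableau.exists_subset_row {n : ℕ} {T : Fin n → ℕ × ℕ} (hT : IsTableau T) {m : ℕ}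
    {i : Fin n} (hi : m ≤ (T i).2) :
    ∃ σ : Finset (Fin n), σ.card = m + 1 ∧ ∀ j ∈ σ, (T j).1 = (T i).1 := by
  classical
  have h : ∀ s : Fin (m + 1), ∃ j, T j = ((T i).1, (s : ℕ)) := fun s =>
    hT.2 (show ((T i).1, (s : ℕ)) ≤ T i from
      ⟨le_rfl, (Nat.lt_succ_iff.1 s.2).trans hi⟩) ⟨i, rfl⟩
  choose e he using h
  refine ⟨Finset.univ.image e, ?_, ?_⟩
  · rw [Finset.card_image_of_injective, Finset.card_univ, Fintype.card_fin]
    intro s s' hs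
    have := (he s).symm.trans ((congrArg T hs).trans (he s'))
    exact Fin.ext (Prod.ext_iff.1 this).2
  · intro j hj
    obtain ⟨s, -, rfl⟩ := Finset.mem_image.1 hj
    rw [he]

lemma shapeClosed_columns_lt (n m : ℕ) : ShapeClosed n {S | ∀ q ∈ S, q.2 < m} := by
  intro T T' hT hT' hTm hTT'
  rintro _ ⟨i, rfl⟩
  by_contra! h
  obtain ⟨σ, hσ, hrow⟩ := hT'.exists_subset_row h
  obtain ⟨a, ha, b, hb, hab, hcol⟩ := Finset.exists_ne_map_eq_of_card_lt_of_maps_to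
    (s := σ) (t := Finset.range m) (by rw [hσ, Finset.card_range]; exact Nat.lt_succ_self m)
    (f := fun j => (T j).2) (fun j _ => by simpa using hTm _ ⟨j, rfl⟩)
  exact hab (hTT' a b hcol ((hrow a ha).trans (hrow b hb).symm))

/-- A coloring of `n` points by `m ≤ n` colors can be refined to one using all the colors. -/
lemma exists_surjective_refinement {n m : ℕ} (hmn : m ≤ n) (c : Fin n → Fin m) :
    ∃ d : Fin n → Fin m, Function.Surjective d ∧ ∀ i j, d i = d j → c i = c j := by
  classical
  obtain ⟨d, hd, hmax⟩ := Finset.exists_max_image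
    (Finset.univ.filter fun d : Fin n → Fin m => ∀ i j, d i = d j → c i = c j)
    (fun d => (Finset.univ.image d).card) ⟨c, by simp⟩
  simp only [Finset.mem_filter, Finset.mem_univ, true_and] at hd hmax
  refine ⟨d, ?_, hd⟩
  by_contra hsurj
  obtain ⟨a, ha⟩ : ∃ a, ∀ i, d i ≠ a := by simpa [Function.Surjective] using hsurj
  have hlt : (Finset.univ.image d).card < m := by
    conv_rhs => rw [← Fintype.card_fin m, ← Finset.card_univ]
    exact Finset.card_lt_card (Finset.ssubset_univ_iff.2 fun h => by
      have := h ▸ Finset.mem_univ a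
      simp [ha] at this)
  have hninj : ¬ Function.Injective d := fun h => by
    rw [Finset.card_image_of_injective _ h, Finset.card_univ, Fintype.card_fin] at hlt
    omega
  obtain ⟨i, j, hij, hne⟩ : ∃ i j, d i = d j ∧ i ≠ j := by
    simpa [Function.Injective] using hninj
  have hle := hmax (Function.update d i a) fun s t hst => by
    by_cases hs : s = i <;> by_cases ht : t = i
    · rw [hs, ht]
    · rw [hs, Function.update_self, Function.update_of_ne ht] at hst
      exact absurd hst.symm (ha t)
    · rw [ht, Function.update_self, Function.update_of_ne hs] at hst
      exact absurd hst (ha s)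
    · rw [Function.update_of_ne hs, Function.update_of_ne ht] at hst
      exact hd s t hst
  refine absurd hle (not_le.2 (Finset.card_lt_card ((Finset.ssubset_iff_of_subset ?_).2
    ⟨a, Finset.mem_image.2 ⟨i, Finset.mem_univ i, Function.update_self ..⟩, by simp [ha]⟩)))
  intro y hy
  obtain ⟨s, -, rfl⟩ := Finset.mem_image.1 hy
  by_cases hs : s = i
  · subst hs
    exact Finset.mem_image.2 ⟨j, Finset.mem_univ j, by rw [Function.update_of_ne hne.symm, hij]⟩
  · exact Finset.mem_image.2 ⟨s, Finset.mem_univ s, Function.update_of_ne hs ..⟩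

/-- The fibers of a surjective coloring form a partition with as many blocks as colors. -/
lemma exists_finpartition_of_surjective {n m : ℕ} {d : Fin n → Fin m}
    (hd : Function.Surjective d) :
    ∃ P : Finpartition (Finset.univ : Finset (Fin n)), P.parts.card = m ∧
      ∀ i j, (∃ b ∈ P.parts, i ∈ b ∧ j ∈ b) → d i = d j := by
  classical
  let F : Fin m → Finset (Fin n) := fun a => Finset.univ.filter fun i => d i = a
  have hF : Function.Injective F := by
    intro a b hab
    obtain ⟨i, rfl⟩ := hd a
    have : i ∈ F b := hab ▸ (by simp [F])
    simpa [F] using this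
  refine ⟨Finpartition.ofExistsUnique (Finset.univ.image F) (fun _ _ => Finset.subset_univ _)
    (fun i _ => ⟨F (d i), ⟨by simp, by simp [F]⟩, ?_⟩) ?_, ?_, ?_⟩
  · rintro b ⟨hb, hib⟩
    obtain ⟨a, -, rfl⟩ := Finset.mem_image.1 hb
    have : d i = a := by simpa [F] using hib
    rw [this]
  · intro h
    obtain ⟨a, -, ha⟩ := Finset.mem_image.1 h
    obtain ⟨i, rfl⟩ := hd a
    have : i ∈ F (d i) := by simp [F]
    simp [ha] at this
  · simp [Finpartition.ofExistsUnique, Finset.card_image_of_injective _ hF]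
  · rintro i j ⟨b, hb, hi, hj⟩
    obtain ⟨a, -, rfl⟩ := Finset.mem_image.1 hb
    have hi : d i = a := by simpa [F] using hi
    have hj : d j = a := by simpa [F] using hj
    rw [hi, hj]

/-- In `k[x_1,…,x_n]`, the ideal generated by the products
`∏_{i<j, i ≡_λ j} (x_i - x_j)`, `λ` running over partitions of `{1,…,n}` into exactly
`p-1` blocks, equals the intersection `⋂_{σ ⊆ [n], |σ| = p} ⟨x_i - x_j : i,j ∈ σ⟩`. -/
theorem liLi_ideal_eq_inf (k : Type*) [Field k] [Infinite k] (n p : ℕ) (hn : 2 ≤ n)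
    (hp : 2 ≤ p) (hpn : p ≤ n) :
    Ideal.span {f : MvPolynomial (Fin n) k |
        ∃ P : Finpartition (Finset.univ : Finset (Fin n)), P.parts.card = p - 1 ∧
          f = ∏ q ∈ Finset.univ.filter
              (fun q : Fin n × Fin n => q.1 < q.2 ∧ ∃ b ∈ P.parts, q.1 ∈ b ∧ q.2 ∈ b),
            (X q.1 - X q.2)} =
      ⨅ σ : {σ : Finset (Fin n) // σ.card = p},
        Ideal.span {f : MvPolynomial (Fin n) k |
          ∃ i ∈ σ.1, ∃ j ∈ σ.1, f = X i - X j} := by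
  classical
  apply le_antisymm
  · refine Ideal.span_le.2 ?_
    rintro _ ⟨P, hP, rfl⟩
    refine (Submodule.mem_iInf _).2 fun ⟨σ, hσ⟩ => ?_
    obtain ⟨i, hi, j, hj, hij, hpart⟩ := Finset.exists_ne_map_eq_of_card_lt_of_maps_to
      (s := σ) (t := P.parts) (by omega) (f := P.part)
      (fun i _ => P.part_mem.2 (Finset.mem_univ i))
    wlog hlt : i < j generalizing i j
    · exact this j hj i hi hij.symm hpart.symm (lt_of_le_of_ne (not_lt.1 hlt) hij.symm)
    have hmem : (i, j) ∈ Finset.univ.filter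
        (fun q : Fin n × Fin n => q.1 < q.2 ∧ ∃ b ∈ P.parts, q.1 ∈ b ∧ q.2 ∈ b) :=
      Finset.mem_filter.2 ⟨Finset.mem_univ _, hlt, P.part i, P.part_mem.2 (Finset.mem_univ i),
        P.mem_part (Finset.mem_univ i), hpart ▸ P.mem_part (Finset.mem_univ j)⟩
    exact Ideal.mem_of_dvd _ (Finset.dvd_prod_of_mem _ hmem)
      (Ideal.subset_span ⟨i, hi, j, hj, rfl⟩)
  · intro f hf
    have hvan : VanishesOff {S | ∀ q ∈ S, q.2 < p - 1} f := by
      intro x T hT hTE hx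
      obtain ⟨i, hi⟩ : ∃ i, p - 1 ≤ (T i).2 := by
        by_contra! h
        exact hTE (by rintro _ ⟨i, rfl⟩; exact h i)
      obtain ⟨σ, hσ, hrow⟩ := hT.exists_subset_row hi
      have hle : Ideal.span {f : MvPolynomial (Fin n) k |
          ∃ i ∈ σ, ∃ j ∈ σ, f = X i - X j} ≤ RingHom.ker (eval x) := by
        refine Ideal.span_le.2 ?_
        rintro _ ⟨a, ha, b, hb, rfl⟩
        simp [RingHom.mem_ker, (hx a b).1 ((hrow a ha).trans (hrow b hb).symm)]
      exact hle ((Submodule.mem_iInf _).1 hf ⟨σ, by omega⟩)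
    refine Ideal.span_le.2 ?_ (hvan.mem_spechtIdeal (shapeClosed_columns_lt n (p - 1)))
    rintro _ ⟨T, hT, hTE, rfl⟩
    obtain ⟨d, hd, hdT⟩ := exists_surjective_refinement (m := p - 1) (by omega)
      (fun i => ⟨(T i).2, hTE _ ⟨i, rfl⟩⟩)
    obtain ⟨P, hP, hPd⟩ := exists_finpartition_of_surjective hd
    refine Ideal.mem_of_dvd _ ?_ (Ideal.subset_span ⟨P, hP, rfl⟩)
    rw [spechtPoly, ← Fintype.prod_prod_type'
      (f := fun i j => if i < j ∧ (T i).2 = (T j).2 then X i - X j else 1), ← Finset.prod_filter]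
    refine Finset.prod_dvd_prod_of_subset _ _ _ fun q hq => ?_
    obtain ⟨-, hlt, hb⟩ := Finset.mem_filter.1 hq
    exact Finset.mem_filter.2
      ⟨Finset.mem_univ _, hlt, by simpa using hdT _ _ (hPd _ _ hb)⟩
end

section
/- Let m ≥ 2, n ≥ 2 and 2 ≤ p ≤ n. In ℂ[x_1, ..., x_n], the ideal generated by the polynomials ∏_{i<j, i ≡_λ j} (x_i^m − x_j^m), where λ ranges over all partitions of [n] into exactly p−1 blocks, equals the intersection ⋂_{σ ⊆ [n], |σ| = p} ⟨x_i^m − x_j^m : i, j ∈ σ⟩. -/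
open MvPolynomial

/-- The number of indices receiving each label. -/
noncomputable def labelSizes {n : ℕ} (T : Fin n → ℕ) : ℕ →₀ ℕ := ∑ j, Finsupp.single (T j) 1

/-- The total number of elements in excess of `t` over all blocks, where `b` records block sizes.
Comparing these functions pointwise is the dominance order on block sizes. -/
def excess (b : ℕ →₀ ℕ) (t : ℕ) : ℕ := b.sum fun _ s => s - t

/-- Discrete convexity of a sequence of natural numbers. -/
def ConvexSeq (F : ℕ → ℕ) : Prop := ∀ t, 2 * F (t + 1) ≤ F t + F (t + 2)

/-- The multiplicity of a value in a tuple. -/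
def mult {α : Type*} [DecidableEq α] {n : ℕ} (x : Fin n → α) (v : α) : ℕ :=
  (Finset.univ.filter fun j => x j = v).card

/-- The number of later positions carrying the same value. -/
def rank {α : Type*} [DecidableEq α] {n : ℕ} (x : Fin n → α) (j : Fin n) : ℕ :=
  (Finset.univ.filter fun i => j < i ∧ x i = x j).card

lemma labelSizes_apply {n : ℕ} (T : Fin n → ℕ) (i : ℕ) :
    labelSizes T i = (Finset.univ.filter fun j => T j = i).card := by
  rw [labelSizes, Finsupp.finsetSum_apply, Finset.card_filter]
  simp only [Finsupp.single_apply]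

lemma labelSizes_cons {n : ℕ} (a : ℕ) (T : Fin n → ℕ) :
    labelSizes (Fin.cons a T : Fin (n + 1) → ℕ) = labelSizes T + Finsupp.single a 1 := by
  simp [labelSizes, Fin.sum_univ_succ, add_comm]

lemma excess_add_single (b : ℕ →₀ ℕ) (a t : ℕ) :
    excess (b + Finsupp.single a 1) t = excess b t + if t ≤ b a then 1 else 0 := by
  classical
  have hs : (b + Finsupp.single a 1).support ⊆ insert a b.support := by
    intro i hi
    by_cases h : i = a
    · simp [h]
    · simpa [h, Finsupp.single_apply, Ne.symm h] using hi
  rw [excess, excess, Finsupp.sum_of_support_subset _ hs _ (by simp),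
    Finsupp.sum_of_support_subset b (Finset.subset_insert a _) _ (by simp),
    ← Finset.add_sum_erase _ _ (Finset.mem_insert_self a b.support),
    ← Finset.add_sum_erase _ (fun x => b x - t) (Finset.mem_insert_self a b.support)]
  have : ∑ x ∈ (insert a b.support).erase a, ((b + Finsupp.single a 1 : ℕ →₀ ℕ) x - t) =
      ∑ x ∈ (insert a b.support).erase a, (b x - t) := by
    refine Finset.sum_congr rfl fun x hx => ?_
    have : a ≠ x := (Finset.ne_of_mem_erase hx).symm
    simp [this]
  rw [this]
  simp only [Finsupp.add_apply, Finsupp.single_eq_same]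
  split_ifs <;> omega

lemma convexSeq_excess (b : ℕ →₀ ℕ) : ConvexSeq (excess b) := by
  intro t
  simp only [excess, Finsupp.sum, Finset.mul_sum, ← Finset.sum_add_distrib]
  exact Finset.sum_le_sum fun i _ => by omega

lemma excess_affine {b : ℕ →₀ ℕ} {t : ℕ} (h : ∀ i, b i ≠ t + 1) :
    2 * excess b (t + 1) = excess b t + excess b (t + 2) := by
  simp only [excess, Finsupp.sum, Finset.mul_sum, ← Finset.sum_add_distrib]
  exact Finset.sum_congr rfl fun i _ => by have := h i; omega

/-- A convex sequence below an affine one, up to one unit at the left end, is strictly below the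
raised sequence in the interior. -/
lemma ConvexSeq.le_of_affine {F E : ℕ → ℕ} (hF : ConvexSeq F) {s d : ℕ}
    (hE : ∀ t, s ≤ t → t < d → 2 * E (t + 1) = E t + E (t + 2))
    (hs : F s ≤ E s + 1) (hd : F (d + 1) ≤ E (d + 1)) {t : ℕ} (hst : s < t) (htd : t ≤ d) :
    F t ≤ E t := by
  classical
  by_contra hcon
  have hex : ∃ t, s < t ∧ t ≤ d ∧ E t < F t := ⟨t, hst, htd, not_le.1 hcon⟩
  obtain ⟨h1, h2, h3⟩ := Nat.find_spec hex
  have hmin := fun k => Nat.find_min hex (m := k)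
  set u := Nat.find hex
  have hpos : F (u - 1) ≤ E (u - 1) + 1 := by
    by_cases h : u - 1 = s
    · rwa [h]
    · have := hmin (u - 1) (by omega)
      by_contra hc
      exact this ⟨by omega, by omega, by omega⟩
  have key : ∀ k, u + k ≤ d + 1 → E (u + k) < F (u + k) ∧
      (F (u + k - 1) + E (u + k) ≤ F (u + k) + E (u + k - 1)) := by
    intro k
    induction k with
    | zero => intro _; exact ⟨h3, by simp only [add_zero]; omega⟩
    | succ k ih =>
      intro hk
      obtain ⟨i1, i2⟩ := ih (by omega)
      have c1 := hF (u + k - 1)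
      have c2 := hE (u + k - 1) (by omega) (by omega)
      rw [show u + k - 1 + 1 = u + k by omega, show u + k - 1 + 2 = u + k + 1 by omega] at c1 c2
      rw [show u + (k + 1) = u + k + 1 by omega, show u + k + 1 - 1 = u + k by omega]
      omega
  have := (key (d + 1 - u) (by omega)).1
  rw [show u + (d + 1 - u) = d + 1 by omega] at this
  omega

/-- If a convex sequence fits below `excess b` raised by one up to `q`, then some block of size
at most `q` can be enlarged so that the new excess dominates the sequence. -/
lemma exists_le_excess_add_single {b : ℕ →₀ ℕ} {q : ℕ} {F : ℕ → ℕ} (hF : ConvexSeq F)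
    (h : ∀ t, F t ≤ excess b t + if t ≤ q then 1 else 0) :
    ∃ a, b a ≤ q ∧ F ≤ excess (b + Finsupp.single a 1) := by
  classical
  obtain ⟨a₀, ha₀⟩ := Infinite.exists_notMem_finset b.support
  have hspec := Nat.findGreatest_spec (P := fun s => s ≤ q ∧ ∃ a, b a = s) (n := q)
    (m := 0) (by omega) ⟨by omega, a₀, by simpa using ha₀⟩
  have hmax := fun k => Nat.findGreatest_is_greatest (P := fun s => s ≤ q ∧ ∃ a, b a = s)
    (n := q) (k := k)
  set s := Nat.findGreatest (fun s => s ≤ q ∧ ∃ a, b a = s) q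
  obtain ⟨hsq, a, ha⟩ := hspec
  refine ⟨a, by omega, fun t => ?_⟩
  rw [excess_add_single, ha]
  have ht := h t
  by_cases hts : t ≤ s
  · simpa [hts, hts.trans hsq] using ht
  by_cases htq : t ≤ q
  · rw [if_neg hts]
    refine hF.le_of_affine (s := s) (d := q) (fun u hu hu' => excess_affine fun i hi => ?_)
      (by simpa [hsq] using h s) (by simpa using h (q + 1)) (by omega) htq
    exact hmax (u + 1) (by omega) (by omega) ⟨by omega, i, hi⟩
  · simpa [hts, htq] using ht

section Rank

variable {α : Type*} [DecidableEq α] {n : ℕ}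

lemma rank_cons (y : α) (x : Fin n → α) :
    rank (Fin.cons y x : Fin (n + 1) → α) = Fin.cons (mult x y) (rank x) := by
  funext j
  refine Fin.cases ?_ (fun j => ?_) j
  · simp [rank, mult, Fin.univ_succ, Finset.filter_insert, Finset.filter_map]
  · simp [rank, Fin.univ_succ, Finset.filter_insert, Finset.filter_map]

lemma rank_lt_of_lt {x : Fin n → α} {i j : Fin n} (h : x i = x j) (hij : i < j) :
    rank x j < rank x i := by
  refine Finset.card_lt_card ⟨fun k hk => ?_, fun hsub => ?_⟩
  · simp only [Finset.mem_filter, Finset.mem_univ, true_and] at hk ⊢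
    exact ⟨hij.trans hk.1, hk.2.trans h.symm⟩
  · have := @hsub j (by simp [hij, h])
    simp at this

lemma eq_of_rank_eq {x : Fin n → α} {i j : Fin n} (h : x i = x j) (hr : rank x i = rank x j) :
    i = j := by
  rcases lt_trichotomy i j with hij | hij | hij
  · have := rank_lt_of_lt h hij; omega
  · exact hij
  · have := rank_lt_of_lt h.symm hij; omega

lemma rank_lt_mult (x : Fin n → α) (j : Fin n) : rank x j < mult x (x j) := by
  refine Finset.card_lt_card ⟨fun k hk => ?_, fun hsub => ?_⟩
  · simp only [Finset.mem_filter, Finset.mem_univ, true_and] at hk ⊢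
    exact hk.2
  · have := @hsub j (by simp)
    simp at this

lemma exists_rank_eq {x : Fin n → α} {v : α} {i : ℕ} (h : i < mult x v) :
    ∃ j, x j = v ∧ rank x j = i := by
  have := Finset.surjOn_of_injOn_of_card_le (s := Finset.univ.filter fun j => x j = v)
    (t := Finset.range (mult x v)) (rank x)
    (fun j hj => by
      simp only [Finset.coe_filter, Finset.mem_univ, true_and, Set.mem_ofPred_eq] at hj
      simpa [hj] using rank_lt_mult x j)
    (fun j hj k hk hjk => by
      simp only [Finset.coe_filter, Finset.mem_univ, true_and, Set.mem_ofPred_eq] at hj hk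
      exact eq_of_rank_eq (hj.trans hk.symm) hjk)
    (by simp [mult])
  obtain ⟨j, hj, hji⟩ := this (by simpa using h : i ∈ (Finset.range (mult x v) : Set ℕ))
  exact ⟨j, by simpa using hj, hji⟩

lemma mult_le (x : Fin n → α) (v : α) : mult x v ≤ n := by
  simpa [mult] using Finset.card_filter_le (Finset.univ : Finset (Fin n)) fun j => x j = v

/-- Outside any finite set there is an element of maximal multiplicity. -/
lemma exists_max_mult_notMem [Infinite α] (x : Fin n → α) (V : Finset α) :
    ∃ w, w ∉ V ∧ ∀ v, v ∉ V → mult x v ≤ mult x w := by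
  classical
  obtain ⟨w₀, hw₀⟩ := Infinite.exists_notMem_finset V
  obtain ⟨w, hw, h⟩ := Nat.findGreatest_spec (P := fun k => ∃ w, w ∉ V ∧ mult x w = k)
    (mult_le x w₀) ⟨w₀, hw₀, rfl⟩
  refine ⟨w, hw, fun v hv => ?_⟩
  rw [h]
  exact Nat.le_findGreatest (mult_le x v) ⟨v, hv, rfl⟩

/-- The values of largest multiplicity. -/
lemma exists_top_mult [Infinite α] (x : Fin n → α) (t : ℕ) :
    ∃ V : Finset α, V.card = t ∧ ∀ v ∈ V, ∀ w, w ∉ V → mult x w ≤ mult x v := by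
  classical
  induction t with
  | zero => exact ⟨∅, by simp⟩
  | succ t ih =>
    obtain ⟨V, hV, h⟩ := ih
    obtain ⟨w, hw, hmax⟩ := exists_max_mult_notMem x V
    refine ⟨insert w V, by simp [hw, hV], fun v hv u hu => ?_⟩
    simp only [Finset.mem_insert, not_or] at hu hv
    rcases hv with rfl | hv
    · exact hmax u hu.2
    · exact h v hv u hu.2

lemma excess_labelSizes {n : ℕ} (T : Fin n → ℕ) (t : ℕ) :
    excess (labelSizes T) t =
      ∑ i ∈ Finset.univ.image T, ((Finset.univ.filter fun j => T j = i).card - t) := by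
  rw [excess, Finsupp.sum_of_support_subset (s := Finset.univ.image T) _ ?_ _ (by simp)]
  · simp [labelSizes_apply]
  · intro i hi
    rw [Finsupp.mem_support_iff, labelSizes_apply] at hi
    obtain ⟨j, hj⟩ := Finset.card_ne_zero.1 hi
    simp only [Finset.mem_filter, Finset.mem_univ, true_and] at hj
    simp [← hj]

/-- A labelling separating equal entries of `x` is dominated by the rank labelling. -/
lemma excess_le_excess_rank [Infinite α] {x : Fin n → α} {T : Fin n → ℕ}
    (h : ∀ i j, i ≠ j → T i = T j → x i ≠ x j) :
    excess (labelSizes T) ≤ excess (labelSizes (rank x)) := by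
  classical
  intro t
  obtain ⟨V, hV, hmax⟩ := exists_top_mult x t
  have hsplit : ∀ (S : Fin n → ℕ) i, (Finset.univ.filter fun j => S j = i).card =
      ((Finset.univ.filter fun j => S j = i).filter fun j => x j ∈ V).card +
      ((Finset.univ.filter fun j => x j ∉ V).filter fun j => S j = i).card := by
    intro S i
    rw [← Finset.card_filter_add_card_filter_not (fun j => x j ∈ V), Finset.filter_filter,
      Finset.filter_filter, Finset.filter_filter]
    simp only [and_comm]
  have hfib : ∀ S : Fin n → ℕ, (Finset.univ.filter fun j => x j ∉ V).card =
      ∑ i ∈ Finset.univ.image S,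
        ((Finset.univ.filter fun j => x j ∉ V).filter fun j => S j = i).card := fun S =>
    Finset.card_eq_sum_card_fiberwise fun j _ => by simp
  calc excess (labelSizes T) t ≤ (Finset.univ.filter fun j => x j ∉ V).card := by
        rw [hfib T, excess_labelSizes]
        refine Finset.sum_le_sum fun i _ => ?_
        have : ((Finset.univ.filter fun j => T j = i).filter fun j => x j ∈ V).card ≤ V.card := by
          refine Finset.card_le_card_of_injOn x (fun j hj => ?_) fun j hj k hk hjk => ?_
          · simp at hj; exact hj.2
          · simp at hj hk
            by_contra hne
            exact h j k hne (hj.1.trans hk.1.symm) hjk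
        have := hsplit T i
        omega
    _ ≤ excess (labelSizes (rank x)) t := by
        rw [hfib (rank x), excess_labelSizes]
        refine Finset.sum_le_sum fun i _ => ?_
        rcases Finset.eq_empty_or_nonempty
          ((Finset.univ.filter fun j => x j ∉ V).filter fun j => rank x j = i) with he | ⟨k, hk⟩
        · simp [he]
        · simp only [Finset.mem_filter, Finset.mem_univ, true_and] at hk
          have : V.card ≤
              ((Finset.univ.filter fun j => rank x j = i).filter fun j => x j ∈ V).card := by
            refine (Finset.card_le_card fun v hv => ?_).trans
              (Finset.card_image_le (f := x))
            have h1 := hmax v hv _ hk.1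
            have h2 := rank_lt_mult x k
            obtain ⟨j, hj, hji⟩ := exists_rank_eq (x := x) (v := v) (i := i) (by omega)
            simp only [Finset.mem_image, Finset.mem_filter, Finset.mem_univ, true_and]
            exact ⟨j, ⟨hji, hj ▸ hv⟩, hj⟩
          have := hsplit (rank x) i
          omega

/-- More than `q` values, outside a prescribed finite set, may be adjoined to `x` at a rank
occurring at most `q` times. -/
lemma exists_card_labelSizes_rank_le [Infinite α] (x : Fin n → α) (q : ℕ) (W : Finset α)
    (hW : ∀ j, x j ∉ W) :
    ∃ S : Finset α, S.card = q + 1 ∧ (∀ z ∈ S, z ∉ W) ∧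
      ∀ z ∈ S, labelSizes (rank x) (mult x z) ≤ q := by
  classical
  suffices H : ∀ k, k ≤ q + 1 → ∃ S : Finset α, S.card = k ∧ (∀ z ∈ S, z ∉ W) ∧
      ∀ z ∈ S, labelSizes (rank x) (mult x z) ≤ q from H (q + 1) le_rfl
  intro k
  induction k with
  | zero => exact fun _ => ⟨∅, by simp⟩
  | succ k ih =>
    intro hk
    obtain ⟨S, hS, hSW, hSq⟩ := ih (by omega)
    obtain ⟨w, hw, hmax⟩ := exists_max_mult_notMem x (S ∪ W)
    simp only [Finset.mem_union, not_or] at hw hmax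
    refine ⟨insert w S, by simp [hw.1, hS], fun z hz => ?_, fun z hz => ?_⟩ <;>
      rcases Finset.mem_insert.1 hz with rfl | hz
    · exact hw.2
    · exact hSW z hz
    · rw [labelSizes_apply]
      refine (Finset.card_le_card_of_injOn (t := S) x (fun j hj => ?_) fun i hi j hj hij => ?_).trans
        (by omega)
      · simp only [Finset.coe_filter, Finset.mem_univ, true_and, Set.mem_ofPred_eq] at hj
        by_contra hjS
        have h1 := hmax (x j) ⟨hjS, hW j⟩
        have h2 := rank_lt_mult x j
        omega
      · simp only [Finset.coe_filter, Finset.mem_univ, true_and, Set.mem_ofPred_eq] at hi hj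
        exact eq_of_rank_eq hij (hi.trans hj.symm)
    · exact hSq z hz

end Rank

/-- The product of the differences `X i ^ m - X j ^ m` over pairs with equal label. -/
noncomputable def blockProd (m : ℕ) {n : ℕ} (T : Fin n → ℕ) : MvPolynomial (Fin n) ℂ :=
  ∏ q ∈ Finset.univ.filter (fun q : Fin n × Fin n => q.1 < q.2 ∧ T q.1 = T q.2),
    (X q.1 ^ m - X q.2 ^ m)

/-- The ideal generated by the block products whose excess function lies in `U`. -/
noncomputable def blockIdeal (m n : ℕ) (U : Set (ℕ → ℕ)) : Ideal (MvPolynomial (Fin n) ℂ) :=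
  Ideal.span {f | ∃ T : Fin n → ℕ, excess (labelSizes T) ∈ U ∧ f = blockProd m T}

/-- The excess functions which, raised by one up to `q`, dominate a convex member of `U`. -/
def lowered (U : Set (ℕ → ℕ)) (q : ℕ) : Set (ℕ → ℕ) :=
  {E | ∃ F ∈ U, ConvexSeq F ∧ ∀ t, F t ≤ E t + if t ≤ q then 1 else 0}

lemma isUpperSet_lowered (U : Set (ℕ → ℕ)) (q : ℕ) : IsUpperSet (lowered U q) := by
  rintro E E' hE ⟨F, hF, hc, h⟩
  exact ⟨F, hF, hc, fun t => (h t).trans (Nat.add_le_add_right (hE t) _)⟩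

lemma blockProd_eq_prod_prod (m : ℕ) {n : ℕ} (T : Fin n → ℕ) :
    blockProd m T = ∏ i, ∏ j, if i < j ∧ T i = T j then X i ^ m - X j ^ m else 1 := by
  rw [blockProd, Finset.prod_filter, Fintype.prod_prod_type]

lemma finSuccEquiv_blockProd_cons (m : ℕ) {n : ℕ} (a : ℕ) (T : Fin n → ℕ) :
    finSuccEquiv ℂ n (blockProd m (Fin.cons a T : Fin (n + 1) → ℕ)) =
      (∏ j ∈ Finset.univ.filter (fun j => T j = a),
        (Polynomial.X ^ m - Polynomial.C (X j ^ m))) * Polynomial.C (blockProd m T) := by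
  simp only [blockProd_eq_prod_prod, Fin.prod_univ_succ, Finset.prod_filter, map_mul, map_prod]
  simp [apply_ite (finSuccEquiv ℂ n), apply_ite (Polynomial.C (R := MvPolynomial (Fin n) ℂ)),
    finSuccEquiv_X_zero, finSuccEquiv_X_succ, eq_comm]

lemma eval_blockProd_eq_zero {m n : ℕ} {U : Set (ℕ → ℕ)} (hU : IsUpperSet U) {T : Fin n → ℕ}
    (hT : excess (labelSizes T) ∈ U) {x : Fin n → ℂ}
    (hx : excess (labelSizes (rank fun j => x j ^ m)) ∉ U) : eval x (blockProd m T) = 0 := by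
  by_contra hne
  refine hx (hU (excess_le_excess_rank fun i j hij hTij hxij => hne ?_) hT)
  rw [blockProd, map_prod]
  rcases lt_or_gt_of_ne hij with h | h
  · exact Finset.prod_eq_zero (i := (i, j)) (by simp [h, hTij]) (by simp [hxij])
  · exact Finset.prod_eq_zero (i := (j, i)) (by simp [h, hTij]) (by simp [hxij])

lemma eval_eq_zero_of_mem_blockIdeal {m n : ℕ} {U : Set (ℕ → ℕ)} (hU : IsUpperSet U)
    {f : MvPolynomial (Fin n) ℂ} (hf : f ∈ blockIdeal m n U) {x : Fin n → ℂ}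
    (hx : excess (labelSizes (rank fun j => x j ^ m)) ∉ U) : eval x f = 0 := by
  have : blockIdeal m n U ≤ RingHom.ker (eval x) := by
    refine Ideal.span_le.2 ?_
    rintro _ ⟨T, hT, rfl⟩
    exact eval_blockProd_eq_zero hU hT hx
  exact this hf

lemma finSuccEquiv_rename_succ {n : ℕ} (b : MvPolynomial (Fin n) ℂ) :
    finSuccEquiv ℂ n (rename Fin.succ b) = Polynomial.C b := by
  induction b using MvPolynomial.induction_on with
  | C a => simp [finSuccEquiv_apply]
  | add p q hp hq => simp only [map_add, hp, hq]
  | mul_X p i hp => rw [map_mul, map_mul, hp, rename_X, finSuccEquiv_X_succ, map_mul]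

/-- Every element of the lowered block ideal is the top coefficient of some element of the block
ideal in one more variable. -/
lemma exists_mem_blockIdeal_coeff_eq {m n d : ℕ} (hm : 0 < m) {U : Set (ℕ → ℕ)}
    (hU : IsUpperSet U) {c : MvPolynomial (Fin n) ℂ}
    (hc : c ∈ blockIdeal m n (lowered U (d / m))) :
    ∃ g ∈ blockIdeal m (n + 1) U, (finSuccEquiv ℂ n g).natDegree ≤ d ∧
      (finSuccEquiv ℂ n g).coeff d = c := by
  refine Submodule.span_induction ?_ ⟨0, zero_mem _, by simp, by simp⟩ ?_ ?_ hc
  · rintro _ ⟨T, ⟨F, hF, hconv, hle⟩, rfl⟩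
    obtain ⟨a, ha, hFa⟩ := exists_le_excess_add_single hconv hle
    have hmem : blockProd m (Fin.cons a T : Fin (n + 1) → ℕ) ∈ blockIdeal m (n + 1) U :=
      Ideal.subset_span ⟨_, hU (by rwa [labelSizes_cons]) hF, rfl⟩
    set Q : Polynomial (MvPolynomial (Fin n) ℂ) := ∏ j ∈ Finset.univ.filter (fun j => T j = a),
        (Polynomial.X ^ m - Polynomial.C (X j ^ m)) with hQ
    have hmonic : ∀ j ∈ Finset.univ.filter (fun j => T j = a),
        (Polynomial.X ^ m - Polynomial.C (X j ^ m : MvPolynomial (Fin n) ℂ)).Monic :=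
      fun j _ => Polynomial.monic_X_pow_sub_C _ hm.ne'
    have hQm : Q.Monic := Polynomial.monic_prod_of_monic _ _ hmonic
    have hQd : Q.natDegree = m * labelSizes T a := by
      rw [hQ, Polynomial.natDegree_prod_of_monic _ _ hmonic]
      rw [Finset.sum_congr rfl fun j _ => Polynomial.natDegree_X_pow_sub_C, Finset.sum_const,
        smul_eq_mul, labelSizes_apply, mul_comm]
    have hdeg : m * labelSizes T a ≤ d :=
      (Nat.mul_le_mul_left m ha).trans (Nat.mul_div_le d m)
    have hR : (Polynomial.X ^ (d - m * labelSizes T a) * Q).Monic :=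
      (Polynomial.monic_X_pow _).mul hQm
    have hRd : (Polynomial.X ^ (d - m * labelSizes T a) * Q).natDegree = d := by
      rw [(Polynomial.monic_X_pow _).natDegree_mul hQm, hQd, Polynomial.natDegree_X_pow]
      omega
    have hg : finSuccEquiv ℂ n (X 0 ^ (d - m * labelSizes T a) *
        blockProd m (Fin.cons a T : Fin (n + 1) → ℕ)) =
        (Polynomial.X ^ (d - m * labelSizes T a) * Q) * Polynomial.C (blockProd m T) := by
      rw [map_mul, map_pow, finSuccEquiv_X_zero, finSuccEquiv_blockProd_cons, mul_assoc]
    refine ⟨_, Ideal.mul_mem_left _ (X 0 ^ (d - m * labelSizes T a)) hmem, ?_, ?_⟩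
    · rw [hg]
      exact (Polynomial.natDegree_mul_C_le _ _).trans hRd.le
    · rw [hg, Polynomial.coeff_mul_C]
      have := hR.coeff_natDegree
      rw [hRd] at this
      rw [this, one_mul]
  · rintro _ _ - - ⟨g, hg, hgd, rfl⟩ ⟨g', hg', hgd', rfl⟩
    refine ⟨g + g', add_mem hg hg', ?_, by simp⟩
    rw [map_add]
    exact (Polynomial.natDegree_add_le _ _).trans (max_le hgd hgd')
  · rintro b _ - ⟨g, hg, hgd, rfl⟩
    have : finSuccEquiv ℂ n (rename Fin.succ b * g) =
        Polynomial.C b * finSuccEquiv ℂ n g := by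
      rw [map_mul, finSuccEquiv_rename_succ]
    refine ⟨_, Ideal.mul_mem_left _ (rename Fin.succ b) hg, ?_, ?_⟩
    · rw [this]
      exact (Polynomial.natDegree_C_mul_le _ _).trans hgd
    · rw [this, Polynomial.coeff_C_mul, smul_eq_mul]

/-- A polynomial vanishing at all `m`-th roots of too many nonzero numbers is zero. -/
lemma eq_zero_of_eval_nthRoots {m : ℕ} (hm : 0 < m) {P : Polynomial ℂ} {S : Finset ℂ}
    (hS : (0 : ℂ) ∉ S) (hdeg : P.natDegree < m * S.card)
    (h : ∀ y, y ^ m ∈ S → P.eval y = 0) : P = 0 := by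
  classical
  have hprim := Complex.isPrimitiveRoot_exp m hm.ne'
  refine Polynomial.eq_zero_of_natDegree_lt_card_of_eval_eq_zero' P
    (S.biUnion fun z => (Polynomial.nthRoots m z).toFinset) (fun y hy => h y ?_) ?_
  · simp only [Finset.mem_biUnion, Multiset.mem_toFinset, Polynomial.mem_nthRoots hm] at hy
    obtain ⟨z, hz, rfl⟩ := hy
    exact hz
  · rw [Finset.card_biUnion, Finset.sum_congr rfl (g := fun _ => m), Finset.sum_const,
      smul_eq_mul, mul_comm]
    · exact hdeg
    · intro z hz
      rw [Multiset.toFinset_card_of_nodup (hprim.nthRoots_nodup fun h0 => hS (h0 ▸ hz)),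
        hprim.card_nthRoots, if_pos (IsAlgClosed.exists_pow_nat_eq z hm)]
    · intro z _ w _ hzw
      refine Finset.disjoint_left.2 fun y hy hy' => hzw ?_
      simp only [Multiset.mem_toFinset, Polynomial.mem_nthRoots hm] at hy hy'
      exact hy.symm.trans hy'

/-- The top coefficient of a polynomial vanishing outside `U` vanishes outside `lowered U`. -/
lemma eval_leadingCoeff_eq_zero {m n : ℕ} (hm : 0 < m) {U : Set (ℕ → ℕ)}
    {f : MvPolynomial (Fin (n + 1)) ℂ}
    (hf : ∀ x : Fin (n + 1) → ℂ, (∀ j, x j ≠ 0) →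
      excess (labelSizes (rank fun j => x j ^ m)) ∉ U → eval x f = 0)
    {x : Fin n → ℂ} (hx0 : ∀ j, x j ≠ 0)
    (hx : excess (labelSizes (rank fun j => x j ^ m)) ∉
      lowered U ((finSuccEquiv ℂ n f).natDegree / m)) :
    eval x (finSuccEquiv ℂ n f).leadingCoeff = 0 := by
  classical
  set d := (finSuccEquiv ℂ n f).natDegree with hd
  obtain ⟨S, hS, hS0, hSq⟩ := exists_card_labelSizes_rank_le (fun j => x j ^ m) (d / m) {0}
    (by simpa using fun j h => absurd h (hx0 j))
  have hP : (finSuccEquiv ℂ n f).map (eval x) = 0 := by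
    refine eq_zero_of_eval_nthRoots hm (S := S) (fun h => hS0 0 h (by simp)) ?_ fun y hy => ?_
    · rw [hS]
      exact (Polynomial.natDegree_map_le).trans_lt (Nat.lt_mul_div_succ d hm)
    · rw [← eval_eq_eval_mv_eval']
      refine hf _ (fun j => ?_) fun hmem => hx ?_
      · refine Fin.cases ?_ (fun j => ?_) j
        · rintro (rfl : y = 0)
          exact hS0 _ hy (by simp [hm.ne'])
        · simpa using hx0 j
      · have hcons : (fun j => (Fin.cons y x : Fin (n + 1) → ℂ) j ^ m) =
            Fin.cons (y ^ m) (fun j => x j ^ m) := by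
          funext j
          refine Fin.cases ?_ (fun j => ?_) j <;> simp
        rw [hcons, rank_cons, labelSizes_cons] at hmem
        refine ⟨_, hmem, convexSeq_excess _, fun t => ?_⟩
        rw [excess_add_single]
        have := hSq _ hy
        split_ifs <;> omega
  rw [Polynomial.leadingCoeff, ← Polynomial.coeff_map, hP, Polynomial.coeff_zero]

/-- A polynomial lies in the block ideal of an upper set as soon as it vanishes at the points with
nonzero coordinates whose type is not in the upper set. -/
theorem mem_blockIdeal_of_eval_eq_zero {m : ℕ} (hm : 0 < m) {n : ℕ} {U : Set (ℕ → ℕ)}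
    (hU : IsUpperSet U) {f : MvPolynomial (Fin n) ℂ}
    (hf : ∀ x : Fin n → ℂ, (∀ j, x j ≠ 0) →
      excess (labelSizes (rank fun j => x j ^ m)) ∉ U → eval x f = 0) :
    f ∈ blockIdeal m n U := by
  induction n generalizing U with
  | zero =>
    by_cases h : excess (labelSizes (Fin.elim0 : Fin 0 → ℕ)) ∈ U
    · have : (1 : MvPolynomial (Fin 0) ℂ) ∈ blockIdeal m 0 U :=
        Ideal.subset_span ⟨_, h, by simp [blockProd]⟩
      rw [(Ideal.eq_top_iff_one _).2 this]
      trivial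
    · have : f = 0 := MvPolynomial.funext fun x => by
        rw [hf x (fun j => j.elim0) (by rwa [Subsingleton.elim (rank _) Fin.elim0]), map_zero]
      rw [this]
      exact zero_mem _
  | succ n ih =>
    induction hd : (finSuccEquiv ℂ n f).degree using WellFoundedLT.induction generalizing f with
    | ind d IH =>
      subst hd
      by_cases h0 : finSuccEquiv ℂ n f = 0
      · rw [(map_eq_zero_iff _ (finSuccEquiv ℂ n).injective).1 h0]
        exact zero_mem _
      obtain ⟨g, hg, hgd, hgc⟩ := exists_mem_blockIdeal_coeff_eq hm hU
        (ih (isUpperSet_lowered U _) fun x hx0 hx => eval_leadingCoeff_eq_zero hm hf hx0 hx)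
      have hlt : (finSuccEquiv ℂ n (f - g)).degree < (finSuccEquiv ℂ n f).degree := by
        rw [map_sub]
        have hlc := Polynomial.leadingCoeff_ne_zero.2 h0
        have hnd : (finSuccEquiv ℂ n g).natDegree = (finSuccEquiv ℂ n f).natDegree :=
          le_antisymm hgd (Polynomial.le_natDegree_of_ne_zero (by rwa [hgc]))
        have hg0 : finSuccEquiv ℂ n g ≠ 0 := by
          intro h
          rw [h, Polynomial.coeff_zero] at hgc
          exact hlc hgc.symm
        refine Polynomial.degree_sub_lt_left ?_ h0 ?_
        · rw [Polynomial.degree_eq_natDegree h0, Polynomial.degree_eq_natDegree hg0, hnd]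
        · rw [← hgc, ← hnd, Polynomial.leadingCoeff]
      have := IH _ hlt (f := f - g) (fun x hx0 hx => by
        rw [map_sub, hf x hx0 hx, eval_eq_zero_of_mem_blockIdeal hU hg hx, sub_zero]) rfl
      simpa using add_mem this hg

/-- A labelling can be refined to use exactly `k` labels. -/
lemma exists_refinement_card_image_eq {n k : ℕ} (hk : k ≤ n) (T : Fin n → ℕ)
    (hT : (Finset.univ.image T).card ≤ k) :
    ∃ S : Fin n → ℕ, (Finset.univ.image S).card = k ∧ ∀ i j, S i = S j → T i = T j := by
  induction k, hT using Nat.le_induction with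
  | base => exact ⟨T, rfl, fun _ _ h => h⟩
  | succ k _ ih =>
    obtain ⟨S, hS, hST⟩ := ih (by omega)
    obtain ⟨i, -, j, -, hij, hSij⟩ := Finset.exists_ne_map_eq_of_card_lt_of_maps_to
      (s := (Finset.univ : Finset (Fin n))) (t := Finset.univ.image S) (f := S)
      (by rw [hS, Finset.card_univ, Fintype.card_fin]; omega) (fun a _ => by simp)
    obtain ⟨c, hc⟩ := Infinite.exists_notMem_finset (Finset.univ.image S)
    have hc' : ∀ a, S a ≠ c := by simpa using hc
    refine ⟨Function.update S i c, ?_, fun a b hab => ?_⟩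
    · have : Finset.univ.image (Function.update S i c) = insert c (Finset.univ.image S) := by
        ext v
        simp only [Finset.mem_image, Finset.mem_univ, true_and, Finset.mem_insert]
        constructor
        · rintro ⟨a, rfl⟩
          by_cases h : a = i
          · simp [h]
          · simp [h]
        · rintro (rfl | ⟨a, rfl⟩)
          · exact ⟨i, by simp⟩
          · by_cases h : a = i
            · exact ⟨j, by simp [Ne.symm hij, h, hSij]⟩
            · exact ⟨a, by simp [h]⟩
      rw [this, Finset.card_insert_of_notMem hc, hS]
    · by_cases ha : a = i <;> by_cases hb : b = i
      · rw [ha, hb]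
      · subst ha
        simp only [Function.update_self, Function.update_of_ne hb] at hab
        exact absurd hab.symm (hc' b)
      · subst hb
        simp only [Function.update_self, Function.update_of_ne ha] at hab
        exact absurd hab (hc' a)
      · rw [Function.update_of_ne ha, Function.update_of_ne hb] at hab
        exact hST a b hab

/-- The partition of the index set into the fibres of a labelling. -/
lemma exists_finpartition_fibres {n : ℕ} (S : Fin n → ℕ) :
    ∃ P : Finpartition (Finset.univ : Finset (Fin n)),
      P.parts.card = (Finset.univ.image S).card ∧
      ∀ i j, (∃ b ∈ P.parts, i ∈ b ∧ j ∈ b) → S i = S j := by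
  refine ⟨Finpartition.ofExistsUnique
    ((Finset.univ.image S).image fun c => Finset.univ.filter fun j => S j = c)
    (fun _ _ => Finset.subset_univ _) (fun a _ => ?_) ?_, ?_, ?_⟩
  · refine ⟨Finset.univ.filter fun j => S j = S a, by simp, ?_⟩
    rintro t ⟨ht, hat⟩
    simp only [Finset.mem_image, Finset.mem_univ, true_and] at ht
    obtain ⟨_, ⟨b, rfl⟩, rfl⟩ := ht
    simp only [Finset.mem_filter, Finset.mem_univ, true_and] at hat
    rw [hat]
  · simp only [Finset.mem_image, Finset.mem_univ, true_and, not_exists, not_and]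
    rintro _ ⟨b, rfl⟩ h
    exact Finset.notMem_empty b (h ▸ by simp)
  · refine Finset.card_image_of_injOn fun c hc c' _ h => ?_
    simp only [Finset.coe_image, Finset.coe_univ, Set.image_univ, Set.mem_range] at hc
    obtain ⟨b, rfl⟩ := hc
    have : b ∈ Finset.univ.filter fun j => S j = c' := by
      rw [← show (Finset.univ.filter fun j => S j = S b) = _ from h]
      simp
    simpa using this
  · rintro i j ⟨b, hb, hi, hj⟩
    simp only [Finpartition.ofExistsUnique, Finset.mem_image, Finset.mem_univ, true_and] at hb
    obtain ⟨_, ⟨a, rfl⟩, rfl⟩ := hb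
    simp only [Finset.mem_filter, Finset.mem_univ, true_and] at hi hj
    rw [hi, hj]

lemma card_le_excess_one_add_card_image {n : ℕ} (T : Fin n → ℕ) :
    n = excess (labelSizes T) 1 + (Finset.univ.image T).card := by
  have h := Finset.card_eq_sum_card_image T Finset.univ
  rw [Finset.card_univ, Fintype.card_fin] at h
  rw [excess_labelSizes, Finset.card_eq_sum_ones, ← Finset.sum_add_distrib]
  refine h.trans (Finset.sum_congr rfl fun c hc => ?_)
  obtain ⟨j, -, hj⟩ := Finset.mem_image.1 hc
  have : 0 < (Finset.univ.filter fun j => T j = c).card := Finset.card_pos.2 ⟨j, by simp [hj]⟩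
  omega

/-- If the ranks take more than `k` values, then some value has multiplicity above `k`. -/
lemma exists_lt_mult {α : Type*} [DecidableEq α] {n k : ℕ} {x : Fin n → α}
    (h : k < (Finset.univ.image (rank x)).card) : ∃ v, k < mult x v := by
  by_contra! hcon
  have : Finset.univ.image (rank x) ⊆ Finset.range k := by
    intro i hi
    obtain ⟨j, -, rfl⟩ := Finset.mem_image.1 hi
    exact Finset.mem_range.2 ((rank_lt_mult x j).trans_le (hcon _))
  have := Finset.card_le_card this
  rw [Finset.card_range] at this
  omega

/-- In `ℂ[x_1,…,x_n]`, the ideal generated by the products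
`∏_{i<j, i ≡_λ j} (x_i^m - x_j^m)`, `λ` running over partitions of `{1,…,n}` into
exactly `p-1` blocks, equals the intersection
`⋂_{σ ⊆ [n], |σ| = p} ⟨x_i^m - x_j^m : i,j ∈ σ⟩`. -/
theorem liLi_monomial_ideal_eq_inf (m n p : ℕ) (hm : 2 ≤ m) (hn : 2 ≤ n)
    (hp : 2 ≤ p) (hpn : p ≤ n) :
    Ideal.span {f : MvPolynomial (Fin n) ℂ |
        ∃ P : Finpartition (Finset.univ : Finset (Fin n)), P.parts.card = p - 1 ∧
          f = ∏ q ∈ Finset.univ.filter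
              (fun q : Fin n × Fin n => q.1 < q.2 ∧ ∃ b ∈ P.parts, q.1 ∈ b ∧ q.2 ∈ b),
            (X q.1 ^ m - X q.2 ^ m)} =
      ⨅ σ : {σ : Finset (Fin n) // σ.card = p},
        Ideal.span {f : MvPolynomial (Fin n) ℂ |
          ∃ i ∈ σ.1, ∃ j ∈ σ.1, f = X i ^ m - X j ^ m} := by
  apply le_antisymm
  · refine le_iInf fun σ => Ideal.span_le.2 ?_
    rintro _ ⟨P, hP, rfl⟩
    obtain ⟨i, hi, j, hj, hij, hPij⟩ := Finset.exists_ne_map_eq_of_card_lt_of_maps_to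
      (s := σ.1) (t := P.parts) (f := P.part) (by rw [hP, σ.2]; omega)
      (fun a _ => P.part_mem.2 (Finset.mem_univ a))
    wlog hlt : i < j generalizing i j
    · exact this j hj i hi hij.symm hPij.symm (lt_of_le_of_ne (not_lt.1 hlt) hij.symm)
    refine Ideal.mem_of_dvd _ (Finset.dvd_prod_of_mem _ (a := (i, j)) ?_)
      (Ideal.subset_span ⟨i, hi, j, hj, rfl⟩)
    simp only [Finset.mem_filter, Finset.mem_univ, true_and]
    exact ⟨hlt, P.part i, P.part_mem.2 (Finset.mem_univ i), P.mem_part (Finset.mem_univ i),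
      hPij ▸ P.mem_part (Finset.mem_univ j)⟩
  · intro f hf
    rw [Ideal.mem_iInf] at hf
    have hU : IsUpperSet {E : ℕ → ℕ | n ≤ E 1 + (p - 1)} := fun E E' h hE =>
      le_trans hE (Nat.add_le_add_right (h 1) _)
    have hmem : f ∈ blockIdeal m n {E : ℕ → ℕ | n ≤ E 1 + (p - 1)} := by
      refine mem_blockIdeal_of_eval_eq_zero (by omega) hU fun x _ hx => ?_
      have hcard := card_le_excess_one_add_card_image (rank fun j => x j ^ m)
      simp only [Set.mem_ofPred_eq, not_le] at hx
      obtain ⟨v, hv⟩ := exists_lt_mult (x := fun j => x j ^ m) (k := p - 1) (by omega)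
      obtain ⟨σ, hσ, hσp⟩ := Finset.exists_subset_card_eq (show p ≤ mult (fun j => x j ^ m) v by omega)
      have hle : Ideal.span {f : MvPolynomial (Fin n) ℂ |
          ∃ i ∈ σ, ∃ j ∈ σ, f = X i ^ m - X j ^ m} ≤ RingHom.ker (eval x) := by
        refine Ideal.span_le.2 ?_
        rintro _ ⟨i, hi, j, hj, rfl⟩
        have h1 := hσ hi
        have h2 := hσ hj
        simp only [Finset.mem_filter, Finset.mem_univ, true_and] at h1 h2
        simp [h1, h2]
      exact hle (hf ⟨σ, hσp⟩)
    refine (Ideal.span_le.2 ?_ : blockIdeal m n _ ≤ _) hmem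
    rintro _ ⟨T, hT, rfl⟩
    have hcard := card_le_excess_one_add_card_image T
    simp only [Set.mem_ofPred_eq] at hT
    obtain ⟨S, hS, hST⟩ := exists_refinement_card_image_eq (k := p - 1) (by omega) T (by omega)
    obtain ⟨P, hP, hPS⟩ := exists_finpartition_fibres S
    refine Ideal.mem_of_dvd _ (Finset.prod_dvd_prod_of_subset _ _ _ ?_)
      (Ideal.subset_span ⟨P, hP.trans hS, rfl⟩)
    intro q hq
    simp only [Finset.mem_filter, Finset.mem_univ, true_and] at hq ⊢
    exact ⟨hq.1, hST _ _ (hPS _ _ hq.2)⟩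
end

section
/- Let k be a field and let y_1, ..., y_n ∈ k[x_1, ..., x_n] be homogeneous polynomials of positive degree which form a regular sequence. Then the k-algebra homomorphism φ : k[x_1, ..., x_n] → k[x_1, ..., x_n] determined by φ(x_i) = y_i for all i is injective; in particular φ is a k-algebra isomorphism of k[x_1, ..., x_n] onto the subalgebra k[y_1, ..., y_n] generated by y_1, ..., y_n. -/
open MvPolynomial

/-- If the elements of a sequence `y` in a `k`-algebra `R` are regular on a module `M`, then a
polynomial over the field `k` whose value at `y` annihilates `M` is zero. -/
theorem MvPolynomial.eq_zero_of_aeval_smul_eq_zero_of_isRegular {k R : Type*} [Field k]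
    [CommRing R] [Algebra k R] {n : ℕ} (y : Fin n → R) {M : Type*} [AddCommGroup M] [Module R M]
    (hreg : RingTheory.Sequence.IsRegular M (List.ofFn y)) (p : MvPolynomial (Fin n) k)
    (hp : ∀ m : M, aeval y p • m = 0) : p = 0 := by
  induction n generalizing M with
  | zero =>
    have := hreg.nontrivial
    obtain ⟨c, rfl⟩ := C_surjective (Fin 0) p
    by_contra hc
    have hc : c ≠ 0 := fun h => hc (by rw [h, C_0])
    obtain ⟨m, hm⟩ := exists_ne (0 : M)
    apply hm
    have h := hp m
    rw [aeval_C] at h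
    rw [← one_smul R m, ← map_one (algebraMap k R), ← inv_mul_cancel₀ hc, map_mul, mul_smul, h,
      smul_zero]
  | succ n ih =>
    rw [List.ofFn_succ, RingTheory.Sequence.isRegular_cons_iff] at hreg
    obtain ⟨hy, htail⟩ := hreg
    let f : MvPolynomial (Fin n) k →+* R := (aeval (R := k) (Fin.tail y)).toRingHom
    have coeff_zero : ∀ F : Polynomial (MvPolynomial (Fin n) k),
        (∀ m : M, F.eval₂ f (y 0) • m = 0) → F.coeff 0 = 0 := by
      intro F hF
      refine ih (Fin.tail y) htail _ fun m => ?_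
      obtain ⟨m, rfl⟩ := Submodule.Quotient.mk_surjective _ m
      rw [← Submodule.Quotient.mk_smul, Submodule.Quotient.mk_eq_zero]
      have h := hF m
      rw [← Polynomial.X_mul_divX_add F, Polynomial.eval₂_add, Polynomial.eval₂_mul,
        Polynomial.eval₂_X, Polynomial.eval₂_C, add_smul, mul_smul] at h
      rw [show aeval (Fin.tail y) (F.coeff 0) = f (F.coeff 0) from rfl,
        eq_neg_of_add_eq_zero_right h]
      exact neg_mem (Submodule.smul_mem_pointwise_smul _ _ _ trivial)
    have eq_zero : ∀ (d : ℕ) (F : Polynomial (MvPolynomial (Fin n) k)), F.natDegree ≤ d →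
        (∀ m : M, F.eval₂ f (y 0) • m = 0) → F = 0 := by
      intro d
      induction d with
      | zero =>
        intro F hd hF
        rw [Polynomial.eq_C_of_natDegree_le_zero hd, coeff_zero F hF, map_zero]
      | succ d ihd =>
        intro F hd hF
        have hX : F = Polynomial.X * F.divX := by
          conv_lhs => rw [← Polynomial.X_mul_divX_add F, coeff_zero F hF, map_zero, add_zero]
        rw [hX, ihd F.divX, mul_zero]
        · rw [Polynomial.natDegree_divX_eq_natDegree_tsub_one]
          omega
        · intro m
          apply hy.right_eq_zero_of_smul
          have h := hF m
          rwa [hX, Polynomial.eval₂_mul, Polynomial.eval₂_X, mul_smul] at h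
    have aeval_eq : (aeval y : _ →ₐ[k] R).toRingHom =
        (Polynomial.eval₂RingHom f (y 0)).comp (finSuccEquiv k n).toRingHom := by
      refine ringHom_ext (fun c => ?_) fun i => ?_
      · simp [f, finSuccEquiv_apply]
      · refine Fin.cases ?_ (fun j => ?_) i
        · simp [finSuccEquiv_X_zero]
        · simp [f, finSuccEquiv_X_succ, Fin.tail]
    have hz : finSuccEquiv k n p = 0 := by
      refine eq_zero _ _ le_rfl fun m => ?_
      rw [← hp m]
      exact congrArg (· • m) (RingHom.congr_fun aeval_eq p).symm
    exact (map_eq_zero_iff _ (finSuccEquiv k n).injective).mp hz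

/-- If `y_1, …, y_n` are homogeneous polynomials of positive degree forming a regular
sequence in `k[x_1,…,x_n]`, then the `k`-algebra endomorphism sending `x_i ↦ y_i` is
injective; in particular it is a `k`-algebra isomorphism onto the subalgebra generated
by the `y_i`. -/
theorem subst_regular_sequence_injective (k : Type*) [Field k] (n : ℕ)
    (y : Fin n → MvPolynomial (Fin n) k)
    (hhom : ∀ i, ∃ d : ℕ, 0 < d ∧ (y i).IsHomogeneous d)
    (hreg : RingTheory.Sequence.IsRegular (MvPolynomial (Fin n) k) (List.ofFn y)) :
    Function.Injective (aeval y : MvPolynomial (Fin n) k →ₐ[k] MvPolynomial (Fin n) k) ∧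
      (aeval y : MvPolynomial (Fin n) k →ₐ[k] MvPolynomial (Fin n) k).range =
        Algebra.adjoin k (Set.range y) := by
  refine ⟨(injective_iff_map_eq_zero _).mpr fun p hp => ?_,
    (Algebra.adjoin_range_eq_range_aeval k y).symm⟩
  exact eq_zero_of_aeval_smul_eq_zero_of_isRegular y hreg p fun m => by rw [hp, zero_smul]
end

section
/- Let k be a field and let y_1, ..., y_n ∈ k[x_1, ..., x_n] be homogeneous polynomials of positive degree which form a regular sequence. Then k[x_1, ..., x_n] is flat as a module over the k-subalgebra k[y_1, ..., y_n] generated by y_1, ..., y_n. -/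
open MvPolynomial

section RegularSequence

variable {k R ι : Type*} [Field k] [CommRing R] [Algebra k R]

open Finsupp Pointwise in
/-- If the sum of the `r ^ j • m j` vanishes, with each `m j` in the span of a family which is
linearly independent modulo the regular element `r`, then all the `m j` vanish. -/
theorem IsSMulRegular.eq_zero_of_sum_pow_smul_linearCombination {M : Type*} [AddCommGroup M]
    [Module R M] [Module k M] [IsScalarTower k R M] {r : R} (hr : IsSMulRegular M r) {v : ι → M}
    (hv : LinearIndependent k fun i ↦ (r • (⊤ : Submodule R M)).mkQ (v i)) (N : ℕ)
    (f : ℕ → ι →₀ k) (hf : ∑ j ∈ Finset.range N, r ^ j • linearCombination k v (f j) = 0) :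
    ∀ j < N, f j = 0 := by
  induction N generalizing f with
  | zero => simp
  | succ N ih =>
    have hsum : ∑ j ∈ Finset.range N, r ^ (j + 1) • linearCombination k v (f (j + 1)) =
        r • ∑ j ∈ Finset.range N, r ^ j • linearCombination k v (f (j + 1)) := by
      simp only [Finset.smul_sum, smul_smul, pow_succ']
    rw [Finset.sum_range_succ', hsum, pow_zero, one_smul] at hf
    have h0 : f 0 = 0 := by
      refine linearIndependent_iff.mp hv _ ?_
      have hcomp : linearCombination k (fun i ↦ (r • (⊤ : Submodule R M)).mkQ (v i)) (f 0) =
          (r • (⊤ : Submodule R M)).mkQ (linearCombination k v (f 0)) :=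
        (apply_linearCombination k ((r • (⊤ : Submodule R M)).mkQ.restrictScalars k) v (f 0)).symm
      rw [hcomp, Submodule.mkQ_apply, Submodule.Quotient.mk_eq_zero,
        eq_neg_of_add_eq_zero_right hf]
      exact neg_mem (Submodule.smul_mem_pointwise_smul _ _ _ Submodule.mem_top)
    rw [h0, map_zero, add_zero] at hf
    have hs := ih (fun j ↦ f (j + 1)) (hr (hf.trans (smul_zero r).symm))
    rintro (_ | j) hj
    · exact h0
    · exact hs j (by omega)

open Pointwise in
/-- A family which is linearly independent modulo a regular element `r` stays linearly independent
after multiplication by the powers of `r`. -/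
theorem LinearIndependent.pow_smul_of_isSMulRegular {M : Type*} [AddCommGroup M]
    [Module R M] [Module k M] [IsScalarTower k R M] {r : R} (hr : IsSMulRegular M r) {v : ι → M}
    (hv : LinearIndependent k fun i ↦ (r • (⊤ : Submodule R M)).mkQ (v i)) :
    LinearIndependent k fun p : ℕ × ι ↦ r ^ p.1 • v p.2 := by
  rw [linearIndependent_iff]
  intro l hl
  have hlt (j : ℕ) (hj : j ∈ l.curry.support) : j < l.curry.support.sup id + 1 :=
    Nat.lt_succ_of_le (Finset.le_sup (f := id) hj)
  have hz := hr.eq_zero_of_sum_pow_smul_linearCombination hv (l.curry.support.sup id + 1) l.curry ?_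
  · ext ⟨j, i⟩
    have hj : l.curry j = 0 := by
      by_contra h
      exact h (hz j (hlt j (Finsupp.mem_support_iff.mpr h)))
    simpa using DFunLike.congr_fun hj i
  · rw [← hl, Finsupp.linearCombination_apply, ← Finset.sum_subset
      (fun j hj ↦ Finset.mem_range.mpr (hlt j hj)) (fun j _ hj ↦ by
        rw [Finsupp.notMem_support_iff.mp hj, map_zero, smul_zero])]
    rw [← Finsupp.sum_curry_index l (fun j i c ↦ c • r ^ j • v i)]
    refine Finset.sum_congr rfl fun j _ ↦ ?_
    rw [Finsupp.linearCombination_apply, Finsupp.smul_sum]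
    exact Finsupp.sum_congr fun i _ ↦ smul_algebra_smul_comm _ _ _

open Pointwise in
/-- A family which is linearly independent modulo a weakly regular sequence stays linearly
independent after multiplication by the monomials in the sequence. -/
theorem LinearIndependent.prod_pow_smul_of_isWeaklyRegular {M : Type*} [AddCommGroup M]
    [Module R M] [Module k M] [IsScalarTower k R M] {n : ℕ} {y : Fin n → R}
    (hy : RingTheory.Sequence.IsWeaklyRegular M (List.ofFn y)) {v : ι → M}
    (hv : LinearIndependent k fun i ↦
      (Ideal.ofList (List.ofFn y) • (⊤ : Submodule R M)).mkQ (v i)) :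
    LinearIndependent k fun p : (Fin n → ℕ) × ι ↦ (∏ j, y j ^ p.1 j) • v p.2 := by
  induction n generalizing M with
  | zero =>
    have hv' : LinearIndependent k v :=
      LinearIndependent.of_comp
        ((Ideal.ofList (List.ofFn y) • (⊤ : Submodule R M)).mkQ.restrictScalars k) hv
    simpa [Function.comp_def] using
      hv'.comp (Prod.snd : (Fin 0 → ℕ) × ι → ι) fun a b h ↦ Prod.ext (Subsingleton.elim _ _) h
  | succ n ih =>
    rw [List.ofFn_succ] at hy hv
    obtain ⟨h0, ht⟩ := (RingTheory.Sequence.isWeaklyRegular_cons_iff M _ _).mp hy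
    let e := (Submodule.quotOfListConsSMulTopEquivQuotSMulTopInner M (y 0)
      (List.ofFn fun i : Fin n ↦ y i.succ)).restrictScalars k
    have hind := LinearIndependent.pow_smul_of_isSMulRegular (k := k) h0
      (v := fun p : (Fin n → ℕ) × ι ↦ (∏ j, y j.succ ^ p.1 j) • v p.2)
      (ih ht (v := fun i ↦ (y 0 • (⊤ : Submodule R M)).mkQ (v i))
        (hv.map' e.toLinearMap e.ker))
    have hcomp := hind.comp
      (fun p : (Fin (n + 1) → ℕ) × ι ↦ (p.1 0, ((fun j : Fin n ↦ p.1 j.succ), p.2))) ?_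
    · simpa only [Function.comp_def, Fin.prod_univ_succ, mul_smul] using hcomp
    · rintro ⟨α, i⟩ ⟨β, j⟩ h
      simp only [Prod.mk.injEq] at h
      exact Prod.ext (funext <| Fin.cases h.1 fun t ↦ congrFun h.2.1 t) h.2.2

/-- If the products of a family `b` with the monomials in `y` are linearly independent over `k`,
then `b` is linearly independent over the subalgebra generated by `y`. -/
theorem LinearIndependent.adjoin_range_of_prod_pow_smul {n : ℕ} {y : Fin n → R} {b : ι → R}
    (h : LinearIndependent k fun p : (Fin n → ℕ) × ι ↦ (∏ j, y j ^ p.1 j) • b p.2) :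
    LinearIndependent (Algebra.adjoin k (Set.range y)) b := by
  classical
  rw [linearIndependent_iff']
  intro s g hg
  have hmem (i : ι) : ∃ p : MvPolynomial (Fin n) k, aeval y p = (g i : R) :=
    (Algebra.adjoin_range_eq_range_aeval k y).le (g i).2
  choose p hp using hmem
  have hT (i : ι) (hi : i ∈ s) :
      (g i : R) = ∑ d ∈ s.biUnion fun i ↦ (p i).support, (p i).coeff d • ∏ j, y j ^ d j := by
    rw [← hp, aeval_def, eval₂_eq']
    simp only [Algebra.smul_def]
    refine Finset.sum_subset (Finset.subset_biUnion_of_mem (fun i ↦ (p i).support) hi) ?_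
    intro d _ hd
    rw [notMem_support_iff.mp hd, map_zero, zero_mul]
  have hinj : Function.Injective
      fun q : (Fin n →₀ ℕ) × ι ↦ ((q.1 : Fin n → ℕ), q.2) := by
    rintro ⟨α, i⟩ ⟨β, j⟩ hq
    simp only [Prod.mk.injEq] at hq
    exact Prod.ext (DFunLike.coe_injective hq.1) hq.2
  have hz := linearIndependent_iff'.mp (h.comp _ hinj)
    ((s.biUnion fun i ↦ (p i).support) ×ˢ s) (fun q ↦ (p q.2).coeff q.1) (by
      rw [Finset.sum_product_right, ← hg]
      refine Finset.sum_congr rfl fun i hi ↦ ?_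
      rw [Subalgebra.smul_def, hT i hi, Finset.sum_smul]
      simp)
  intro i hi
  refine Subtype.ext ?_
  rw [hT i hi, ZeroMemClass.coe_zero]
  exact Finset.sum_eq_zero fun d hd ↦ by
    rw [hz (d, i) (Finset.mk_mem_product hd hi), zero_smul]

end RegularSequence

section Graded

variable {k σ ι : Type*} [Field k]

/-- Graded Nakayama lemma: homogeneous polynomials which span `k[x]` modulo the ideal generated by
homogeneous polynomials `y i` of positive degree generate `k[x]` as a `k[y]`-module. -/
theorem MvPolynomial.span_adjoin_range_eq_top {τ : Type*} {y : τ → MvPolynomial σ k}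
    (hy : ∀ i, ∃ d : ℕ, 0 < d ∧ (y i).IsHomogeneous d) {b : ι → MvPolynomial σ k}
    (hb : ∀ i, ∃ d : ℕ, (b i).IsHomogeneous d)
    (hspan : ∀ f : MvPolynomial σ k, ∃ g ∈ Submodule.span k (Set.range b),
      f - g ∈ Ideal.span (Set.range y)) :
    Submodule.span (Algebra.adjoin k (Set.range y)) (Set.range b) = ⊤ := by
  set N := Submodule.span (Algebra.adjoin k (Set.range y)) (Set.range b)
  have hsmul (i : τ) {f : MvPolynomial σ k} (hf : f ∈ N) : f * y i ∈ N := by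
    rw [mul_comm]
    exact N.smul_mem ⟨y i, Algebra.subset_adjoin ⟨i, rfl⟩⟩ hf
  have hhom (d : ℕ) : ∀ f : MvPolynomial σ k, f.IsHomogeneous d → f ∈ N := by
    induction d using Nat.strong_induction_on with
    | _ d ih =>
      intro f hf
      obtain ⟨g, hg, hfg⟩ := hspan f
      have hgN : homogeneousComponent d g ∈ N := by
        clear hfg
        induction hg using Submodule.span_induction with
        | mem x hx =>
          obtain ⟨i, rfl⟩ := hx
          obtain ⟨e, he⟩ := hb i
          rw [homogeneousComponent_of_mem he]
          split_ifs
          · exact Submodule.subset_span ⟨i, rfl⟩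
          · exact zero_mem _
        | zero => simp
        | add x z _ _ hx hz => rw [map_add]; exact add_mem hx hz
        | smul c x _ hx =>
          rw [map_smul]
          exact (N.restrictScalars k).smul_mem c hx
      have hIN : homogeneousComponent d (f - g) ∈ N := by
        generalize f - g = q at hfg
        induction hfg using Submodule.closure_induction with
        | smul_mem c x hx =>
          obtain ⟨i, rfl⟩ := hx
          obtain ⟨e, he, hye⟩ := hy i
          rw [← sum_homogeneousComponent c, smul_eq_mul, Finset.sum_mul, map_sum]
          refine sum_mem fun m _ ↦ ?_
          rw [homogeneousComponent_of_mem ((homogeneousComponent_isHomogeneous m c).mul hye)]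
          split_ifs with hd
          · exact hsmul i (ih m (by omega) _ (homogeneousComponent_isHomogeneous m c))
          · exact zero_mem _
        | zero => simp
        | add x z _ _ hx hz => rw [map_add]; exact add_mem hx hz
      rw [map_sub, homogeneousComponent_eq_self hf] at hIN
      simpa using add_mem hIN hgN
  refine eq_top_iff.mpr fun f _ ↦ ?_
  rw [← sum_homogeneousComponent f]
  exact sum_mem fun d _ ↦ hhom d _ (homogeneousComponent_isHomogeneous d f)

end Graded

/-- If `y_1, …, y_n` are homogeneous polynomials of positive degree forming a regular
sequence in `k[x_1,…,x_n]`, then `k[x_1,…,x_n]` is flat as a module over the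
subalgebra `k[y_1,…,y_n]` generated by the `y_i`. -/
theorem flat_over_regular_sequence_subalgebra (k : Type*) [Field k] (n : ℕ)
    (y : Fin n → MvPolynomial (Fin n) k)
    (hhom : ∀ i, ∃ d : ℕ, 0 < d ∧ (y i).IsHomogeneous d)
    (hreg : RingTheory.Sequence.IsRegular (MvPolynomial (Fin n) k) (List.ofFn y)) :
    Module.Flat (Algebra.adjoin k (Set.range y)) (MvPolynomial (Fin n) k) := by
  let J : Submodule (MvPolynomial (Fin n) k) (MvPolynomial (Fin n) k) :=
    Ideal.ofList (List.ofFn y) • ⊤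
  have hJ : J = Ideal.span (Set.range y) := by
    simp only [J, smul_eq_mul, Ideal.mul_top, Ideal.ofList, List.mem_ofFn']
    rfl
  obtain ⟨κ, a, -, hsp, hli⟩ := exists_linearIndependent' k
    fun α : Fin n →₀ ℕ ↦ J.mkQ (monomial α (1 : k))
  let b (i : κ) : MvPolynomial (Fin n) k := monomial (a i) 1
  have hrange : Submodule.span k (Set.range fun i ↦ J.mkQ (b i)) =
      (Submodule.span k (Set.range b)).map (J.mkQ.restrictScalars k) := by
    rw [Submodule.map_span, ← Set.range_comp]
    rfl
  have htop : Submodule.span k (Set.range fun α : Fin n →₀ ℕ ↦ J.mkQ (monomial α (1 : k))) = ⊤ := by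
    have := congrArg (Submodule.map (J.mkQ.restrictScalars k)) (basisMonomials (Fin n) k).span_eq
    rw [Submodule.map_span, ← Set.range_comp, Submodule.map_top, LinearMap.range_eq_top.mpr
      (by exact J.mkQ_surjective)] at this
    rw [← this]
    congr 2
  have hspan := MvPolynomial.span_adjoin_range_eq_top hhom (b := b)
    (fun i ↦ ⟨_, isHomogeneous_monomial 1 rfl⟩) fun f ↦ by
      have hf : J.mkQ f ∈ (Submodule.span k (Set.range b)).map (J.mkQ.restrictScalars k) := by
        rw [← hrange]
        exact (hsp.trans htop).ge Submodule.mem_top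
      obtain ⟨g, hg, hgf⟩ := hf
      exact ⟨g, hg, hJ ▸ (Submodule.Quotient.eq J).mp hgf.symm⟩
  have hind := (hli.prod_pow_smul_of_isWeaklyRegular (v := b)
    hreg.toIsWeaklyRegular).adjoin_range_of_prod_pow_smul
  have := Module.Free.of_basis (Module.Basis.mk hind hspan.ge)
  infer_instance
end

section
/- Let k be a field, let y_1, ..., y_n ∈ k[x_1, ..., x_n] be homogeneous polynomials of positive degree which form a regular sequence, and let φ : k[x_1, ..., x_n] → k[x_1, ..., x_n] be the k-algebra homomorphism determined by φ(x_i) = y_i. Then for any two homogeneous ideals I, J ⊆ k[x_1, ..., x_n], the extension of I ∩ J along φ equals the intersection of the extensions: φ(I ∩ J)·k[x_1,...,x_n] = φ(I)·k[x_1,...,x_n] ∩ φ(J)·k[x_1,...,x_n], i.e. Ideal.map φ (I ∩ J) = Ideal.map φ I ∩ Ideal.map φ J. -/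
open MvPolynomial

/-- An element of a free algebra lies in the extension of an ideal iff all its coordinates lie in
the ideal. -/
theorem Module.Basis.mem_map_algebraMap_iff {A B ι : Type*} [CommRing A] [CommRing B] [Algebra A B]
    (e : Module.Basis ι A B) (I : Ideal A) (x : B) :
    x ∈ I.map (algebraMap A B) ↔ ∀ b, e.repr x b ∈ I := by
  constructor
  · intro hx b
    have hx' : x ∈ (I • ⊤ : Submodule A B) := by
      rw [Ideal.smul_top_eq_map]
      exact hx
    clear hx
    induction hx' using Submodule.smul_induction_on' with
    | smul r hr n _ => simpa using I.mul_mem_right _ hr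
    | add x _ y _ ihx ihy => simpa using I.add_mem ihx ihy
  · intro h
    rw [← e.linearCombination_repr x, Finsupp.linearCombination_apply]
    refine Ideal.sum_mem _ fun b _ => ?_
    simp only [Algebra.smul_def]
    exact Ideal.mul_mem_right _ _ (Ideal.mem_map_of_mem _ (h b))

/-- Extension of ideals along a free ring homomorphism commutes with intersections. -/
theorem Ideal.map_inf_of_free {A B ι : Type*} [CommRing A] [CommRing B] (f : A →+* B) (e : ι → B)
    (hli : ∀ (s : Finset ι) (p : ι → A), ∑ b ∈ s, f (p b) * e b = 0 → ∀ b ∈ s, p b = 0)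
    (hspan : ∀ N : AddSubgroup B, (∀ a, ∀ x ∈ N, f a * x ∈ N) → (∀ b, e b ∈ N) → N = ⊤)
    (I J : Ideal A) : (I ⊓ J).map f = I.map f ⊓ J.map f := by
  let := f.toAlgebra
  have hli' : LinearIndependent A e := linearIndependent_iff'.2 hli
  have hsp : ⊤ ≤ Submodule.span A (Set.range e) := by
    have h := hspan (Submodule.span A (Set.range e)).toAddSubgroup
      (fun a x hx => Submodule.smul_mem _ a hx)
      (fun b => Submodule.subset_span (Set.mem_range_self b))
    intro x _
    have hx : x ∈ (⊤ : AddSubgroup B) := AddSubgroup.mem_top x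
    rwa [← h] at hx
  let E := Module.Basis.mk hli' hsp
  ext x
  have key := E.mem_map_algebraMap_iff (x := x)
  rw [RingHom.algebraMap_toAlgebra] at key
  simp only [Submodule.mem_inf, key, forall_and]

theorem MvPolynomial.exists_eq_X_zero_mul_add_rename_succ {k : Type*} [CommRing k] {n : ℕ}
    (p : MvPolynomial (Fin (n + 1)) k) :
    ∃ q p₀, p = X 0 * q + rename Fin.succ p₀ := by
  have hren : ∀ p₀ : MvPolynomial (Fin n) k,
      finSuccEquiv k n (rename Fin.succ p₀) = Polynomial.C p₀ := by
    intro p₀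
    induction p₀ using MvPolynomial.induction_on with
    | C a => simp [finSuccEquiv_apply]
    | add p q hp hq => simp [hp, hq]
    | mul_X p i hp => rw [map_mul, map_mul, hp, rename_X, finSuccEquiv_X_succ, map_mul]
  refine ⟨(finSuccEquiv k n).symm (finSuccEquiv k n p).divX, (finSuccEquiv k n p).coeff 0, ?_⟩
  apply (finSuccEquiv k n).injective
  rw [map_add, map_mul, AlgEquiv.apply_symm_apply, hren, finSuccEquiv_X_zero,
    Polynomial.X_mul_divX_add]

open scoped Pointwise in
/-- If `y` is a weakly regular sequence on `M`, a family in `M` that is linearly independent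
over `k` modulo `y` is linearly independent over the polynomial ring acting through `y`. -/
theorem RingTheory.Sequence.IsWeaklyRegular.eq_zero_of_sum_aeval_smul_eq_zero {k R : Type*}
    [CommRing k] [IsDomain k] [CommRing R] [Algebra k R] {ι : Type*} {n : ℕ} {M : Type*}
    [AddCommGroup M] [Module R M] {y : Fin n → R} (hreg : IsWeaklyRegular M (List.ofFn y)) {e : ι → M}
    {s : Finset ι}
    (hli : ∀ c : ι → k, ∑ b ∈ s, algebraMap k R (c b) • e b ∈
      (Ideal.ofList (List.ofFn y) • ⊤ : Submodule R M) → ∀ b ∈ s, c b = 0)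
    {p : ι → MvPolynomial (Fin n) k} (hp : ∑ b ∈ s, aeval y (p b) • e b = 0) :
    ∀ b ∈ s, p b = 0 := by
  induction n generalizing M with
  | zero =>
    have hC : ∀ b, p b = C ((p b).coeff 0) := fun b => eq_C_of_isEmpty (p b)
    intro b hb
    rw [hC b, hli (fun b => (p b).coeff 0) ?_ b hb, map_zero]
    have : ∑ b ∈ s, algebraMap k R ((p b).coeff 0) • e b = 0 := by
      rw [← hp]
      refine Finset.sum_congr rfl fun b _ => ?_
      conv_rhs => rw [hC b, aeval_C]
    rw [this]
    exact zero_mem _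
  | succ n ih =>
    rw [List.ofFn_succ, isWeaklyRegular_cons_iff] at hreg
    obtain ⟨hy, hreg⟩ := hreg
    have hdvd : ∀ q p₀ : ι → MvPolynomial _ k,
        ∑ b ∈ s, aeval y (X 0 * q b + rename Fin.succ (p₀ b)) • e b = 0 →
        ∀ b ∈ s, p₀ b = 0 := by
      intro q p₀ h
      refine ih hreg (e := fun b => Submodule.Quotient.mk (e b)) (fun c hc => hli c ?_) ?_
      · rw [List.ofFn_succ, Ideal.ofList_cons_smul, ← Submodule.ker_mkQ (y 0 • ⊤ : Submodule R M),
          sup_comm, ← Submodule.comap_map_eq, Submodule.mem_comap, Submodule.map_smul'',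
          Submodule.map_top, Submodule.range_mkQ]
        simpa using hc
      · have h' := congrArg (Submodule.mkQ (y 0 • ⊤ : Submodule R M)) h
        rw [map_zero, map_sum] at h'
        rw [← h']
        refine Finset.sum_congr rfl fun b _ => ?_
        rw [map_add, map_mul, aeval_X, aeval_rename, add_smul, mul_smul, map_add]
        have h0 : (Submodule.mkQ (y 0 • ⊤ : Submodule R M)) (y 0 • aeval y (q b) • e b) = 0 := by
          rw [Submodule.mkQ_apply, Submodule.Quotient.mk_eq_zero]
          exact Submodule.smul_mem_pointwise_smul _ _ _ trivial
        rw [h0, zero_add]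
        rfl
    suffices H : ∀ (D : ℕ) (p : ι → MvPolynomial (Fin (n + 1)) k),
        (∀ b ∈ s, p b ≠ 0 → (p b).totalDegree < D) → ∑ b ∈ s, aeval y (p b) • e b = 0 →
        ∀ b ∈ s, p b = 0 from
      H (s.sup (fun b => (p b).totalDegree) + 1) p
        (fun b hb _ => Nat.lt_succ_of_le (Finset.le_sup (f := fun b => (p b).totalDegree) hb)) hp
    intro D
    induction D with
    | zero =>
      intro p hD _ b hb
      by_contra h
      exact absurd (hD b hb h) (Nat.not_lt_zero _)
    | succ D ihD =>
      intro p hD hp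
      choose q p₀ hq using fun b => exists_eq_X_zero_mul_add_rename_succ (p b)
      have hp₀ := hdvd q p₀ (by simpa only [← hq] using hp)
      have hpq : ∀ b ∈ s, p b = X 0 * q b := fun b hb => by
        rw [hq b, hp₀ b hb, map_zero, add_zero]
      have hq0 : ∀ b ∈ s, q b = 0 := by
        refine ihD q (fun b hb hb0 => ?_) ?_
        · have hlt := hD b hb (by rw [hpq b hb]; exact mul_ne_zero (X_ne_zero 0) hb0)
          rw [hpq b hb, totalDegree_mul_of_isDomain (X_ne_zero 0) hb0, totalDegree_X] at hlt
          omega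
        · apply hy
          simp only [smul_zero]
          rw [Finset.smul_sum, ← hp]
          refine Finset.sum_congr rfl fun b hb => ?_
          rw [hpq b hb, map_mul, aeval_X, mul_smul]
      intro b hb
      rw [hpq b hb, hq0 b hb, mul_zero]

theorem MvPolynomial.homogeneousComponent_mem_of_mem_span {σ k ι : Type*} [CommRing k] [Fintype ι]
    {y : ι → MvPolynomial σ k} (hhom : ∀ i, ∃ d : ℕ, 0 < d ∧ (y i).IsHomogeneous d)
    (N : AddSubgroup (MvPolynomial σ k)) (hN : ∀ i, ∀ x ∈ N, y i * x ∈ N) (d : ℕ)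
    (hlt : ∀ m < d, ∀ f : MvPolynomial σ k, f.IsHomogeneous m → f ∈ N)
    {h : MvPolynomial σ k} (hh : h ∈ Ideal.span (Set.range y)) :
    homogeneousComponent d h ∈ N := by
  obtain ⟨c, rfl⟩ := Ideal.mem_span_range_iff_exists_fun.1 hh
  rw [map_sum]
  refine sum_mem fun i _ => ?_
  obtain ⟨m, hm, hy⟩ := hhom i
  rw [← sum_homogeneousComponent (c i), Finset.sum_mul, map_sum]
  refine sum_mem fun j _ => ?_
  have hj := homogeneousComponent_isHomogeneous j (c i)
  rw [homogeneousComponent_of_mem (hj.mul hy)]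
  split_ifs with hd
  · rw [mul_comm]
    exact hN i _ (hlt j (by omega) _ hj)
  · exact zero_mem _

/-- Graded Nakayama lemma: homogeneous polynomials spanning modulo the homogeneous polynomials `y`
of positive degree generate everything as a module over the subalgebra generated by `y`. -/
theorem MvPolynomial.eq_top_of_span_sup_span_eq_top {σ k ι κ : Type*} [CommRing k] [Fintype ι]
    {y : ι → MvPolynomial σ k} (hhom : ∀ i, ∃ d : ℕ, 0 < d ∧ (y i).IsHomogeneous d)
    {e : κ → MvPolynomial σ k} (he : ∀ b, ∃ d, (e b).IsHomogeneous d)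
    (hspan : Submodule.span k (Set.range e) ⊔
      (Ideal.span (Set.range y)).restrictScalars k = ⊤)
    (N : AddSubgroup (MvPolynomial σ k)) (hC : ∀ c, ∀ x ∈ N, C c * x ∈ N)
    (hN : ∀ i, ∀ x ∈ N, y i * x ∈ N) (heN : ∀ b, e b ∈ N) : N = ⊤ := by
  have hcomp : ∀ d, ∀ g ∈ Submodule.span k (Set.range e), homogeneousComponent d g ∈ N := by
    intro d g hg
    induction hg using Submodule.span_induction with
    | mem x hx =>
      obtain ⟨b, rfl⟩ := hx
      obtain ⟨m, hm⟩ := he b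
      rw [homogeneousComponent_of_mem hm]
      split_ifs
      exacts [heN b, zero_mem _]
    | zero => rw [map_zero]; exact zero_mem _
    | add x y _ _ hx hy => rw [map_add]; exact add_mem hx hy
    | smul a x _ hx => rw [map_smul, smul_eq_C_mul]; exact hC a _ hx
  have hhomog : ∀ d, ∀ f : MvPolynomial σ k, f.IsHomogeneous d → f ∈ N := by
    intro d
    induction d using Nat.strong_induction_on with
    | _ d ih =>
      intro f hf
      have hmem : f ∈ Submodule.span k (Set.range e) ⊔
          (Ideal.span (Set.range y)).restrictScalars k := hspan ▸ Submodule.mem_top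
      obtain ⟨g, hg, h, hh, hgh⟩ := Submodule.mem_sup.1 hmem
      have hfd : homogeneousComponent d f = f := by
        rw [homogeneousComponent_of_mem hf, if_pos rfl]
      rw [← hfd, ← hgh, map_add]
      exact add_mem (hcomp d g hg) (homogeneousComponent_mem_of_mem_span hhom N hN d ih hh)
  rw [eq_top_iff]
  intro f _
  rw [← sum_homogeneousComponent f]
  exact sum_mem fun d _ => hhomog d _ (homogeneousComponent_isHomogeneous d f)

/-- A quotient of a polynomial ring over a field has a basis of classes of homogeneous
polynomials. -/
theorem MvPolynomial.exists_homogeneous_basis_mod {σ k : Type*} [Field k]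
    (P : Ideal (MvPolynomial σ k)) :
    ∃ (B : Set (MvPolynomial σ k ⧸ P.restrictScalars k)) (e : B → MvPolynomial σ k),
      (∀ b, ∃ d, (e b).IsHomogeneous d) ∧
      LinearIndependent k (fun b => (P.restrictScalars k).mkQ (e b)) ∧
      Submodule.span k (Set.range e) ⊔ P.restrictScalars k = ⊤ := by
  let S : Set (MvPolynomial σ k) := {f | ∃ d, f.IsHomogeneous d}
  have hS : Submodule.span k S = ⊤ := by
    rw [eq_top_iff]
    intro f _
    rw [← sum_homogeneousComponent f]
    exact sum_mem fun d _ => Submodule.subset_span ⟨d, homogeneousComponent_isHomogeneous d f⟩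
  obtain ⟨B, hBS, hBspan, hBli⟩ :=
    exists_linearIndependent k ((P.restrictScalars k).mkQ '' S)
  choose e he hemk using fun b : B => hBS b.2
  refine ⟨B, e, he, ?_, ?_⟩
  · rw [show (fun b => (P.restrictScalars k).mkQ (e b)) = Subtype.val from _root_.funext hemk]
    exact hBli
  · have hrange : (P.restrictScalars k).mkQ '' Set.range e = B := by
      rw [← Set.range_comp]
      exact (congrArg Set.range (_root_.funext hemk)).trans Subtype.range_coe
    have hker := Submodule.comap_map_eq (P.restrictScalars k).mkQ (Submodule.span k (Set.range e))
    rw [Submodule.ker_mkQ] at hker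
    rw [← hker, Submodule.map_span, hrange, hBspan, ← Submodule.map_span, hS, Submodule.map_top,
      Submodule.range_mkQ, Submodule.comap_top]

/-- If `y_1, …, y_n` are homogeneous polynomials of positive degree forming a regular
sequence in `k[x_1,…,x_n]` and `φ` is the `k`-algebra endomorphism `x_i ↦ y_i`, then
for homogeneous ideals `I, J` (ideals generated by homogeneous polynomials) one has
`φ(I ∩ J)·R = φ(I)·R ∩ φ(J)·R`. -/
theorem map_inf_of_regular_sequence (k : Type*) [Field k] (n : ℕ)
    (y : Fin n → MvPolynomial (Fin n) k)
    (hhom : ∀ i, ∃ d : ℕ, 0 < d ∧ (y i).IsHomogeneous d)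
    (hreg : RingTheory.Sequence.IsRegular (MvPolynomial (Fin n) k) (List.ofFn y))
    (I J : Ideal (MvPolynomial (Fin n) k))
    (hI : ∃ S : Set (MvPolynomial (Fin n) k),
      (∀ f ∈ S, ∃ d : ℕ, MvPolynomial.IsHomogeneous f d) ∧ I = Ideal.span S)
    (hJ : ∃ S : Set (MvPolynomial (Fin n) k),
      (∀ f ∈ S, ∃ d : ℕ, MvPolynomial.IsHomogeneous f d) ∧ J = Ideal.span S) :
    Ideal.map (aeval y : MvPolynomial (Fin n) k →ₐ[k] MvPolynomial (Fin n) k) (I ⊓ J) =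
      Ideal.map (aeval y : MvPolynomial (Fin n) k →ₐ[k] MvPolynomial (Fin n) k) I ⊓
        Ideal.map (aeval y : MvPolynomial (Fin n) k →ₐ[k] MvPolynomial (Fin n) k) J := by
  obtain ⟨κ, e, he, hli, hspan⟩ := exists_homogeneous_basis_mod (Ideal.span (Set.range y))
  have hofList : Ideal.ofList (List.ofFn y) = Ideal.span (Set.range y) := by
    exact congrArg Ideal.span (Set.ext fun _ => List.mem_ofFn)
  refine Ideal.map_inf_of_free (aeval y : MvPolynomial (Fin n) k →ₐ[k] _).toRingHom e ?_ ?_ I J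
  · intro s p hp
    refine hreg.toIsWeaklyRegular.eq_zero_of_sum_aeval_smul_eq_zero (e := e) ?_ hp
    intro c hc
    rw [hofList, Ideal.smul_eq_mul, Ideal.mul_top] at hc
    have h0 : ((Ideal.span (Set.range y)).restrictScalars k).mkQ (∑ b ∈ s, c b • e b) = 0 := by
      rw [Submodule.mkQ_apply, Submodule.Quotient.mk_eq_zero, Submodule.restrictScalars_mem]
      simpa only [smul_eq_C_mul, smul_eq_mul, algebraMap_eq] using hc
    rw [map_sum] at h0
    exact linearIndependent_iff'.1 hli s c h0
  · intro N hN heN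
    refine eq_top_of_span_sup_span_eq_top hhom he hspan N (fun c x hx => ?_) (fun i x hx => ?_) heN
    · simpa [algebraMap_eq] using hN (C c) x hx
    · simpa using hN (X i) x hx
end

section
/- Let m ≥ 1, n ≥ 1, and let σ ⊆ [n] be any subset. Then the ideal ⟨x_i^m − x_j^m : i, j ∈ σ⟩ of ℂ[x_1, ..., x_n] is a radical ideal. -/
open MvPolynomial

/-- Over a domain containing a primitive `m`-th root of unity, `m ≥ 1`, the multiples of a nonzero
element `y` by the `m`-th roots of unity form a finite set whose monic annihilating polynomial is
`x ^ m - y ^ m`. -/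
theorem IsPrimitiveRoot.exists_finset_prod_sub_eq_pow_sub_pow {R : Type*} [CommRing R] [IsDomain R]
    {m : ℕ} {ζ : R} (hζ : IsPrimitiveRoot ζ m) (hm : 0 < m) {y : R} (hy : y ≠ 0) :
    ∃ T : Finset R, y ∈ T ∧ (∀ s ∈ T, s ^ m = y ^ m) ∧
      ∀ x, ∏ s ∈ T, (x - s) = x ^ m - y ^ m := by
  classical
  refine ⟨(Polynomial.nthRootsFinset m (1 : R)).image (· * y), ?_, ?_, fun x ↦ ?_⟩
  · exact Finset.mem_image.2 ⟨1, Polynomial.one_mem_nthRootsFinset hm, one_mul y⟩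
  · simp only [Finset.forall_mem_image]
    intro η hη
    rw [mul_pow, (Polynomial.mem_nthRootsFinset hm 1).1 hη, one_mul]
  · rw [Finset.prod_image (mul_left_injective₀ hy).injOn, hζ.pow_sub_pow_eq_prod_sub_mul x y hm]

/-- For a finite set of values `S i` containing `X i` for each variable, a polynomial vanishing at
all points of the grid `∏ i, S i` lies in any ideal containing all `∏ s ∈ S i, (X i - s)`. -/
theorem MvPolynomial.mem_of_aeval_eq_zero_on_grid {ι K : Type*} [Finite ι] [Field K]
    (I : Ideal (MvPolynomial ι K)) (S : ι → Finset (MvPolynomial ι K))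
    (hne : ∀ i, (S i).Nonempty) (hS : ∀ i, ∏ s ∈ S i, (X i - s) ∈ I) {f : MvPolynomial ι K}
    (hf : ∀ x : ι → MvPolynomial ι K, (∀ i, x i ∈ S i) → aeval x f = 0) : f ∈ I := by
  obtain ⟨h, -, hh⟩ := combinatorial_nullstellensatz_exists_linearCombination S hne
    (map (algebraMap K (MvPolynomial ι K)) f)
    (fun x hx ↦ by rw [eval_map, ← aeval_def]; exact hf x hx)
  have key := congrArg (eval X) hh
  rw [eval_map, ← aeval_def, aeval_X_left_apply, Finsupp.linearCombination_apply, Finsupp.sum,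
    map_sum] at key
  rw [key]
  refine I.sum_mem fun i _ ↦ ?_
  simpa [map_prod] using I.mul_mem_left (eval X (h i)) (hS i)

/-- For `m ≥ 1` and any subset `σ ⊆ [n]`, the ideal `⟨x_i^m - x_j^m : i, j ∈ σ⟩` of
`ℂ[x_1,…,x_n]` is radical. -/
theorem power_differences_ideal_isRadical (m n : ℕ) (hm : 1 ≤ m) (hn : 1 ≤ n)
    (σ : Finset (Fin n)) :
    (Ideal.span {f : MvPolynomial (Fin n) ℂ |
        ∃ i ∈ σ, ∃ j ∈ σ, f = X i ^ m - X j ^ m}).IsRadical := by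
  rintro f ⟨r, hr⟩
  have hζ : IsPrimitiveRoot (C (Complex.exp (2 * Real.pi * Complex.I / m)) :
      MvPolynomial (Fin n) ℂ) m :=
    (Complex.isPrimitiveRoot_exp m (by omega)).map_of_injective (C_injective (Fin n) ℂ)
  have hgrid : ∃ S : Fin n → Finset (MvPolynomial (Fin n) ℂ), (∀ i, (S i).Nonempty) ∧
      (∀ i, ∏ s ∈ S i, (X i - s) ∈ Ideal.span {f : MvPolynomial (Fin n) ℂ |
        ∃ i ∈ σ, ∃ j ∈ σ, f = X i ^ m - X j ^ m}) ∧
      ∀ i ∈ σ, ∀ j ∈ σ, ∀ s ∈ S i, ∀ t ∈ S j, s ^ m = t ^ m := by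
    rcases σ.eq_empty_or_nonempty with rfl | ⟨k, hk⟩
    · exact ⟨fun i ↦ {X i}, by simp, by simp, by simp⟩
    · obtain ⟨T, hkT, hT, hprod⟩ :=
        hζ.exists_finset_prod_sub_eq_pow_sub_pow hm (X_ne_zero (R := ℂ) k)
      refine ⟨fun i ↦ if i ∈ σ then T else {X i}, fun i ↦ ?_, fun i ↦ ?_, ?_⟩
      · dsimp only
        split_ifs
        exacts [⟨_, hkT⟩, by simp]
      · dsimp only
        split_ifs with hi
        · rw [hprod]
          exact Ideal.subset_span ⟨i, hi, k, hk, rfl⟩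
        · simp
      · dsimp only
        intro i hi j hj s hs t ht
        rw [if_pos hi] at hs
        rw [if_pos hj] at ht
        rw [hT s hs, hT t ht]
  obtain ⟨S, hne, hS, hpow⟩ := hgrid
  refine mem_of_aeval_eq_zero_on_grid _ S hne hS fun x hx ↦ ?_
  have hle : Ideal.span {f : MvPolynomial (Fin n) ℂ |
      ∃ i ∈ σ, ∃ j ∈ σ, f = X i ^ m - X j ^ m} ≤ RingHom.ker (aeval (R := ℂ) x) := by
    rw [Ideal.span_le]
    rintro _ ⟨i, hi, j, hj, rfl⟩
    simp [RingHom.mem_ker, hpow i hi j hj _ (hx i) _ (hx j)]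
  have h0 := hle hr
  rw [RingHom.mem_ker, map_pow] at h0
  exact eq_zero_of_pow_eq_zero h0
end

section
/- Let m ≥ 1 and 2 ≤ p ≤ n, and let η = e^{2πi/m} ∈ ℂ be a primitive m-th root of unity. Then in ℂ[x_1, ..., x_n] the ideal ⟨x_1^m − x_j^m : j = 2, ..., p⟩ equals the intersection, over all functions a : {2, ..., p} → {0, 1, ..., m−1}, of the ideals ⟨x_1 − η^{a(2)} x_2, x_1 − η^{a(3)} x_3, ..., x_1 − η^{a(p)} x_p⟩, and these m^{p−1} ideals are pairwise distinct. -/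
open MvPolynomial Complex

namespace PowerDifferences

variable {K σ ι : Type*} [Field K]

/-- The ideal generated by the differences `X o ^ m - X (v j) ^ m`. -/
noncomputable def powIdeal (K : Type*) [Field K] (m : ℕ) (o : σ) (v : ι → σ) : Ideal (MvPolynomial σ K) :=
  Ideal.span (Set.range fun j => X o ^ m - X (v j) ^ m)

/-- The ideal generated by the linear forms `X o - c j * X (v j)`. -/
noncomputable def linIdeal (o : σ) (v : ι → σ) (c : ι → K) : Ideal (MvPolynomial σ K) :=
  Ideal.span (Set.range fun j => X o - C (c j) * X (v j))

lemma powIdeal_le_linIdeal {m : ℕ} {o : σ} {v : ι → σ} {c : ι → K} (hc : ∀ j, c j ^ m = 1) :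
    powIdeal K m o v ≤ linIdeal o v c := by
  rw [powIdeal, Ideal.span_le]
  rintro _ ⟨j, rfl⟩
  have h : (X (v j) : MvPolynomial σ K) ^ m = (C (c j) * X (v j)) ^ m := by
    rw [mul_pow, ← C_pow, hc, C_1, one_mul]
  change X o ^ m - X (v j) ^ m ∈ linIdeal o v c
  rw [h]
  exact Ideal.mem_of_dvd _ (sub_dvd_pow_sub_pow _ _ m) (Ideal.subset_span ⟨j, rfl⟩)

section NormalForm

variable [Fintype σ] [DecidableEq σ]

/-- The exponent of the normal form of the monomial with exponent `e` modulo the relations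
`X o ^ m = X i ^ m`, `i ∈ S`. -/
noncomputable def reduceExp (m : ℕ) (o : σ) (S : Finset σ) (e : σ →₀ ℕ) : σ →₀ ℕ :=
  Finsupp.equivFunOnFinite.symm fun i =>
    (if i ∈ S then e i % m else e i) + if i = o then m * ∑ l ∈ S, e l / m else 0

lemma reduceExp_apply (m : ℕ) (o : σ) (S : Finset σ) (e : σ →₀ ℕ) (i : σ) :
    reduceExp m o S e i =
      (if i ∈ S then e i % m else e i) + if i = o then m * ∑ l ∈ S, e l / m else 0 := rfl

lemma reduceExp_add_single {m : ℕ} {o : σ} {S : Finset σ} (ho : o ∉ S) (e : σ →₀ ℕ) (k : ℕ) :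
    reduceExp m o S (e + Finsupp.single o k) = reduceExp m o S e + Finsupp.single o k := by
  have hs : ∑ l ∈ S, (e + Finsupp.single o k) l / m = ∑ l ∈ S, e l / m :=
    Finset.sum_congr rfl fun l hl => by
      rw [Finsupp.add_apply, Finsupp.single_eq_of_ne (ne_of_mem_of_not_mem hl ho), add_zero]
  ext i
  rw [Finsupp.add_apply, reduceExp_apply, reduceExp_apply, hs]
  by_cases hi : i = o
  · subst hi
    simp [ho]
    ring
  · simp [Finsupp.single_eq_of_ne hi, hi]

lemma reduceExp_add_single_of_mem {m : ℕ} (hm : 0 < m) {o : σ} {S : Finset σ} (ho : o ∉ S)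
    {i : σ} (hi : i ∈ S) (e : σ →₀ ℕ) :
    reduceExp m o S (e + Finsupp.single i m) = reduceExp m o S e + Finsupp.single o m := by
  have hs : ∑ l ∈ S, (e + Finsupp.single i m) l / m = ∑ l ∈ S, e l / m + 1 := by
    have h (l : σ) (_ : l ∈ S) :
        (e + Finsupp.single i m) l / m = e l / m + if i = l then 1 else 0 := by
      rw [Finsupp.add_apply, Finsupp.single_apply]
      split_ifs
      · exact Nat.add_div_right _ hm
      · simp
    rw [Finset.sum_congr rfl h, Finset.sum_add_distrib, Finset.sum_ite_eq, if_pos hi]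
  ext l
  rw [Finsupp.add_apply, reduceExp_apply, reduceExp_apply, hs]
  by_cases hl : l = o
  · subst hl
    have : l ≠ i := fun h => ho (h ▸ hi)
    simp [ho, Finsupp.single_eq_of_ne this]
    ring
  · by_cases hli : l = i
    · subst hli
      simp [hi, hl, Finsupp.single_eq_of_ne hl]
    · simp [hl, Finsupp.single_eq_of_ne hl, Finsupp.single_eq_of_ne hli]

/-- The linear map sending a monomial to its normal form. -/
noncomputable def reduce (K : Type*) [Field K] (m : ℕ) (o : σ) (S : Finset σ) :
    MvPolynomial σ K →ₗ[K] MvPolynomial σ K :=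
  (basisMonomials σ K).constr K fun e => monomial (reduceExp m o S e) 1

lemma reduce_monomial (m : ℕ) (o : σ) (S : Finset σ) (e : σ →₀ ℕ) (c : K) :
    reduce K m o S (monomial e c) = monomial (reduceExp m o S e) c := by
  have h := (basisMonomials σ K).constr_basis K (fun e => monomial (reduceExp m o S e) (1 : K)) e
  rw [coe_basisMonomials] at h
  have hc (d : σ →₀ ℕ) : monomial d c = c • monomial d (1 : K) := by
    rw [smul_monomial, smul_eq_mul, mul_one]
  rw [hc, map_smul, hc (reduceExp m o S e), ← h, reduce]

lemma reduce_mul_X_pow {m : ℕ} {o : σ} {S : Finset σ} (ho : o ∉ S) (k : ℕ)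
    (f : MvPolynomial σ K) :
    reduce K m o S (f * X o ^ k) = reduce K m o S f * X o ^ k := by
  induction f using MvPolynomial.induction_on' with
  | monomial e c =>
    rw [X_pow_eq_monomial, monomial_mul, reduce_monomial, reduce_monomial, monomial_mul,
      reduceExp_add_single ho]
  | add f g hf hg => rw [add_mul, map_add, hf, hg, map_add, add_mul]

lemma reduce_mul_X_pow_of_mem {m : ℕ} (hm : 0 < m) {o : σ} {S : Finset σ} (ho : o ∉ S)
    {i : σ} (hi : i ∈ S) (f : MvPolynomial σ K) :
    reduce K m o S (f * X i ^ m) = reduce K m o S f * X o ^ m := by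
  induction f using MvPolynomial.induction_on' with
  | monomial e c =>
    rw [X_pow_eq_monomial, X_pow_eq_monomial, monomial_mul, reduce_monomial, reduce_monomial,
      monomial_mul, reduceExp_add_single_of_mem hm ho hi]
  | add f g hf hg => rw [add_mul, map_add, hf, hg, map_add, add_mul]

variable [Fintype ι] {m : ℕ} {o : σ} {v : ι → σ}

lemma reduce_eq_zero_of_mem (hm : 0 < m) (ho : ∀ j, v j ≠ o) {f : MvPolynomial σ K}
    (hf : f ∈ powIdeal K m o v) : reduce K m o (Finset.univ.image v) f = 0 := by
  have ho' : o ∉ Finset.univ.image v := by simpa using ho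
  obtain ⟨g, rfl⟩ := (Ideal.mem_span_range_iff_exists_fun).mp hf
  rw [map_sum]
  refine Finset.sum_eq_zero fun j _ => ?_
  rw [mul_sub, map_sub, reduce_mul_X_pow ho',
    reduce_mul_X_pow_of_mem hm ho' (Finset.mem_image_of_mem v (Finset.mem_univ j)), sub_self]

lemma mk_reduce (f : MvPolynomial σ K) :
    Ideal.Quotient.mk (powIdeal K m o v) (reduce K m o (Finset.univ.image v) f) =
      Ideal.Quotient.mk (powIdeal K m o v) f := by
  induction f using MvPolynomial.induction_on' with
  | add f g hf hg => rw [map_add, map_add, hf, hg, map_add]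
  | monomial e c =>
    set q := Ideal.Quotient.mk (powIdeal K m o v)
    set S := Finset.univ.image v
    have hq (i : σ) (hi : i ∈ S) : q (X i) ^ m = q (X o) ^ m := by
      obtain ⟨j, -, rfl⟩ := Finset.mem_image.mp hi
      rw [← map_pow, ← map_pow]
      have hmem : X o ^ m - X (v j) ^ m ∈ powIdeal K m o v := Ideal.subset_span ⟨j, rfl⟩
      exact (Ideal.Quotient.eq.mpr hmem).symm
    have hmon (d : σ →₀ ℕ) : q (monomial d c) = q (C c) * ∏ i, q (X i) ^ d i := by
      rw [monomial_eq, map_mul, Finsupp.prod_fintype _ _ fun i => pow_zero _, map_prod]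
      simp only [map_pow]
    have he (i : σ) : q (X i) ^ e i = q (X i) ^ (if i ∈ S then e i % m else e i) *
        if i ∈ S then q (X o) ^ (m * (e i / m)) else 1 := by
      split_ifs with hi
      · rw [pow_mul, ← hq i hi, ← pow_mul, ← pow_add, Nat.mod_add_div]
      · rw [mul_one]
    have hr (i : σ) : q (X i) ^ reduceExp m o S e i =
        q (X i) ^ (if i ∈ S then e i % m else e i) *
          if i = o then q (X o) ^ (m * ∑ l ∈ S, e l / m) else 1 := by
      rw [reduceExp_apply, pow_add]
      split_ifs with _ h <;> simp_all
    rw [reduce_monomial, hmon, hmon]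
    simp only [he, hr, Finset.prod_mul_distrib, Finset.prod_ite_eq', Finset.mem_univ, if_true,
      Finset.prod_ite_mem, Finset.univ_inter, Finset.prod_pow_eq_pow_sum, Finset.mul_sum]

lemma mem_powIdeal_of_mul_X_pow_mem (hm : 0 < m) (ho : ∀ j, v j ≠ o) {k : ℕ}
    {f : MvPolynomial σ K} (hf : f * X o ^ k ∈ powIdeal K m o v) : f ∈ powIdeal K m o v := by
  have h := reduce_eq_zero_of_mem hm ho hf
  rw [reduce_mul_X_pow (by simpa using ho)] at h
  have h₀ := (mul_eq_zero.mp h).resolve_right (pow_ne_zero _ (X_ne_zero o))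
  rw [← Ideal.Quotient.eq_zero_iff_mem, ← mk_reduce, h₀, map_zero]

end NormalForm

lemma prod_mul_mem_powIdeal [Fintype ι] {m : ℕ} {o : σ} {v : ι → σ} {c : ι → K}
    {E : ι → MvPolynomial σ K}
    (hE : ∀ j, E j * (X o - C (c j) * X (v j)) = X o ^ m - X (v j) ^ m)
    {f : MvPolynomial σ K} (hf : f ∈ linIdeal o v c) : (∏ j, E j) * f ∈ powIdeal K m o v := by
  obtain ⟨g, rfl⟩ := Ideal.mem_span_range_iff_exists_fun.mp hf
  rw [Finset.mul_sum]
  refine sum_mem fun j _ => ?_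
  have hmem : X o ^ m - X (v j) ^ m ∈ powIdeal K m o v := Ideal.subset_span ⟨j, rfl⟩
  rw [mul_left_comm]
  refine Ideal.mul_mem_left _ _ (Ideal.mem_of_dvd _ ?_ hmem)
  rw [← hE j]
  exact mul_dvd_mul_right (Finset.dvd_prod_of_mem _ (Finset.mem_univ j)) _

lemma sum_geom_sum_rootsOfUnity {R : Type*} [CommRing R] [IsDomain R] {m : ℕ} (hm : 0 < m)
    {ζ : R} (hζ : IsPrimitiveRoot ζ m) (x y : R) :
    ∑ k : Fin m, ∑ t ∈ Finset.range m, x ^ t * (ζ ^ k.1 * y) ^ (m - 1 - t) =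
      m * x ^ (m - 1) := by
  rw [Finset.sum_comm, Finset.sum_eq_single_of_mem (m - 1) (by simp; omega)]
  · simp
  · intro t ht htm
    have ht' := Finset.mem_range.mp ht
    have h1 : ζ ^ (m - 1 - t) ≠ 1 := hζ.pow_ne_one_of_pos_of_lt (by omega) (by omega)
    have h2 : ∑ k : Fin m, (ζ ^ (m - 1 - t)) ^ k.1 = 0 := by
      rw [Fin.sum_univ_eq_sum_range fun k => (ζ ^ (m - 1 - t)) ^ k]
      refine (mul_eq_zero.mp ?_).resolve_right (sub_ne_zero.mpr h1)
      rw [geom_sum_mul, ← pow_mul, mul_comm, pow_mul, hζ.pow_eq_one, one_pow, sub_self]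
    calc _ = ∑ k : Fin m, (ζ ^ (m - 1 - t)) ^ k.1 * (x ^ t * y ^ (m - 1 - t)) :=
          Finset.sum_congr rfl fun k _ => by rw [mul_pow, ← pow_mul, ← pow_mul]; ring
      _ = 0 := by rw [← Finset.sum_mul, h2, zero_mul]

theorem powIdeal_eq_iInf_linIdeal [Fintype σ] [Fintype ι] {m : ℕ} (hm : 0 < m)
    (hmK : (m : K) ≠ 0) {η : K} (hη : IsPrimitiveRoot η m) {o : σ} {v : ι → σ}
    (ho : ∀ j, v j ≠ o) :
    powIdeal K m o v = ⨅ a : ι → Fin m, linIdeal o v fun j => η ^ (a j).1 := by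
  classical
  refine le_antisymm (le_iInf fun a => powIdeal_le_linIdeal fun j => ?_) fun f hf => ?_
  · rw [← pow_mul, mul_comm, pow_mul, hη.pow_eq_one, one_pow]
  let E (j : ι) (k : Fin m) : MvPolynomial σ K :=
    ∑ t ∈ Finset.range m, X o ^ t * (C η ^ k.1 * X (v j)) ^ (m - 1 - t)
  have hE (j : ι) (k : Fin m) :
      E j k * (X o - C (η ^ k.1) * X (v j)) = X o ^ m - X (v j) ^ m := by
    rw [C_pow, geom_sum₂_mul, mul_pow, ← pow_mul, mul_comm k.1, pow_mul, ← C_pow,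
      hη.pow_eq_one, C_1, one_pow, one_mul]
  have hprod (a : ι → Fin m) : (∏ j, E j (a j)) * f ∈ powIdeal K m o v := by
    exact prod_mul_mem_powIdeal (fun j => hE j (a j)) ((Submodule.mem_iInf _).mp hf a)
  have hsum : (∑ a : ι → Fin m, ∏ j, E j (a j)) =
      C ((m : K) ^ Fintype.card ι) * X o ^ ((m - 1) * Fintype.card ι) := by
    rw [← Fintype.piFinset_univ, ← Finset.prod_univ_sum]
    simp only [E, sum_geom_sum_rootsOfUnity hm (hη.map_of_injective (C_injective σ K))]
    simp [mul_pow, pow_mul]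
  have hmem : C ((m : K) ^ Fintype.card ι) * X o ^ ((m - 1) * Fintype.card ι) * f ∈
      powIdeal K m o v := by
    rw [← hsum, Finset.sum_mul]
    exact sum_mem fun a _ => hprod a
  refine mem_powIdeal_of_mul_X_pow_mem (k := (m - 1) * Fintype.card ι) hm ho ?_
  have h := Ideal.mul_mem_left _ (C ((m : K) ^ Fintype.card ι)⁻¹) hmem
  rwa [mul_assoc, ← mul_assoc, ← C_mul, inv_mul_cancel₀ (pow_ne_zero _ hmK), C_1, one_mul,
    mul_comm] at h

theorem linIdeal_injective {o : σ} {v : ι → σ} (hv : Function.Injective v) (ho : ∀ j, v j ≠ o)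
    {c d : ι → K} (hc : ∀ j, c j ≠ 0) (h : linIdeal o v c = linIdeal o v d) : c = d := by
  let x : σ → K := Function.extend v (fun j => (c j)⁻¹) 1
  have hxv (j : ι) : x (v j) = (c j)⁻¹ := hv.extend_apply _ _ _
  have hxo : x o = 1 := Function.extend_apply' _ _ _ fun ⟨j, hj⟩ => ho j hj
  have hle : linIdeal o v c ≤ RingHom.ker (eval x) := by
    rw [linIdeal, Ideal.span_le]
    rintro _ ⟨j, rfl⟩
    simp [RingHom.mem_ker, hxv, hxo, hc]
  funext j
  have hj : X o - C (d j) * X (v j) ∈ RingHom.ker (eval x) :=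
    hle (h ▸ Ideal.subset_span ⟨j, rfl⟩)
  have hj' : 1 - d j * (c j)⁻¹ = 0 := by simpa [RingHom.mem_ker, hxv, hxo] using hj
  rw [sub_eq_zero, ← div_eq_mul_inv, eq_comm, div_eq_one_iff_eq (hc j)] at hj'
  exact hj'.symm

end PowerDifferences

/-- For `m ≥ 1`, `2 ≤ p ≤ n`, and `η = e^{2πi/m}`, the ideal
`⟨x_1^m - x_j^m : j = 2,…,p⟩` of `ℂ[x_1,…,x_n]` is the intersection, over all
`a : {2,…,p} → {0,…,m-1}`, of the ideals `⟨x_1 - η^{a(j)} x_j : j = 2,…,p⟩`, and these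
`m^{p-1}` ideals are pairwise distinct. -/
theorem power_differences_ideal_eq_inf_linear (m n p : ℕ) (hm : 1 ≤ m)
    (hp : 2 ≤ p) (hpn : p ≤ n) :
    (Ideal.span (Set.range fun j : Fin (p - 1) =>
        (X (⟨0, by omega⟩ : Fin n) ^ m - X (⟨j.1 + 1, by omega⟩ : Fin n) ^ m :
          MvPolynomial (Fin n) ℂ)) =
      ⨅ a : Fin (p - 1) → Fin m,
        Ideal.span (Set.range fun j : Fin (p - 1) =>
          (X (⟨0, by omega⟩ : Fin n) -
            C (Complex.exp (2 * Real.pi * Complex.I / m) ^ (a j).1) *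
              X (⟨j.1 + 1, by omega⟩ : Fin n) : MvPolynomial (Fin n) ℂ))) ∧
    Function.Injective (fun a : Fin (p - 1) → Fin m =>
      Ideal.span (Set.range fun j : Fin (p - 1) =>
        (X (⟨0, by omega⟩ : Fin n) -
          C (Complex.exp (2 * Real.pi * Complex.I / m) ^ (a j).1) *
            X (⟨j.1 + 1, by omega⟩ : Fin n) : MvPolynomial (Fin n) ℂ))) := by
  have hη : IsPrimitiveRoot (Complex.exp (2 * Real.pi * Complex.I / m)) m :=
    Complex.isPrimitiveRoot_exp m (by omega)
  let v : Fin (p - 1) → Fin n := fun j => ⟨j.1 + 1, by omega⟩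
  have hv : Function.Injective v := fun i j h => by
    simpa [v, Fin.ext_iff] using h
  have ho (j : Fin (p - 1)) : v j ≠ ⟨0, by omega⟩ := by simp [v]
  refine ⟨PowerDifferences.powIdeal_eq_iInf_linIdeal hm (by exact_mod_cast (by omega : m ≠ 0))
    hη ho, fun a b h => ?_⟩
  have hab := PowerDifferences.linIdeal_injective hv ho
    (fun j => pow_ne_zero _ (hη.ne_zero (by omega))) h
  funext j
  exact Fin.ext (hη.pow_inj (a j).2 (b j).2 (congrFun hab j))
end

section
/- Let k be a field and let Q_1, ..., Q_t ∈ k[x_1, ..., x_n] form a regular sequence, where each Q_j = ∏_{l=1}^{d_j} L_{j,l} is a product of homogeneous linear forms L_{j,l} (homogeneous polynomials of degree 1). Suppose that the ∏_{j=1}^{t} d_j ideals ⟨L_{1,c(1)}, L_{2,c(2)}, ..., L_{t,c(t)}⟩, as c ranges over all choice functions with 1 ≤ c(j) ≤ d_j for each j, are pairwise distinct. Then ⟨Q_1, ..., Q_t⟩ = ⋂_c ⟨L_{1,c(1)}, ..., L_{t,c(t)}⟩, the intersection taken over all such choice functions c. -/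
open MvPolynomial

theorem RingTheory.Sequence.IsWeaklyRegular.length_le_height {R : Type*} [CommRing R]
    [IsNoetherianRing R] {rs : List R} (reg : RingTheory.Sequence.IsWeaklyRegular R rs)
    (p : Ideal R) [p.IsPrime] (mem : ∀ r ∈ rs, r ∈ p) : (rs.length : ℕ∞) ≤ p.height := by
  have hreg := reg.isRegular_of_isLocalization_of_mem (Localization.AtPrime p) p mem
  have hdim := ringKrullDim_add_length_eq_ringKrullDim_of_isRegular _ hreg
  have hne : Nontrivial (Localization.AtPrime p ⧸
      Ideal.ofList (rs.map (algebraMap R (Localization.AtPrime p)))) := by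
    refine Ideal.Quotient.nontrivial_iff.mpr fun h => hreg.top_ne_smul ?_
    simp [h]
  rw [IsLocalization.AtPrime.ringKrullDim_eq_height p (Localization.AtPrime p), List.length_map] at hdim
  have h : ((rs.length : ℕ∞) : WithBot ℕ∞) ≤ (p.height : WithBot ℕ∞) := by
    rw [← hdim]
    exact le_add_of_nonneg_left ringKrullDim_nonneg_of_nontrivial
  exact_mod_cast h

/-- A linear projection along a subspace `W` of linear forms extends to an algebra endomorphism
whose kernel is the ideal generated by `W`. -/
theorem MvPolynomial.exists_algHom_ker_eq_span {k σ : Type*} [Field k]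
    {W : Submodule k (MvPolynomial σ k)} (hW : W ≤ homogeneousSubmodule σ k 1) :
    ∃ φ : MvPolynomial σ k →ₐ[k] MvPolynomial σ k,
      RingHom.ker φ = Ideal.span (W : Set (MvPolynomial σ k)) ∧
      ∀ v : MvPolynomial σ k, v.IsHomogeneous 1 → φ v = 0 → v ∈ W := by
  obtain ⟨W', hc⟩ := W.exists_isCompl
  let p := W'.projection W hc.symm
  have hker : LinearMap.ker p = W := Submodule.ker_projection hc.symm
  let φ : MvPolynomial σ k →ₐ[k] MvPolynomial σ k := aeval fun i => p (X i)
  have hφ : ∀ v ∈ homogeneousSubmodule σ k 1, φ v = p v := by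
    intro v hv
    rw [homogeneousSubmodule_one_eq_span_X] at hv
    exact LinearMap.eqOn_span (f := φ.toLinearMap) (g := p)
      (by rintro _ ⟨i, rfl⟩; simp [φ]) hv
  refine ⟨φ, le_antisymm (fun f hf => ?_) (Ideal.span_le.mpr fun w hw => ?_), fun v hv h => ?_⟩
  · have hmk : (Ideal.Quotient.mkₐ k (Ideal.span (W : Set (MvPolynomial σ k)))).comp φ =
        Ideal.Quotient.mkₐ k _ := by
      refine algHom_ext fun i => ?_
      simp only [φ, AlgHom.comp_apply, aeval_X, Ideal.Quotient.mkₐ_eq_mk]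
      refine Ideal.Quotient.eq.mpr (Ideal.subset_span ?_)
      rw [SetLike.mem_coe, ← hker, LinearMap.mem_ker, map_sub, sub_eq_zero]
      exact Submodule.projection_apply_of_mem_left _ (Submodule.projection_apply_mem _ _)
    have := DFunLike.congr_fun hmk f
    simp only [AlgHom.comp_apply, Ideal.Quotient.mkₐ_eq_mk, RingHom.mem_ker.mp hf,
      map_zero] at this
    exact Ideal.Quotient.eq_zero_iff_mem.mp this.symm
  · rw [SetLike.mem_coe, RingHom.mem_ker, hφ w (hW hw), ← LinearMap.mem_ker, hker]
    exact hw
  · rw [← hker, LinearMap.mem_ker, ← hφ v hv, h]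

theorem Ideal.span_submodule_span {k R : Type*} [CommSemiring k] [Semiring R] [Algebra k R]
    (s : Set R) : Ideal.span (Submodule.span k s : Set R) = Ideal.span s :=
  Submodule.span_span_of_tower k R s

theorem MvPolynomial.isPrime_span_of_isHomogeneous_one {k σ : Type*} [Field k]
    {s : Set (MvPolynomial σ k)} (hs : ∀ f ∈ s, f.IsHomogeneous 1) : (Ideal.span s).IsPrime := by
  have hW : Submodule.span k s ≤ homogeneousSubmodule σ k 1 := Submodule.span_le.mpr hs
  obtain ⟨φ, hφ, -⟩ := exists_algHom_ker_eq_span hW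
  rw [← Ideal.span_submodule_span (k := k), ← hφ]
  exact RingHom.ker_isPrime φ

theorem MvPolynomial.mem_span_of_mem_ideal_span {k σ : Type*} [Field k]
    {s : Set (MvPolynomial σ k)} (hs : ∀ f ∈ s, f.IsHomogeneous 1) {v : MvPolynomial σ k}
    (hv : v.IsHomogeneous 1) (h : v ∈ Ideal.span s) : v ∈ Submodule.span k s := by
  have hW : Submodule.span k s ≤ homogeneousSubmodule σ k 1 := Submodule.span_le.mpr hs
  obtain ⟨φ, hφ, h'⟩ := exists_algHom_ker_eq_span hW
  refine h' v hv ?_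
  rwa [← RingHom.mem_ker, hφ, Ideal.span_submodule_span]

theorem Ideal.height_span_le_finrank {k R : Type*} [Field k] [CommRing R] [Algebra k R]
    [IsNoetherianRing R] (s : Set R) (hfin : s.Finite) (hs : Ideal.span s ≠ ⊤) :
    (Ideal.span s).height ≤ Module.finrank k (Submodule.span k s) := by
  have : Module.Finite k (Submodule.span k s) := FiniteDimensional.span_of_finite k hfin
  obtain ⟨t, -, ht, hspan, -⟩ := Submodule.exists_finset_span_eq_linearIndepOn k s
  rw [← ht]
  rw [← span_submodule_span (k := k) s, ← hspan, span_submodule_span] at hs ⊢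
  obtain ⟨p, hp⟩ := Ideal.nonempty_minimalPrimes hs
  exact (Ideal.height_mono hp.1.2).trans
    (Ideal.height_le_card_of_mem_minimalPrimes_span_finset hp)

theorem Ideal.span_mul_sup_eq_inf {R : Type*} [CommRing R] (a b : R) (J : Ideal R)
    (h : ∀ u, a * u ∈ Ideal.span {b} ⊔ J → u ∈ Ideal.span {b} ⊔ J) :
    Ideal.span {a * b} ⊔ J = (Ideal.span {a} ⊔ J) ⊓ (Ideal.span {b} ⊔ J) := by
  refine le_antisymm (le_inf ?_ ?_) ?_
  · exact sup_le_sup_right (Ideal.span_singleton_le_span_singleton.mpr (dvd_mul_right a b)) J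
  · exact sup_le_sup_right (Ideal.span_singleton_le_span_singleton.mpr (dvd_mul_left b a)) J
  · rintro z ⟨hza, hzb⟩
    obtain ⟨_, hu, w, hw, rfl⟩ := Submodule.mem_sup.mp hza
    obtain ⟨u, rfl⟩ := Ideal.mem_span_singleton.mp hu
    have hau : a * u ∈ Ideal.span {b} ⊔ J := by
      have := Ideal.sub_mem _ hzb (Ideal.mem_sup_right hw)
      rwa [add_sub_cancel_right] at this
    obtain ⟨_, hv, x, hx, rfl⟩ := Submodule.mem_sup.mp (h u hau)
    obtain ⟨v, rfl⟩ := Ideal.mem_span_singleton.mp hv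
    rw [mul_add, add_assoc, ← mul_assoc]
    exact Ideal.add_mem _ (Ideal.mem_sup_left (Ideal.mem_span_singleton.mpr (dvd_mul_right _ _)))
      (Ideal.mem_sup_right (J.add_mem (J.mul_mem_left a hx) hw))

theorem Ideal.span_range_prod_eq_iInf {R ι : Type*} [CommRing R] [Finite ι] {α : ι → Type*}
    (L : ∀ j, α j → R)
    (hprime : ∀ c : ∀ j, α j, (Ideal.span (Set.range fun j => L j (c j))).IsPrime)
    (hmem : ∀ (c : ∀ j, α j) (j : ι) (a : α j),
      L j a ∈ Ideal.span (Set.range fun j => L j (c j)) → a = c j)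
    (S : ∀ j, Finset (α j)) :
    Ideal.span (Set.range fun j => ∏ l ∈ S j, L j l) =
      ⨅ (c : ∀ j, α j) (_ : ∀ j, c j ∈ S j), Ideal.span (Set.range fun j => L j (c j)) := by
  classical
  have := Fintype.ofFinite ι
  induction hN : ∑ j, (S j).card using Nat.strong_induction_on generalizing S with
  | _ N ih =>
  by_cases hempty : ∃ j, S j = ∅
  · obtain ⟨j, hj⟩ := hempty
    have htop : Ideal.span (Set.range fun j => ∏ l ∈ S j, L j l) = ⊤ :=
      (Ideal.eq_top_iff_one _).mpr (Ideal.subset_span ⟨j, by simp [hj]⟩)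
    rw [htop, eq_comm]
    refine iInf₂_eq_top.mpr fun c hc => ?_
    simpa [hj] using hc j
  by_cases hone : ∀ j, (S j).card = 1
  · choose c₀ hc₀ using fun j => Finset.card_eq_one.mp (hone j)
    have hS : ∀ c : ∀ j, α j, (∀ j, c j ∈ S j) ↔ c = c₀ := fun c => by
      simp [hc₀, _root_.funext_iff]
    simp only [hS, iInf_iInf_eq_left]
    simp [hc₀]
  push Not at hempty hone
  obtain ⟨j, hj⟩ := hone
  obtain ⟨a, ha⟩ := hempty j
  have hcard : 2 ≤ (S j).card := by
    have := Finset.card_pos.mpr (hempty j)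
    omega
  have hlt : ∀ U : Finset (α j), U.card < (S j).card →
      ∑ i, (Function.update S j U i).card < N := fun U hU => by
    rw [← hN]
    refine Finset.sum_lt_sum (fun i _ => ?_) ⟨j, Finset.mem_univ j, by simpa using hU⟩
    by_cases hi : i = j
    · subst hi; simpa using hU.le
    · simp [hi]
  set J := Ideal.span ((fun i => ∏ l ∈ S i, L i l) '' {j}ᶜ) with hJ
  have hsplit : ∀ U : Finset (α j),
      Ideal.span (Set.range fun i => ∏ l ∈ Function.update S j U i, L i l) =
        Ideal.span {∏ l ∈ U, L j l} ⊔ J := fun U => by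
    rw [hJ, ← Ideal.span_union, ← Set.image_univ, ← Set.union_compl_self {j}, Set.image_union,
      Set.image_singleton, Function.update_self]
    congr 2
    exact Set.image_congr fun i hi => by rw [Function.update_of_ne hi]
  have hdecomp : ∀ U : Finset (α j), U.card < (S j).card → Ideal.span {∏ l ∈ U, L j l} ⊔ J =
      ⨅ (c : ∀ j, α j) (_ : ∀ i, c i ∈ Function.update S j U i),
        Ideal.span (Set.range fun j => L j (c j)) := fun U hU => by
    rw [← hsplit, ih _ (hlt U hU) _ rfl]
  have ha' := hdecomp {a} (by simp; omega)
  have hb' := hdecomp ((S j).erase a) (Finset.card_erase_lt_of_mem ha)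
  have hall := hsplit (S j)
  rw [Function.update_eq_self, ← Finset.mul_prod_erase _ _ ha] at hall
  rw [Finset.prod_singleton] at ha'
  rw [hall, Ideal.span_mul_sup_eq_inf, ha', hb']
  · have hmemU : ∀ (U : Finset (α j)) (c : ∀ j, α j),
        (∀ i, c i ∈ Function.update S j U i) ↔ c j ∈ U ∧ ∀ i ≠ j, c i ∈ S i := fun U c => by
      rw [Function.forall_update_iff S (fun i s => c i ∈ s)]
    have hmemS : ∀ c : ∀ j, α j, (∀ i, c i ∈ S i) ↔
        (∀ i, c i ∈ Function.update S j {a} i) ∨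
          ∀ i, c i ∈ Function.update S j ((S j).erase a) i := fun c => by
      rw [hmemU, hmemU, ← or_and_right, ← Finset.mem_union, ← Finset.insert_eq,
        Finset.insert_erase ha, ← hmemU, Function.update_eq_self]
    simp only [hmemS, iInf_or, iInf_inf_eq]
  · intro u hu
    rw [hb'] at hu ⊢
    simp only [Submodule.mem_iInf] at hu ⊢
    intro c hc
    refine ((hprime c).mem_or_mem (hu c hc)).resolve_left fun h => ?_
    have := hc j
    rw [Function.update_self, ← hmem c j a h] at this
    exact Finset.notMem_erase a _ this

/-- If `Q_1, …, Q_t` form a regular sequence in `k[x_1,…,x_n]`, where each `Q_j` is a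
product of homogeneous linear forms `L_{j,1}, …, L_{j,d_j}`, and the ideals
`⟨L_{1,c(1)}, …, L_{t,c(t)}⟩` obtained from all choice functions `c` are pairwise
distinct, then `⟨Q_1, …, Q_t⟩ = ⋂_c ⟨L_{1,c(1)}, …, L_{t,c(t)}⟩`. -/
theorem regular_sequence_of_linear_products_eq_inf (k : Type*) [Field k] (n t : ℕ)
    (d : Fin t → ℕ) (L : (j : Fin t) → Fin (d j) → MvPolynomial (Fin n) k)
    (hlin : ∀ j l, (L j l).IsHomogeneous 1)
    (hreg : RingTheory.Sequence.IsRegular (MvPolynomial (Fin n) k)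
      (List.ofFn fun j : Fin t => ∏ l : Fin (d j), L j l))
    (hdist : Function.Injective fun c : (j : Fin t) → Fin (d j) =>
      Ideal.span (Set.range fun j : Fin t => L j (c j))) :
    Ideal.span (Set.range fun j : Fin t => ∏ l : Fin (d j), L j l) =
      ⨅ c : (j : Fin t) → Fin (d j),
        Ideal.span (Set.range fun j : Fin t => L j (c j)) := by
  have hhom : ∀ c : (j : Fin t) → Fin (d j), ∀ f ∈ Set.range fun j => L j (c j),
      f.IsHomogeneous 1 := by
    rintro c _ ⟨j, rfl⟩
    exact hlin j (c j)
  have hprime : ∀ c : (j : Fin t) → Fin (d j),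
      (Ideal.span (Set.range fun j => L j (c j))).IsPrime := fun c =>
    MvPolynomial.isPrime_span_of_isHomogeneous_one (hhom c)
  have hrank : ∀ c : (j : Fin t) → Fin (d j),
      Module.finrank k (Submodule.span k (Set.range fun j => L j (c j))) = t := by
    intro c
    refine le_antisymm ((finrank_range_le_card _).trans_eq (Fintype.card_fin t)) ?_
    have := hprime c
    have hle := hreg.toIsWeaklyRegular.length_le_height
      (Ideal.span (Set.range fun j => L j (c j))) fun r hr => by
        obtain ⟨j, rfl⟩ := List.mem_ofFn.mp hr
        exact Ideal.mem_of_dvd _ (Finset.dvd_prod_of_mem (L j) (Finset.mem_univ (c j)))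
          (Ideal.subset_span ⟨j, rfl⟩)
    rw [List.length_ofFn] at hle
    exact_mod_cast hle.trans (Ideal.height_span_le_finrank (k := k) _ (Set.finite_range _)
      (hprime c).ne_top)
  have hmem : ∀ (c : (j : Fin t) → Fin (d j)) (j : Fin t) (a : Fin (d j)),
      L j a ∈ Ideal.span (Set.range fun j => L j (c j)) → a = c j := by
    intro c j a h
    have hle : Submodule.span k (Set.range fun i => L i (Function.update c j a i)) ≤
        Submodule.span k (Set.range fun i => L i (c i)) := by
      rw [Submodule.span_le]
      rintro _ ⟨i, rfl⟩
      by_cases hi : i = j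
      · subst hi
        simpa using MvPolynomial.mem_span_of_mem_ideal_span (hhom c) (hlin i a) h
      · exact Submodule.subset_span ⟨i, by simp [hi]⟩
    have := FiniteDimensional.span_of_finite k (Set.finite_range fun i => L i (c i))
    have heq := Submodule.eq_of_le_of_finrank_eq hle ((hrank _).trans (hrank c).symm)
    have hc : Function.update c j a = c := hdist <| by
      simp only
      rw [← Ideal.span_submodule_span (k := k), heq, Ideal.span_submodule_span]
    rw [← congrFun hc j, Function.update_self]
  simpa using Ideal.span_range_prod_eq_iInf L hprime hmem fun _ => Finset.univ
end

section
/- Let m ≥ 1, n ≥ 1, and let λ be any partition of [n]. Then the ideal I_λ = ⟨x_i^m − x_j^m : i ≡_λ j⟩ of ℂ[x_1, ..., x_n] is a radical ideal. -/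
open MvPolynomial

/-- The character `c ↦ ∏ i, c i ^ e i` of the group of tuples of `m`-th roots of unity. -/
noncomputable def rootsOfUnityMonomialChar {σ : Type*} [Fintype σ] (m : ℕ) (e : σ →₀ ℕ) :
    (σ → rootsOfUnity m ℂ) →* ℂ where
  toFun c := ∏ i, ((c i : ℂˣ) : ℂ) ^ e i
  map_one' := by simp
  map_mul' c d := by simp [mul_pow, Finset.prod_mul_distrib]

theorem rootsOfUnityMonomialChar_apply {σ : Type*} [Fintype σ] (m : ℕ) (e : σ →₀ ℕ)
    (c : σ → rootsOfUnity m ℂ) :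
    rootsOfUnityMonomialChar m e c = ∏ i, ((c i : ℂˣ) : ℂ) ^ e i := rfl

/-- The character attached to an exponent vector determines that vector modulo `m`. -/
theorem mod_eq_of_rootsOfUnityMonomialChar_eq {σ : Type*} [Fintype σ] {m : ℕ} (hm : m ≠ 0)
    {e e' : σ →₀ ℕ} (h : rootsOfUnityMonomialChar m e = rootsOfUnityMonomialChar m e') (i : σ) :
    e i % m = e' i % m := by
  classical
  have : NeZero m := ⟨hm⟩
  have hζ := Complex.isPrimitiveRoot_exp m hm
  have key : ∀ a : σ →₀ ℕ, rootsOfUnityMonomialChar m a (Pi.mulSingle i hζ.toRootsOfUnity) =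
      Complex.exp (2 * Real.pi * Complex.I / m) ^ a i := by
    intro a
    rw [rootsOfUnityMonomialChar_apply, Finset.prod_eq_single i]
    · simp
    · intro j _ hj
      simp [Pi.mulSingle_eq_of_ne hj]
    · simp
  have h1 := DFunLike.congr_fun h (Pi.mulSingle i hζ.toRootsOfUnity)
  rw [key, key] at h1
  have h2 := (hζ.isOfFinOrder hm).pow_eq_pow_iff_modEq.1 h1
  rwa [← hζ.eq_orderOf] at h2

/-- Vanishing of a linear combination of characters forces vanishing of the total coefficient of
each character. -/
theorem sum_filter_monoidHom_eq_zero {G ι : Type*} [Monoid G] [DecidableEq (G →* ℂ)]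
    (s : Finset ι) (a : ι → ℂ) (χ : ι → G →* ℂ) (h : ∀ g, ∑ i ∈ s, a i * χ i g = 0)
    (ψ : G →* ℂ) : ∑ i ∈ s with χ i = ψ, a i = 0 := by
  by_cases hψ : ψ ∈ s.image χ
  · refine linearIndependent_iff'.1 (linearIndependent_monoidHom G ℂ) (s.image χ)
      (fun ψ => ∑ i ∈ s with χ i = ψ, a i) ?_ ψ hψ
    funext g
    rw [Finset.sum_apply, Pi.zero_apply, ← h g,
      ← Finset.sum_fiberwise_of_maps_to (fun i hi => Finset.mem_image_of_mem χ hi)]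
    refine Finset.sum_congr rfl fun ψ _ => ?_
    rw [Pi.smul_apply, smul_eq_mul, Finset.sum_mul]
    refine Finset.sum_congr rfl fun i hi => ?_
    rw [(Finset.mem_filter.1 hi).2]
  · refine Finset.sum_eq_zero fun i hi => ?_
    rw [Finset.mem_filter] at hi
    exact absurd (Finset.mem_image.2 ⟨i, hi.1, hi.2⟩) hψ

/-- If `u i ^ m = u (r i) ^ m` for all `i`, then the monomial in `u` with exponent vector `e`
depends only on `e` modulo `m` and on the pushforward of `e` along `r`. -/
theorem prod_pow_eq_of_mapDomain_eq {σ A : Type*} [Fintype σ] [CommRing A] {m : ℕ} (r : σ → σ)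
    (u : σ → A) (hu : ∀ i, u i ^ m = u (r i) ^ m) {e e' : σ →₀ ℕ}
    (hd : e.mapDomain r = e'.mapDomain r) (hmod : ∀ i, e i % m = e' i % m) :
    ∏ i, u i ^ e i = ∏ i, u i ^ e' i := by
  let a : σ →₀ ℕ := Finsupp.equivFunOnFinite.symm fun i => e i % m
  let q (e : σ →₀ ℕ) : σ →₀ ℕ := Finsupp.equivFunOnFinite.symm fun i => m * (e i / m)
  have split : ∀ f : σ →₀ ℕ, (∀ i, f i % m = e i % m) → f = a + q f := by
    intro f hf
    ext i
    simp [a, q, ← hf i, Nat.mod_add_div]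
  have push : ∀ f : σ →₀ ℕ, (f.mapDomain r).prod (fun i k => u i ^ k) = ∏ i, u (r i) ^ f i := by
    intro f
    rw [Finsupp.prod_mapDomain_index (by simp) (by intros; rw [pow_add]),
      Finsupp.prod_fintype _ _ (by simp)]
  have expand : ∀ f : σ →₀ ℕ, (∀ i, f i % m = e i % m) →
      ∏ i, u i ^ f i = (∏ i, u i ^ a i) * ((q f).mapDomain r).prod (fun i k => u i ^ k) := by
    intro f hf
    rw [push, ← Finset.prod_mul_distrib]
    refine Finset.prod_congr rfl fun i _ => ?_
    conv_lhs => rw [split f hf]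
    rw [Finsupp.add_apply, pow_add]
    congr 1
    simp only [q, Finsupp.equivFunOnFinite_symm_apply_apply, pow_mul, hu i]
  have hq : (q e).mapDomain r = (q e').mapDomain r := by
    rw [split e fun _ => rfl, split e' fun i => (hmod i).symm, Finsupp.mapDomain_add,
      Finsupp.mapDomain_add] at hd
    exact add_left_cancel hd
  rw [expand e fun _ => rfl, expand e' fun i => (hmod i).symm, hq]

/-- An ideal containing all `X i ^ m - X (r i) ^ m`, and killed by every substitution
`X i ↦ c i * X (r i)` with `c` a tuple of `m`-th roots of unity, is radical. -/
theorem isRadical_of_forall_aeval_rootsOfUnity {σ : Type*} [Fintype σ] {m : ℕ} (hm : m ≠ 0)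
    (r : σ → σ) (I : Ideal (MvPolynomial σ ℂ)) (hI : ∀ i, X i ^ m - X (r i) ^ m ∈ I)
    (hker : ∀ c : σ → rootsOfUnity m ℂ, ∀ f ∈ I,
      aeval (fun i => C ((c i : ℂˣ) : ℂ) * (X (r i) : MvPolynomial σ ℂ)) f = 0) :
    I.IsRadical := by
  classical
  rintro f ⟨k, hk⟩
  have hf : ∀ c : σ → rootsOfUnity m ℂ,
      aeval (fun i => C ((c i : ℂˣ) : ℂ) * (X (r i) : MvPolynomial σ ℂ)) f = 0 := by
    intro c
    have := hker c _ hk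
    rw [map_pow] at this
    exact eq_zero_of_pow_eq_zero this
  have haeval : ∀ c : σ → rootsOfUnity m ℂ,
      aeval (fun i => C ((c i : ℂˣ) : ℂ) * (X (r i) : MvPolynomial σ ℂ)) f =
        ∑ e ∈ f.support, monomial (e.mapDomain r) (coeff e f * rootsOfUnityMonomialChar m e c) := by
    intro c
    rw [aeval_def, eval₂_eq']
    refine Finset.sum_congr rfl fun e _ => ?_
    have hX : ∏ i, (X (r i) : MvPolynomial σ ℂ) ^ e i = monomial (e.mapDomain r) 1 := by
      rw [monomial_eq, C_1, one_mul,
        Finsupp.prod_mapDomain_index (by simp) (by intros; rw [pow_add]),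
        Finsupp.prod_fintype _ _ (by simp)]
    simp only [mul_pow, Finset.prod_mul_distrib, hX, rootsOfUnityMonomialChar_apply,
      algebraMap_eq, ← map_pow, ← map_prod, C_mul_monomial, mul_one]
  have hcoeff : ∀ d ψ, ∑ e ∈ f.support with e.mapDomain r = d ∧ rootsOfUnityMonomialChar m e = ψ,
      coeff e f = 0 := by
    intro d ψ
    rw [← Finset.filter_filter]
    refine sum_filter_monoidHom_eq_zero _ _ _ (fun c => ?_) ψ
    have h := congrArg (coeff d) ((haeval c).symm.trans (hf c))
    rw [coeff_sum, coeff_zero] at h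
    simpa only [coeff_monomial, Finset.sum_filter] using h
  let π := Ideal.Quotient.mk I
  have hu : ∀ i, π (X i) ^ m = π (X (r i)) ^ m := by
    intro i
    rw [← map_pow, ← map_pow]
    exact Ideal.Quotient.eq.2 (hI i)
  rw [← Ideal.Quotient.eq_zero_iff_mem]
  have hsum : π f = ∑ e ∈ f.support, π (C (coeff e f)) * ∏ i, π (X i) ^ e i := by
    conv_lhs => rw [f.as_sum]
    rw [map_sum]
    refine Finset.sum_congr rfl fun e _ => ?_
    rw [monomial_eq, Finsupp.prod_fintype _ _ (by simp), map_mul, map_prod]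
    simp only [map_pow]
  let key (e : σ →₀ ℕ) := (e.mapDomain r, rootsOfUnityMonomialChar m e)
  change π f = 0
  rw [hsum, ← Finset.sum_fiberwise_of_maps_to
    (fun e he => Finset.mem_image_of_mem key he)]
  refine Finset.sum_eq_zero fun x hx => ?_
  obtain ⟨e₀, -, rfl⟩ := Finset.mem_image.1 hx
  have hprod : ∀ e ∈ f.support.filter (fun e => key e = key e₀),
      π (C (coeff e f)) * ∏ i, π (X i) ^ e i = π (C (coeff e f)) * ∏ i, π (X i) ^ e₀ i := by
    intro e he
    obtain ⟨h1, h2⟩ := Prod.ext_iff.1 (Finset.mem_filter.1 he).2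
    rw [prod_pow_eq_of_mapDomain_eq r _ hu h1
      (mod_eq_of_rootsOfUnityMonomialChar_eq hm h2)]
  rw [Finset.sum_congr rfl hprod, ← Finset.sum_mul, ← map_sum, ← map_sum]
  have h0 := hcoeff (e₀.mapDomain r) (rootsOfUnityMonomialChar m e₀)
  simp only [key, Prod.mk.injEq, h0, map_zero, zero_mul]

/-- For `m ≥ 1` and any partition `λ` of `[n]`, the ideal
`I_λ = ⟨x_i^m - x_j^m : i ≡_λ j⟩` of `ℂ[x_1,…,x_n]` is radical. -/
theorem partition_power_differences_ideal_isRadical (m n : ℕ) (hm : 1 ≤ m) (hn : 1 ≤ n)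
    (P : Finpartition (Finset.univ : Finset (Fin n))) :
    (Ideal.span {f : MvPolynomial (Fin n) ℂ |
        ∃ i j : Fin n, (∃ b ∈ P.parts, i ∈ b ∧ j ∈ b) ∧ f = X i ^ m - X j ^ m}).IsRadical := by
  have hne : ∀ b : P.parts, ∃ x, x ∈ b.1 := fun b => P.nonempty_of_mem_parts b.2
  choose g hg using hne
  let p (i : Fin n) : P.parts := ⟨P.part i, P.part_mem.2 (Finset.mem_univ i)⟩
  refine isRadical_of_forall_aeval_rootsOfUnity (Nat.one_le_iff_ne_zero.1 hm) (fun i => g (p i)) _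
    (fun i => Ideal.subset_span
      ⟨i, _, ⟨(p i).1, (p i).2, P.mem_part (Finset.mem_univ i), hg (p i)⟩, rfl⟩) ?_
  intro c f hf
  rw [← AlgHom.coe_toRingHom, ← RingHom.mem_ker]
  refine Ideal.span_le.2 ?_ hf
  rintro _ ⟨i, j, ⟨b, hb, hi, hj⟩, rfl⟩
  have hij : p i = p j :=
    Subtype.ext ((P.part_eq_of_mem hb hi).trans (P.part_eq_of_mem hb hj).symm)
  have hc : ∀ l, ((c l : ℂˣ) : ℂ) ^ m = 1 := fun l => by
    rw [← Units.val_pow_eq_pow_val, (mem_rootsOfUnity m _).1 (c l).2, Units.val_one]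
  rw [SetLike.mem_coe, RingHom.mem_ker, AlgHom.coe_toRingHom, map_sub, map_pow, map_pow, aeval_X,
    aeval_X, mul_pow, mul_pow, ← C_pow, ← C_pow, hc, hc, hij, sub_self]
end

section
/- Let k be any field, let n ≥ 1 and 0 ≤ p < n. In k[x_0, x_1, ..., x_n], the ideal generated by the products Q_σ = ∏_{i ∈ σ} (x_i^2 − x_0^2), where σ ranges over all subsets of {1, ..., n} of cardinality p+1, equals the intersection ⋂_{τ ⊆ {1,...,n}, |τ| = n−p} ⟨x_i^2 − x_0^2 : i ∈ τ⟩. -/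
open MvPolynomial

/-- Enlarging the index set of a squarefree product ideal enlarges the ideal. -/
theorem span_prod_card_mono {R ι : Type*} [CommRing R] (y : ι → R) {S S' : Finset ι}
    (h : S' ⊆ S) (q : ℕ) :
    Ideal.span {f | ∃ σ ⊆ S', σ.card = q ∧ f = ∏ i ∈ σ, y i} ≤
      Ideal.span {f | ∃ σ ⊆ S, σ.card = q ∧ f = ∏ i ∈ σ, y i} :=
  Ideal.span_mono fun _ ⟨σ, hσ, hc, hf⟩ => ⟨σ, hσ.trans h, hc, hf⟩

/-- A `q`-fold product indexed by a subset of `S` lies in the ideal generated by any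
family `τ ⊆ S` that is too large to be disjoint from the subset. -/
theorem prod_mem_span_image {R ι : Type*} [CommRing R] [DecidableEq ι] (y : ι → R)
    {S σ τ : Finset ι} (hσ : σ ⊆ S) (hτ : τ ⊆ S) (hc : S.card < τ.card + σ.card) :
    ∏ i ∈ σ, y i ∈ Ideal.span (y '' (τ : Set ι)) := by
  obtain ⟨i, hi⟩ : (τ ∩ σ).Nonempty := by
    by_contra hne
    have hd : Disjoint τ σ := by
      rwa [Finset.disjoint_iff_inter_eq_empty, ← Finset.not_nonempty_iff_eq_empty]
    have := Finset.card_le_card (Finset.union_subset hτ hσ)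
    rw [Finset.card_union_of_disjoint hd] at this
    omega
  rw [Finset.mem_inter] at hi
  exact Ideal.mem_of_dvd _ (Finset.dvd_prod_of_mem y hi.2)
    (Ideal.subset_span ⟨i, hi.1, rfl⟩)

/-- Multiplying by `y a` turns `q`-fold products over `S` into `(q + 1)`-fold products over
`insert a S`. -/
theorem mul_mem_span_prod_insert {R ι : Type*} [CommRing R] [DecidableEq ι] (y : ι → R)
    {S : Finset ι} {a : ι} (ha : a ∉ S) (q : ℕ) {u : R}
    (hu : u ∈ Ideal.span {f | ∃ σ ⊆ S, σ.card = q ∧ f = ∏ i ∈ σ, y i}) :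
    u * y a ∈ Ideal.span {f | ∃ σ ⊆ insert a S, σ.card = q + 1 ∧ f = ∏ i ∈ σ, y i} := by
  induction hu using Submodule.span_induction with
  | mem x hx =>
    obtain ⟨σ, hσ, hσc, rfl⟩ := hx
    have haσ : a ∉ σ := fun h => ha (hσ h)
    refine Ideal.subset_span ⟨insert a σ, Finset.insert_subset_insert a hσ, ?_, ?_⟩
    · rw [Finset.card_insert_of_notMem haσ, hσc]
    · rw [Finset.prod_insert haσ, mul_comm]
  | zero => simp
  | add x z _ _ hx hz =>
    rw [add_mul]
    exact Ideal.add_mem _ hx hz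
  | smul r x _ hx =>
    rw [smul_eq_mul, mul_assoc]
    exact Ideal.mul_mem_left _ _ hx

/-- If the elements `y i`, `i ∈ U`, form a regular sequence in any order, then modulo
`⟨y i : i ∈ T⟩` the intersection of the ideals `⟨y i : i ∈ τ⟩` with `τ ⊆ S` of cardinality
greater than `|S| - q` is contained in the ideal of the `q`-fold products over `S`. -/
theorem mem_span_prod_sup_of_forall_mem {R ι : Type*} [CommRing R] [DecidableEq ι]
    (y : ι → R) (U : Finset ι)
    (hreg : ∀ T ⊆ U, ∀ a ∈ U, a ∉ T → ∀ h : R,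
      y a * h ∈ Ideal.span (y '' (T : Set ι)) → h ∈ Ideal.span (y '' (T : Set ι)))
    (S : Finset ι) : ∀ (q : ℕ) (T : Finset ι), S ⊆ U → T ⊆ U → Disjoint S T → ∀ f : R,
      (∀ τ ⊆ S, S.card < τ.card + q → f ∈ Ideal.span (y '' ((τ ∪ T : Finset ι) : Set ι))) →
      f ∈ Ideal.span {f | ∃ σ ⊆ S, σ.card = q ∧ f = ∏ i ∈ σ, y i} ⊔
        Ideal.span (y '' (T : Set ι)) := by
  induction S using Finset.induction_on with
  | empty =>
    rintro (_ | q) T - - - f hf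
    · have h1 : (1 : R) ∈ Ideal.span {f | ∃ σ ⊆ (∅ : Finset ι), σ.card = 0 ∧
          f = ∏ i ∈ σ, y i} := Ideal.subset_span ⟨∅, by simp⟩
      rw [(Ideal.eq_top_iff_one _).2 h1]
      simp
    · exact Ideal.mem_sup_right (by simpa using hf ∅ subset_rfl (by simp))
  | insert a S ha ih =>
    rintro (_ | q) T hS hT hST f hf
    · have h1 : (1 : R) ∈ Ideal.span {f | ∃ σ ⊆ insert a S, σ.card = 0 ∧
          f = ∏ i ∈ σ, y i} := Ideal.subset_span ⟨∅, by simp⟩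
      rw [(Ideal.eq_top_iff_one _).2 h1]
      simp
    · rw [Finset.insert_subset_iff] at hS
      rw [Finset.disjoint_insert_left] at hST
      have hmod := ih (q + 1) (insert a T) hS.2 (Finset.insert_subset hS.1 hT)
        (by rw [Finset.disjoint_insert_right]; exact ⟨ha, hST.2⟩) f (by
          intro τ hτ hc
          have := hf (insert a τ) (Finset.insert_subset_insert a hτ) (by
            rw [Finset.card_insert_of_notMem ha,
              Finset.card_insert_of_notMem fun h => ha (hτ h)]
            omega)
          rwa [Finset.insert_union, ← Finset.union_insert] at this)
      obtain ⟨g, hg, r, hr, rfl⟩ := Submodule.mem_sup.1 hmod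
      rw [Finset.coe_insert, Set.image_insert_eq, Ideal.mem_span_insert] at hr
      obtain ⟨h, c, hcT, rfl⟩ := hr
      have hh := ih q T hS.2 hT hST.2 h (by
        intro τ hτ hc
        refine hreg _ (Finset.union_subset (hτ.trans hS.2) hT) a hS.1
          (by rw [Finset.mem_union]; exact fun h => h.elim (fun h => ha (hτ h)) hST.1) h ?_
        have hgτ : g ∈ Ideal.span (y '' ((τ ∪ T : Finset ι) : Set ι)) := by
          refine Ideal.span_mono (Set.image_mono (by simp)) (?_ : g ∈ Ideal.span (y '' τ))
          refine Ideal.span_le.2 ?_ hg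
          rintro _ ⟨σ, hσ, hσc, rfl⟩
          exact prod_mem_span_image y hσ hτ (by omega)
        have hcτ : c ∈ Ideal.span (y '' ((τ ∪ T : Finset ι) : Set ι)) :=
          Ideal.span_mono (Set.image_mono (by simp)) hcT
        have hfτ := hf τ (hτ.trans (Finset.subset_insert a S)) (by
          rw [Finset.card_insert_of_notMem ha]; omega)
        have := Ideal.sub_mem _ (Ideal.sub_mem _ hfτ hgτ) hcτ
        convert this using 1
        ring)
      have hah : h * y a ∈ Ideal.span {f | ∃ σ ⊆ insert a S, σ.card = q + 1 ∧
          f = ∏ i ∈ σ, y i} ⊔ Ideal.span (y '' (T : Set ι)) := by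
        obtain ⟨u, hu, v, hv, rfl⟩ := Submodule.mem_sup.1 hh
        rw [add_mul]
        refine Ideal.add_mem _ (Ideal.mem_sup_left ?_)
          (Ideal.mem_sup_right (Ideal.mul_mem_right _ _ hv))
        exact mul_mem_span_prod_insert y ha q hu
      refine Ideal.add_mem _ (Ideal.mem_sup_left ?_)
        (Ideal.add_mem _ hah (Ideal.mem_sup_right hcT))
      exact span_prod_card_mono y (Finset.subset_insert a S) _ hg

/-- `x_a ^ 2 - x_b ^ 2` is a nonzerodivisor modulo the ideal generated by elements
`x_i ^ 2 - x_b ^ 2` whose indices `i` differ from `a`. -/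
theorem mem_span_of_X_sq_sub_X_sq_mul_mem {ι k : Type*} [CommRing k] [DecidableEq ι]
    {a b : ι} (hab : b ≠ a) (T : Set ι) (haT : a ∉ T) (h : MvPolynomial ι k)
    (hmem : (X a ^ 2 - X b ^ 2) * h ∈
      Ideal.span ((fun i => (X i ^ 2 - X b ^ 2 : MvPolynomial ι k)) '' T)) :
    h ∈ Ideal.span ((fun i => (X i ^ 2 - X b ^ 2 : MvPolynomial ι k)) '' T) := by
  set I := Ideal.span ((fun i => (X i ^ 2 - X b ^ 2 : MvPolynomial ι k)) '' T)
  let φ : MvPolynomial ι k →ₐ[k] Polynomial (MvPolynomial ι k ⧸ I) :=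
    aeval fun i => if i = a then Polynomial.X else Polynomial.C (Ideal.Quotient.mk I (X i))
  have hφI : I ≤ RingHom.ker φ := by
    refine Ideal.span_le.2 ?_
    rintro _ ⟨i, hi, rfl⟩
    have hia : i ≠ a := fun h => haT (h ▸ hi)
    have h0 : Ideal.Quotient.mk I (X i ^ 2 - X b ^ 2) = 0 :=
      Ideal.Quotient.eq_zero_iff_mem.2 (Ideal.subset_span ⟨i, hi, rfl⟩)
    simp only [SetLike.mem_coe, RingHom.mem_ker, φ, map_sub, map_pow, aeval_X, if_neg hia,
      if_neg hab]
    simp only [← map_pow, ← map_sub, h0, map_zero]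
  have hmonic : (φ (X a ^ 2 - X b ^ 2)).Monic := by
    simp only [φ, map_sub, map_pow, aeval_X, if_neg hab, if_true]
    rw [← map_pow]
    exact Polynomial.monic_X_pow_sub_C _ two_ne_zero
  have hφh : φ h = 0 := by
    have := hφI hmem
    rw [RingHom.mem_ker, map_mul] at this
    exact (hmonic.mul_right_eq_zero_iff).1 this
  have hcomp : (((Polynomial.aeval (Ideal.Quotient.mk I (X a))).restrictScalars k).comp φ :
      MvPolynomial ι k →ₐ[k] MvPolynomial ι k ⧸ I) = Ideal.Quotient.mkₐ k I := by
    ext i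
    by_cases hi : i = a
    · subst hi; simp [φ]
    · simp [φ, hi]
  have := DFunLike.congr_fun hcomp h
  simp only [AlgHom.comp_apply, hφh, map_zero] at this
  exact Ideal.Quotient.eq_zero_iff_mem.1 this.symm

/-- Over any field `k`, the ideal of `k[x_0,…,x_n]` generated by the products
`Q_σ = ∏_{i ∈ σ} (x_i^2 - x_0^2)`, `σ` running over subsets of `{1,…,n}` of cardinality
`p+1`, equals the intersection `⋂_{τ ⊆ {1,…,n}, |τ| = n-p} ⟨x_i^2 - x_0^2 : i ∈ τ⟩`. -/
theorem skeleton_ideal_eq_inf (k : Type*) [Field k] (n p : ℕ) (hn : 1 ≤ n) (hpn : p < n) :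
    Ideal.span {f : MvPolynomial (Fin (n + 1)) k |
        ∃ σ : Finset (Fin (n + 1)), 0 ∉ σ ∧ σ.card = p + 1 ∧
          f = ∏ i ∈ σ, (X i ^ 2 - X 0 ^ 2)} =
      ⨅ τ : {τ : Finset (Fin (n + 1)) // 0 ∉ τ ∧ τ.card = n - p},
        Ideal.span {f : MvPolynomial (Fin (n + 1)) k |
          ∃ i ∈ τ.1, f = X i ^ 2 - X 0 ^ 2} := by
  let y : Fin (n + 1) → MvPolynomial (Fin (n + 1)) k := fun i => X i ^ 2 - X 0 ^ 2
  let U : Finset (Fin (n + 1)) := Finset.univ.erase 0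
  have hU : U.card = n := by simp [U]
  have hsub : ∀ σ : Finset (Fin (n + 1)), σ ⊆ U ↔ 0 ∉ σ := fun σ => by
    simp [U, Finset.subset_erase]
  have himage : ∀ τ : Finset (Fin (n + 1)),
      {f : MvPolynomial (Fin (n + 1)) k | ∃ i ∈ τ, f = X i ^ 2 - X 0 ^ 2} = y '' τ := by
    intro τ
    ext f
    simp [y, eq_comm]
  simp only [himage]
  apply le_antisymm
  · rw [Ideal.span_le]
    rintro _ ⟨σ, hσ, hσc, rfl⟩
    simp only [SetLike.mem_coe, Ideal.mem_iInf]
    rintro ⟨τ, hτ, hτc⟩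
    exact prod_mem_span_image y ((hsub σ).2 hσ) ((hsub τ).2 hτ)
      (by rw [hU, hτc, hσc]; omega)
  · intro f hf
    rw [Ideal.mem_iInf] at hf
    have key := mem_span_prod_sup_of_forall_mem y U (fun T _ a ha haT h hm =>
      mem_span_of_X_sq_sub_X_sq_mul_mem (Finset.ne_of_mem_erase ha).symm T
        (by simpa using haT) h hm) U (p + 1) ∅ subset_rfl (by simp) (by simp) f (by
      intro τ hτ hc
      obtain ⟨τ', hτ', hc'⟩ := Finset.exists_subset_card_eq (show n - p ≤ τ.card by omega)
      have := hf ⟨τ', (hsub τ').1 (hτ'.trans hτ), hc'⟩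
      exact Ideal.span_mono (Set.image_mono (by simpa using hτ')) this)
    simpa [hsub, y] using key
end

section
/- Let k be a field with char k ≠ 2, let n ≥ 1 and 0 ≤ p < n. Then the ideal of k[x_0, x_1, ..., x_n] generated by the products Q_σ = ∏_{i ∈ σ} (x_i^2 − x_0^2), where σ ranges over all subsets of {1, ..., n} of cardinality p+1, is a radical ideal. -/
open MvPolynomial

section PolynomialExtension

variable {B : Type*} [CommRing B]

theorem Ideal.map_polynomialC_eq_ker (K : Ideal B) :
    K.map (Polynomial.C : B →+* Polynomial B) =
      RingHom.ker (Polynomial.mapRingHom (Ideal.Quotient.mk K)) := by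
  rw [Polynomial.ker_mapRingHom, Ideal.mk_ker]

/-- The extension of a radical ideal to the polynomial ring is radical. -/
theorem Ideal.IsRadical.map_polynomialC {K : Ideal B} (hK : K.IsRadical) :
    (K.map (Polynomial.C : B →+* Polynomial B)).IsRadical := by
  have : IsReduced (B ⧸ K) := (Ideal.isRadical_iff_quotient_reduced K).mp hK
  have : IsReduced (Polynomial (B ⧸ K)) := ⟨fun f hf => by
    ext i
    exact (Polynomial.isNilpotent_iff.mp hf i).eq_zero⟩
  rw [Ideal.map_polynomialC_eq_ker]
  exact RingHom.ker_isRadical_iff_reduced_of_surjective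
    (Polynomial.map_surjective _ Ideal.Quotient.mk_surjective) |>.mpr inferInstance

/-- A monic polynomial is a nonzerodivisor modulo an extended ideal. -/
theorem Polynomial.Monic.mem_map_C_of_mul_mem {K : Ideal B} {m g : Polynomial B}
    (hm : m.Monic) (h : m * g ∈ K.map (Polynomial.C : B →+* Polynomial B)) :
    g ∈ K.map (Polynomial.C : B →+* Polynomial B) := by
  rw [Ideal.map_polynomialC_eq_ker, RingHom.mem_ker, map_mul] at h
  rw [Ideal.map_polynomialC_eq_ker, RingHom.mem_ker]
  exact ((hm.map (Ideal.Quotient.mk K)).mul_right_eq_zero_iff).mp h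

/-- For `J ≤ K`, the ideal `J[X] + (X² - a²) K[X]` consists of the polynomials with coefficients
in `K` whose values at `a` and `-a` lie in `J`. -/
theorem Ideal.map_C_sup_span_mul_eq {J K : Ideal B} (hJK : J ≤ K) {a : B}
    (h2 : IsUnit (2 : B)) (ha : ∀ b, a * b ∈ J → b ∈ J) :
    J.map (Polynomial.C : B →+* Polynomial B) ⊔
        Ideal.span {Polynomial.X ^ 2 - Polynomial.C a ^ 2} *
          K.map (Polynomial.C : B →+* Polynomial B) =
      K.map (Polynomial.C : B →+* Polynomial B) ⊓
        (J.comap (Polynomial.evalRingHom a) ⊓ J.comap (Polynomial.evalRingHom (-a))) := by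
  have two_mem (b : B) (h : 2 * b ∈ J) : b ∈ J := (Ideal.unit_mul_mem_iff_mem J h2).mp h
  have map_le (c : B) : J.map (Polynomial.C : B →+* Polynomial B) ≤
      J.comap (Polynomial.evalRingHom c) := by
    rw [Ideal.map_le_iff_le_comap]
    intro b hb
    simpa using hb
  apply le_antisymm
  · refine sup_le (le_inf (Ideal.map_mono hJK) (le_inf (map_le a) (map_le (-a))))
      (le_inf Ideal.mul_le_right (le_inf ?_ ?_))
    all_goals
      refine Ideal.mul_le_left.trans ?_
      rw [Ideal.span_singleton_le_iff_mem, Ideal.mem_comap]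
      simp
  · rintro f ⟨hfK, hfa, hfna⟩
    rcases subsingleton_or_nontrivial B with hB | hB
    · rw [Subsingleton.elim f 0]
      exact zero_mem _
    set m : Polynomial B := Polynomial.X ^ 2 - Polynomial.C a ^ 2 with hm_def
    have hm_eq : m = Polynomial.X ^ 2 - Polynomial.C (a ^ 2) := by simp [hm_def]
    have hm : m.Monic := hm_eq ▸ Polynomial.monic_X_pow_sub_C _ two_ne_zero
    have hdeg : (f %ₘ m).natDegree ≤ 1 := by
      have h := Polynomial.natDegree_modByMonic_lt f hm (by
        intro h
        have := congrArg Polynomial.natDegree h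
        rw [hm_eq, Polynomial.natDegree_X_pow_sub_C] at this
        simp at this)
      rw [hm_eq, Polynomial.natDegree_X_pow_sub_C, ← hm_eq] at h
      omega
    obtain ⟨c, d, hcd⟩ := Polynomial.exists_eq_X_add_C_of_natDegree_le_one hdeg
    have hf : f = Polynomial.C c * Polynomial.X + Polynomial.C d + m * (f /ₘ m) := by
      rw [← hcd, Polynomial.modByMonic_add_div]
    have hva : c * a + d ∈ J := by
      rw [SetLike.mem_coe, Ideal.mem_comap, hf] at hfa
      simpa [hm_def] using hfa
    have hvna : -(c * a) + d ∈ J := by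
      rw [SetLike.mem_coe, Ideal.mem_comap, hf] at hfna
      simpa [hm_def] using hfna
    have hd : d ∈ J := two_mem d (by convert J.add_mem hva hvna using 1; ring)
    have hc : c ∈ J := ha c (by convert J.sub_mem hva hd using 1; ring)
    have hr : Polynomial.C c * Polynomial.X + Polynomial.C d ∈
        J.map (Polynomial.C : B →+* Polynomial B) :=
      add_mem (Ideal.mul_mem_right _ _ (Ideal.mem_map_of_mem _ hc)) (Ideal.mem_map_of_mem _ hd)
    have hg : m * (f /ₘ m) ∈ K.map (Polynomial.C : B →+* Polynomial B) := by
      have h := sub_mem hfK (Ideal.map_mono hJK hr)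
      rwa [sub_eq_of_eq_add' hf] at h
    rw [hf]
    exact add_mem (Ideal.mem_sup_left hr) (Ideal.mem_sup_right
      (Ideal.mul_mem_mul (Ideal.mem_span_singleton_self m) (hm.mem_map_C_of_mul_mem hg)))

end PolynomialExtension

/-- The ideal of `R[x_0,…,x_{n-1}]` generated by the products of `q` distinct elements among the
`x_i² - a²`. -/
noncomputable def quadricProductIdeal {R : Type*} [CommRing R] (a : R) (n q : ℕ) :
    Ideal (MvPolynomial (Fin n) R) :=
  Ideal.span {f | ∃ σ : Finset (Fin n), σ.card = q ∧ f = ∏ i ∈ σ, (X i ^ 2 - C a ^ 2)}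

theorem Fin.exists_eq_map_succEmb {n : ℕ} {σ : Finset (Fin (n + 1))} (h : 0 ∉ σ) :
    ∃ τ : Finset (Fin n), σ = τ.map (Fin.succEmb n) := by
  obtain ⟨τ, -, hτ⟩ := Finset.subset_map_iff (s := σ) (t := Finset.univ)
    (f := Fin.succEmb n) |>.mp (by
      intro i hi
      obtain ⟨j, rfl⟩ := Fin.exists_succ_eq.mpr (ne_of_mem_of_not_mem hi h)
      simp)
  exact ⟨τ, hτ⟩

section QuadricProductIdeal

variable {R : Type*} [CommRing R] (a : R)

theorem quadricProductIdeal_zero (n : ℕ) : quadricProductIdeal a n 0 = ⊤ :=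
  (Ideal.eq_top_iff_one _).mpr (Ideal.subset_span ⟨∅, by simp⟩)

theorem quadricProductIdeal_succ_le (n q : ℕ) :
    quadricProductIdeal a n (q + 1) ≤ quadricProductIdeal a n q := by
  refine Ideal.span_le.mpr ?_
  rintro _ ⟨σ, hσ, rfl⟩
  obtain ⟨i, hi⟩ : σ.Nonempty := Finset.card_pos.mp (by omega)
  rw [← Finset.mul_prod_erase σ _ hi]
  exact Ideal.mul_mem_left _ _
    (Ideal.subset_span ⟨σ.erase i, by rw [Finset.card_erase_of_mem hi, hσ]; rfl, rfl⟩)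

theorem map_finSuccEquiv_quadricProductIdeal (n q : ℕ) :
    (quadricProductIdeal a (n + 1) (q + 1)).map (finSuccEquiv R n).toRingEquiv =
      (quadricProductIdeal a n (q + 1)).map Polynomial.C ⊔
        Ideal.span {Polynomial.X ^ 2 - Polynomial.C (C a) ^ 2} *
          (quadricProductIdeal a n q).map Polynomial.C := by
  have hC (r : R) : finSuccEquiv R n (C r) = Polynomial.C (C r) := by
    simp [finSuccEquiv_apply]
  have map_prod_succ (τ : Finset (Fin n)) :
      finSuccEquiv R n (∏ i ∈ τ.map (Fin.succEmb n), (X i ^ 2 - C a ^ 2)) =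
        Polynomial.C (∏ i ∈ τ, (X i ^ 2 - C a ^ 2)) := by
    simp [Finset.prod_map, map_prod, finSuccEquiv_X_succ, hC]
  have map_prod_cons (τ : Finset (Fin n)) :
      finSuccEquiv R n (∏ i ∈ (τ.map (Fin.succEmb n)).cons 0 (by simp), (X i ^ 2 - C a ^ 2)) =
        (Polynomial.X ^ 2 - Polynomial.C (C a) ^ 2) *
          Polynomial.C (∏ i ∈ τ, (X i ^ 2 - C a ^ 2)) := by
    rw [Finset.prod_cons, map_mul, map_prod_succ]
    simp [finSuccEquiv_X_zero, hC]
  apply le_antisymm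
  · rw [quadricProductIdeal, Ideal.map_span, Ideal.span_le]
    rintro _ ⟨_, ⟨σ, hσ, rfl⟩, rfl⟩
    by_cases h0 : 0 ∈ σ
    · obtain ⟨τ, hτ⟩ := Fin.exists_eq_map_succEmb (Finset.notMem_erase 0 σ)
      have hσ' : σ = (τ.map (Fin.succEmb n)).cons 0 (by simp) := by
        rw [Finset.cons_eq_insert, ← hτ, Finset.insert_erase h0]
      subst hσ'
      refine Ideal.mem_sup_right ?_
      have h := map_prod_cons τ
      exact (Eq.symm h) ▸ Ideal.mul_mem_mul (Ideal.mem_span_singleton_self _)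
        (Ideal.mem_map_of_mem _ (Ideal.subset_span ⟨τ, by simpa using hσ, rfl⟩))
    · obtain ⟨τ, rfl⟩ := Fin.exists_eq_map_succEmb h0
      refine Ideal.mem_sup_left ?_
      have h := map_prod_succ τ
      exact (Eq.symm h) ▸ Ideal.mem_map_of_mem _
        (Ideal.subset_span ⟨τ, by simpa using hσ, rfl⟩)
  · refine sup_le ?_ ?_
    · rw [quadricProductIdeal, Ideal.map_span, Ideal.span_le]
      rintro _ ⟨_, ⟨τ, hτ, rfl⟩, rfl⟩
      rw [← map_prod_succ]
      exact Ideal.mem_map_of_mem (finSuccEquiv R n).toRingEquiv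
        (Ideal.subset_span ⟨_, by simpa using hτ, rfl⟩)
    · rw [quadricProductIdeal, quadricProductIdeal, Ideal.map_span, Ideal.span_mul_span',
        Ideal.span_le]
      rintro _ ⟨_, rfl, _, ⟨_, ⟨τ, hτ, rfl⟩, rfl⟩, rfl⟩
      have h := map_prod_cons τ
      rw [SetLike.mem_coe]
      beta_reduce
      rw [← h]
      exact Ideal.mem_map_of_mem (finSuccEquiv R n).toRingEquiv
        (Ideal.subset_span ⟨_, by simpa using hτ, rfl⟩)

/-- Over a domain in which `2` is invertible and for `a ≠ 0`, the ideal `quadricProductIdeal a n q`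
is radical and `a` is a nonzerodivisor modulo it. -/
theorem quadricProductIdeal_isRadical [IsDomain R] (h2 : IsUnit (2 : R)) {a : R} (ha : a ≠ 0)
    (n q : ℕ) :
    (quadricProductIdeal a n q).IsRadical ∧
      ∀ b, C a * b ∈ quadricProductIdeal a n q → b ∈ quadricProductIdeal a n q := by
  induction n generalizing q with
  | zero =>
    cases q with
    | zero => simp [quadricProductIdeal_zero, Ideal.IsRadical]
    | succ q =>
      have hbot : quadricProductIdeal a 0 (q + 1) = ⊥ := by
        rw [quadricProductIdeal, Ideal.span_eq_bot]
        rintro _ ⟨σ, hσ, rfl⟩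
        simp [Finset.eq_empty_of_isEmpty σ] at hσ
      rw [hbot]
      exact ⟨Ideal.isPrime_bot.isRadical, fun b hb => by simpa [ha] using hb⟩
  | succ n ih =>
    cases q with
    | zero => simp [quadricProductIdeal_zero, Ideal.IsRadical]
    | succ q =>
      have h2' : IsUnit (2 : MvPolynomial (Fin n) R) := by
        exact map_ofNat (C : R →+* MvPolynomial (Fin n) R) 2 ▸ h2.map C
      obtain ⟨hJ, hJa⟩ := ih (q + 1)
      obtain ⟨hK, hKa⟩ := ih q
      have hcomap : quadricProductIdeal a (n + 1) (q + 1) =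
          Ideal.comap (finSuccEquiv R n).toRingEquiv _ :=
        (Ideal.comap_map_of_bijective _ (finSuccEquiv R n).toRingEquiv.bijective).symm
      rw [map_finSuccEquiv_quadricProductIdeal, Ideal.map_C_sup_span_mul_eq
        (quadricProductIdeal_succ_le a n q) h2' hJa] at hcomap
      rw [hcomap]
      refine ⟨(hK.map_polynomialC.inf ((hJ.comap _).inf (hJ.comap _))).comap _, ?_⟩
      intro b hb
      have hC : finSuccEquiv R n (C a) = Polynomial.C (C a) := by
        simp [finSuccEquiv_apply]
      obtain ⟨hbK, hbJ, hbJ'⟩ := hb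
      refine ⟨?_, ?_, ?_⟩
      · refine Ideal.mem_map_C_iff.mpr fun i => hKa _ ?_
        have h := Ideal.mem_map_C_iff.mp hbK i
        simpa [hC] using h
      · refine hJa _ ?_
        simpa [hC] using hbJ
      · refine hJa _ ?_
        simpa [hC] using hbJ'

end QuadricProductIdeal

/-- Over a field `k` of characteristic `≠ 2`, the ideal of `k[x_0,…,x_n]` generated by
the products `Q_σ = ∏_{i ∈ σ} (x_i^2 - x_0^2)`, `σ` running over subsets of `{1,…,n}`
of cardinality `p+1`, is a radical ideal. -/
theorem skeleton_ideal_isRadical (k : Type*) [Field k] (h2 : (2 : k) ≠ 0)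
    (n p : ℕ) (hn : 1 ≤ n) (hpn : p < n) :
    (Ideal.span {f : MvPolynomial (Fin (n + 1)) k |
        ∃ σ : Finset (Fin (n + 1)), 0 ∉ σ ∧ σ.card = p + 1 ∧
          f = ∏ i ∈ σ, (X i ^ 2 - X 0 ^ 2)}).IsRadical := by
  let e : MvPolynomial (Fin (n + 1)) k ≃+* MvPolynomial (Fin n) (Polynomial k) :=
    ((renameEquiv k (_root_.finSuccEquiv n)).trans (optionEquivRight k (Fin n))).toRingEquiv
  have he0 : e (X 0) = C Polynomial.X := by
    simp [e]
  have heS (i : Fin n) : e (X i.succ) = X i := by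
    simp [e]
  have he_prod (τ : Finset (Fin n)) :
      e (∏ i ∈ τ.map (Fin.succEmb n), (X i ^ 2 - X 0 ^ 2)) =
        ∏ i ∈ τ, (X i ^ 2 - C Polynomial.X ^ 2) := by
    simp [Finset.prod_map, map_prod, he0, heS]
  have h2' : IsUnit (2 : Polynomial k) := by
    exact map_ofNat (Polynomial.C : k →+* Polynomial k) 2 ▸ h2.isUnit.map Polynomial.C
  convert (quadricProductIdeal_isRadical h2' (Polynomial.X_ne_zero (R := k))
    n (p + 1)).1.comap e using 1
  rw [← Ideal.map_symm, quadricProductIdeal, Ideal.map_span]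
  congr 1
  ext f
  constructor
  · rintro ⟨σ, h0, hσ, rfl⟩
    obtain ⟨τ, rfl⟩ := Fin.exists_eq_map_succEmb h0
    exact ⟨_, ⟨τ, by simpa using hσ, rfl⟩, e.symm_apply_eq.mpr (he_prod τ).symm⟩
  · rintro ⟨_, ⟨τ, hτ, rfl⟩, rfl⟩
    exact ⟨τ.map (Fin.succEmb n), by simp, by simpa using hτ,
      e.symm_apply_eq.mpr (he_prod τ).symm⟩
end
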